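/- Let D be a domain in ℂⁿ and let a₁,…,a_m : D → ℂ be continuous functions such that the set 𝓔 = {(z,w) ∈ D × ℂ : wᵐ + a₁(z)w^{m−1} + ⋯ + a_m(z) = 0} is pluripolar in ℂ^{n+1}. If there exists a point z₀ ∈ D such that the polynomial w ↦ wᵐ + a₁(z₀)w^{m−1} + ⋯ + a_m(z₀) has m pairwise distinct roots, then a₁,…,a_m are holomorphic on D. -/

import Mathlib

open Metric Set Polynomial

noncomputable section

/-- A function `u : ℂ → EReal` is subharmonic on an open set `U` if it is upper
semicontinuous on `U` and satisfies the maximum principle with respect to harmonic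
majorants of the form `Re p`, `p` a complex polynomial, on every closed disc in `U`. -/
def SubharmonicOn (u : ℂ → EReal) (U : Set ℂ) : Prop :=
  UpperSemicontinuousOn u U ∧
    ∀ (c : ℂ) (r : ℝ), 0 < r → closedBall c r ⊆ U →
      ∀ p : Polynomial ℂ,
        (∀ z ∈ sphere c r, u z ≤ (((p.eval z).re : ℝ) : EReal)) →
        ∀ z ∈ closedBall c r, u z ≤ (((p.eval z).re : ℝ) : EReal)

/-- `u : ℂ^N → [-∞, ∞)` is plurisubharmonic if it is upper semicontinuous, takes values
in `[-∞, ∞)`, and its restriction to every complex affine line is subharmonic. -/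
def Plurisubharmonic {N : ℕ} (u : (Fin N → ℂ) → EReal) : Prop :=
  UpperSemicontinuous u ∧ (∀ z, u z ≠ ⊤) ∧
    ∀ a b : Fin N → ℂ, SubharmonicOn (fun t : ℂ => u (a + t • b)) Set.univ

/-- A set `E ⊆ ℂ^N` is pluripolar if there is a plurisubharmonic function on `ℂ^N`,
not identically `-∞`, which is `-∞` on `E`. -/
def Pluripolar {N : ℕ} (E : Set (Fin N → ℂ)) : Prop :=
  ∃ u : (Fin N → ℂ) → EReal,
    Plurisubharmonic u ∧ ¬ (∀ z, u z = ⊥) ∧ ∀ z ∈ E, u z = ⊥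



/-- Density of real parts of polynomials on circles. -/
theorem exists_poly_approx (k : ℂ → ℝ) (c : ℂ) (r : ℝ) (hr : 0 < r)
    (hk : ContinuousOn k (sphere c r)) (ε : ℝ) (hε : 0 < ε) :
    ∃ p : ℂ[X], ∀ z ∈ sphere c r, |k z - (p.eval z).re| < ε := by
  have : Fact (0 < 2 * Real.pi) := ⟨Real.two_pi_pos⟩
  have hcm : ∀ x : AddCircle (2 * Real.pi), c + r * (x.toCircle : ℂ) ∈ sphere c r := by
    intro x; simp [abs_of_pos hr, Circle.norm_coe]
  have hcont : Continuous (fun x : AddCircle (2 * Real.pi) => ((k (c + r * (x.toCircle : ℂ)) : ℝ) : ℂ)) := by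
    apply Complex.continuous_ofReal.comp
    refine hk.comp_continuous ?_ hcm
    have := AddCircle.continuous_toCircle (T := 2 * Real.pi)
    fun_prop
  let G : C(AddCircle (2 * Real.pi), ℂ) := ⟨_, hcont⟩
  have hG : G ∈ (Submodule.span ℂ (range <| @fourier (2 * Real.pi))).topologicalClosure := by
    rw [span_fourier_closure_eq_top]; trivial
  rw [← SetLike.mem_coe, Submodule.topologicalClosure_coe, Metric.mem_closure_iff] at hG
  obtain ⟨g, hg, hgd⟩ := hG ε hε
  have key : ∀ a : ℂ, ∃ p : ℂ[X], ∀ x : AddCircle (2 * Real.pi),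
      (a * g x).re = (p.eval (c + r * (x.toCircle : ℂ))).re := by
    refine Submodule.span_induction
      (p := fun g _ => ∀ a : ℂ, ∃ p : ℂ[X], ∀ x : AddCircle (2 * Real.pi),
      (a * g x).re = (p.eval (c + r * (x.toCircle : ℂ))).re) ?_ ?_ ?_ ?_ hg
    · rintro _ ⟨n, rfl⟩ a
      have hrne : (r : ℂ) ≠ 0 := by exact_mod_cast hr.ne'
      rcases Int.eq_nat_or_neg n with ⟨m, rfl | rfl⟩
      · refine ⟨C a * ((X - C c) * C (r : ℂ)⁻¹) ^ m, fun x => ?_⟩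
        simp only [eval_mul, eval_C, eval_pow, eval_sub, eval_X]
        have : (c + r * (x.toCircle : ℂ) - c) * (r : ℂ)⁻¹ = x.toCircle := by
          field_simp; ring
        rw [this, fourier_apply, AddCircle.toCircle_zsmul]
        simp
      · refine ⟨C (starRingEnd ℂ a) * ((X - C c) * C (r : ℂ)⁻¹) ^ m, fun x => ?_⟩
        simp only [eval_mul, eval_C, eval_pow, eval_sub, eval_X]
        have : (c + r * (x.toCircle : ℂ) - c) * (r : ℂ)⁻¹ = x.toCircle := by
          field_simp; ring
        rw [this, fourier_apply, AddCircle.toCircle_zsmul]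
        rw [← Complex.conj_re (a * _)]
        congr 1
        simp [← Circle.coe_inv_eq_conj]
    · intro a; exact ⟨0, by simp⟩
    · intro f g _ _ hf hg a
      obtain ⟨p, hp⟩ := hf a
      obtain ⟨q, hq⟩ := hg a
      refine ⟨p + q, fun x => ?_⟩
      rw [eval_add, Complex.add_re, ← hp, ← hq, ContinuousMap.add_apply, mul_add, Complex.add_re]
    · intro b f _ hf a
      obtain ⟨p, hp⟩ := hf (a * b)
      refine ⟨p, fun x => ?_⟩
      rw [← hp, ContinuousMap.smul_apply, smul_eq_mul, mul_assoc]
  obtain ⟨p, hp⟩ := key 1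
  refine ⟨p, fun z hz => ?_⟩
  obtain ⟨θ, hθ⟩ : ∃ θ : ℝ, z = c + r * ((AddCircle.toCircle (θ : AddCircle (2 * Real.pi)) : Circle) : ℂ) := by
    refine ⟨(z - c).arg, ?_⟩
    have h1 : ‖z - c‖ = r := by simpa [dist_eq_norm] using hz
    have := Complex.norm_mul_exp_arg_mul_I (z - c)
    rw [h1] at this
    rw [AddCircle.toCircle_apply_mk]
    simp only [Circle.coe_exp]
    have h2 : (2 * Real.pi / (2 * Real.pi) * (z - c).arg) = (z - c).arg := by
      field_simp
    rw [h2, this]; ring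
  have h1 := (ContinuousMap.dist_lt_iff hε).1 hgd (θ : AddCircle (2 * Real.pi))
  have h2 := hp (θ : AddCircle (2 * Real.pi))
  rw [one_mul, ← hθ] at h2
  rw [← h2]
  have h3 : G (θ : AddCircle (2 * Real.pi)) = ((k z : ℝ) : ℂ) := by
    rw [hθ]; rfl
  rw [h3, dist_eq_norm] at h1
  refine lt_of_le_of_lt ?_ h1
  have := Complex.abs_re_le_norm (((k z : ℝ) : ℂ) - g (θ : AddCircle (2 * Real.pi)))
  simpa using this

theorem poly_re_circleAverage (p : ℂ[X]) (c : ℂ) (r : ℝ) :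
    Real.circleAverage (fun z => (p.eval z).re) c r = (p.eval c).re := by
  have h : DiffContOnCl ℂ (fun z => p.eval z) (ball c |r|) := p.differentiable.diffContOnCl
  have h2 := h.circleAverage
  have h3 := Complex.reCLM.circleAverage_comp_comm (f := fun z => p.eval z) (c := c) (R := r)
    (p.continuous.continuousOn.circleIntegrable')
  simp only [Function.comp_def, Complex.reCLM_apply] at h3
  rw [h3, h2]

/-- Sub-mean value property against continuous majorants. -/
theorem sub_mean_cont {u : ℂ → EReal} (hu : SubharmonicOn u univ) (k : ℂ → ℝ) (c : ℂ) (r : ℝ)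
    (hr : 0 < r) (hk : ContinuousOn k (sphere c r))
    (huk : ∀ z ∈ sphere c r, u z ≤ (k z : EReal)) :
    u c ≤ ((Real.circleAverage k c r : ℝ) : EReal) := by
  have hci : CircleIntegrable k c r := by
    apply ContinuousOn.circleIntegrable'; rwa [abs_of_pos hr]
  refine EReal.le_of_forall_lt_iff_le.1 ?_
  intro z hz
  have hz' : Real.circleAverage k c r < z := by exact_mod_cast hz
  set ε := (z - Real.circleAverage k c r) / 2 with hε
  have hεp : 0 < ε := by rw [hε]; linarith
  obtain ⟨p, hp⟩ := exists_poly_approx (fun z => k z + ε) c r hr (hk.add continuousOn_const) ε hεp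
  have h1 := hu.2 c r hr (subset_univ _) p (fun w hw => (huk w hw).trans (by
    have := abs_lt.1 (hp w hw)
    exact_mod_cast (by linarith [this.2] : k w ≤ (p.eval w).re))) c (mem_closedBall_self hr.le)
  refine h1.trans ?_
  have h2 : (p.eval c).re ≤ Real.circleAverage (fun w => k w + 2 * ε) c r := by
    rw [← poly_re_circleAverage p c r]
    apply Real.circleAverage_mono
    · exact (Complex.continuous_re.comp p.continuous).continuousOn.circleIntegrable'
    · exact hci.add (circleIntegrable_const _ _ _)
    · intro w hw
      rw [abs_of_pos hr] at hw
      have := abs_lt.1 (hp w hw)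
      show (p.eval w).re ≤ k w + 2 * ε
      linarith [this.1]
  have h3 : Real.circleAverage (fun w => k w + 2 * ε) c r = Real.circleAverage k c r + 2 * ε := by
    rw [Real.circleAverage_fun_add hci (circleIntegrable_const _ _ _), Real.circleAverage_const]
  have h4 : (p.eval c).re ≤ z := by rw [h3] at h2; rw [hε] at h2; linarith
  exact_mod_cast h4

theorem circleAverage_pos_of_cont {f : ℂ → ℝ} {c : ℂ} {r : ℝ} (hr : 0 < r) (hf : Continuous f)
    (h0 : ∀ z, 0 ≤ f z) {z : ℂ} (hz : z ∈ sphere c r) (hfz : 0 < f z) :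
    0 < Real.circleAverage f c r := by
  rw [Real.circleAverage_def, smul_eq_mul]
  have : 0 < ∫ θ in (0:ℝ)..2 * Real.pi, f (circleMap c r θ) := by
    apply intervalIntegral.integral_pos Real.two_pi_pos
    · exact (hf.comp (continuous_circleMap c r)).continuousOn
    · intro x _; exact h0 _
    · have : z ∈ circleMap c r '' Ioc 0 (2 * Real.pi) := by
        rw [image_circleMap_Ioc, abs_of_pos hr]; exact hz
      obtain ⟨θ, hθ, rfl⟩ := this
      exact ⟨θ, Ioc_subset_Icc_self hθ, hfz⟩
  have := Real.pi_pos
  positivity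

/-- an usc function without value `⊤` is bounded above on compact sets -/
theorem usc_bdd {α : Type*} [TopologicalSpace α] {u : α → EReal} {K : Set α} (hK : IsCompact K)
    (hu : UpperSemicontinuousOn u K) (ht : ∀ z, u z ≠ ⊤) :
    ∃ C : ℝ, ∀ z ∈ K, u z ≤ (C : EReal) := by
  rcases K.eq_empty_or_nonempty with rfl | hne
  · exact ⟨0, by simp⟩
  obtain ⟨a, ha, hmax⟩ := hu.exists_isMaxOn hne hK
  refine ⟨(u a).toReal, fun z hz => (hmax hz).trans (EReal.le_coe_toReal (ht a))⟩

theorem subharmonic_bot_of_ball {u : ℂ → EReal} (hu : SubharmonicOn u univ) (ht : ∀ z, u z ≠ ⊤)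
    {c₁ : ℂ} {ρ : ℝ} (hρ : 0 < ρ) (hbot : ∀ z ∈ ball c₁ ρ, u z = ⊥) (c : ℂ) : u c = ⊥ := by
  rcases eq_or_ne c c₁ with rfl | hne
  · exact hbot c (mem_ball_self hρ)
  set r := dist c₁ c with hr
  have hrpos : 0 < r := dist_pos.2 hne.symm
  obtain ⟨C, hC⟩ := usc_bdd (isCompact_sphere c r) (hu.1.mono (subset_univ _)) ht
  set f : ℂ → ℝ := fun z => max 0 (ρ - dist z c₁) with hf
  have hfc : Continuous f := by fun_prop
  have hpos : 0 < Real.circleAverage f c r :=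
    circleAverage_pos_of_cont hrpos hfc (fun z => le_max_left _ _)
      (z := c₁) (mem_sphere.2 rfl) (by simp [hf, hρ])
  have key : ∀ n : ℕ, u c ≤ ((C - n * Real.circleAverage f c r : ℝ) : EReal) := by
    intro n
    have h1 := sub_mean_cont hu (fun z => C - n * f z) c r hrpos (by fun_prop) (by
      intro z hz
      by_cases hzb : z ∈ ball c₁ ρ
      · rw [hbot z hzb]; exact bot_le
      · have : f z = 0 := by
          simp only [hf, mem_ball, not_lt] at *
          exact max_eq_left (by linarith)
        rw [this]; simpa using hC z hz)
    have h2 : Real.circleAverage (fun z => C - n * f z) c r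
        = C - n * Real.circleAverage f c r := by
      rw [Real.circleAverage_fun_sub (circleIntegrable_const _ _ _)
        ((by fun_prop : Continuous fun z => (n:ℝ) * f z).continuousOn.circleIntegrable'),
        Real.circleAverage_const]
      congr 1
      exact Real.circleAverage_fun_smul (a := (n : ℝ)) (f := f)
    rwa [h2] at h1
  refine EReal.eq_bot_iff_forall_lt _ |>.2 fun y => ?_
  obtain ⟨n, hn⟩ := exists_nat_gt ((C - y) / Real.circleAverage f c r)
  refine (key n).trans_lt ?_
  rw [div_lt_iff₀ hpos] at hn
  exact_mod_cast (by linarith : C - n * Real.circleAverage f c r < y)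

/-- truncation from below, as a real function -/
def trunc {α : Type*} (u : α → EReal) (N : ℝ) (x : α) : ℝ := (max (u x) ((-N : ℝ) : EReal)).toReal

theorem coe_trunc {α : Type*} {u : α → EReal} {N : ℝ} {x : α} (hx : u x ≠ ⊤) :
    (trunc u N x : EReal) = max (u x) ((-N : ℝ) : EReal) := by
  apply EReal.coe_toReal
  · intro h
    rcases max_choice (u x) ((-N : ℝ) : EReal) with h1 | h1 <;> rw [h1] at h
    · exact hx h
    · exact EReal.coe_ne_top _ h
  · intro h
    have : ((-N : ℝ) : EReal) ≤ ⊥ := h ▸ le_max_right _ _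
    exact EReal.coe_ne_bot _ (le_bot_iff.1 this)

theorem neg_le_trunc {α : Type*} {u : α → EReal} {N : ℝ} {x : α} (hx : u x ≠ ⊤) :
    -N ≤ trunc u N x := by
  have : ((-N : ℝ) : EReal) ≤ (trunc u N x : EReal) := by
    rw [coe_trunc hx]; exact le_max_right _ _
  exact_mod_cast this

theorem le_trunc {α : Type*} {u : α → EReal} {N : ℝ} {x : α} (hx : u x ≠ ⊤) :
    u x ≤ (trunc u N x : EReal) := by
  rw [coe_trunc hx]; exact le_max_left _ _

theorem trunc_le {α : Type*} {u : α → EReal} {N : ℝ} {x : α} (hx : u x ≠ ⊤) {k : ℝ}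
    (h1 : u x ≤ (k : EReal)) (h2 : -N ≤ k) : trunc u N x ≤ k := by
  have : (trunc u N x : EReal) ≤ (k : EReal) := by
    rw [coe_trunc hx]; exact max_le h1 (by exact_mod_cast h2)
  exact_mod_cast this

theorem trunc_bot {α : Type*} {u : α → EReal} {N : ℝ} {x : α} (hx : u x = ⊥) :
    trunc u N x = -N := by
  simp [trunc, hx]

theorem trunc_usc {α : Type*} [TopologicalSpace α] {u : α → EReal} (N : ℝ) {s : Set α}
    (hu : UpperSemicontinuousOn u s) (ht : ∀ z, u z ≠ ⊤) : UpperSemicontinuousOn (trunc u N) s := by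
  intro x hx y hy
  have h1 : max (u x) ((-N : ℝ) : EReal) < (y : EReal) := by
    rw [← coe_trunc (ht x)]; exact_mod_cast hy
  filter_upwards [hu x hx y (lt_of_le_of_lt (le_max_left _ _) h1)] with z hz
  have : (trunc u N z : EReal) < y := by
    rw [coe_trunc (ht z)]; exact max_lt hz (lt_of_le_of_lt (le_max_right _ _) h1)
  exact_mod_cast this

/-- A usc function on a circle is dominated in average by its continuous majorants. -/
theorem le_avg_of_cont_majorants {H : ℂ → ℝ} {c : ℂ} {r : ℝ} (hr : 0 < r)
    (hH : UpperSemicontinuousOn H (sphere c r)) {N : ℝ} (hN : ∀ z, -N ≤ H z) {x : ℝ}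
    (hx : ∀ k : ℂ → ℝ, ContinuousOn k (sphere c r) → (∀ z ∈ sphere c r, H z ≤ k z) →
      x ≤ Real.circleAverage k c r) : x ≤ Real.circleAverage H c r := by
  obtain ⟨C, hC⟩ := hH.bddAbove_of_isCompact (isCompact_sphere c r)
  have hC' : ∀ z ∈ sphere c r, H z ≤ C := fun z hz => hC (mem_image_of_mem _ hz)
  have hne : (sphere c r).Nonempty := NormedSpace.sphere_nonempty.2 hr.le
  have : Nonempty (sphere c r) := hne.to_subtype
  let k : ℕ → ℂ → ℝ := fun n z => ⨆ y : sphere c r, (H y - n * dist (y : ℂ) z)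
  have hbdd : ∀ (n : ℕ) (z : ℂ), BddAbove (range fun y : sphere c r => (H y - n * dist (y : ℂ) z)) := by
    intro n z
    refine ⟨C, ?_⟩
    rintro _ ⟨y, rfl⟩
    have := hC' y y.2
    have : 0 ≤ n * dist (y : ℂ) z := by positivity
    simp only; linarith
  have hkle : ∀ n z, k n z ≤ C := by
    intro n z
    apply ciSup_le
    intro y
    have := hC' y y.2
    have : 0 ≤ n * dist (y : ℂ) z := by positivity
    linarith
  have hkge : ∀ n, ∀ z ∈ sphere c r, H z ≤ k n z := by
    intro n z hz
    have := le_ciSup (hbdd n z) ⟨z, hz⟩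
    simpa using this
  have hlip : ∀ n : ℕ, Continuous (k n) := by
    intro n
    apply LipschitzWith.continuous (K := (n : NNReal))
    apply LipschitzWith.of_le_add_mul
    intro z z'
    apply ciSup_le
    intro y
    have h1 := le_ciSup (hbdd n z') y
    have h2 : dist (y : ℂ) z' ≤ dist (y : ℂ) z + dist z z' := dist_triangle _ _ _
    have h3 : (n : ℝ) * dist (y : ℂ) z' ≤ n * dist (y : ℂ) z + n * dist z z' := by
      rw [← mul_add]; gcongr
    simp only [NNReal.coe_natCast]
    have h4 : H y - n * dist (y : ℂ) z' ≤ k n z' := h1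
    linarith
  have hlim : ∀ z ∈ sphere c r, Filter.Tendsto (fun n => k n z) Filter.atTop (nhds (H z)) := by
    intro z hz
    rw [Metric.tendsto_atTop]
    intro ε hε
    have := hH z hz (H z + ε / 2) (by linarith)
    rw [eventually_nhdsWithin_iff, Metric.eventually_nhds_iff] at this
    obtain ⟨δ, hδ, h⟩ := this
    obtain ⟨n₀, hn₀⟩ := exists_nat_gt ((C + N) / δ)
    refine ⟨n₀, fun n hn => ?_⟩
    have h1 : k n z ≤ H z + ε / 2 := by
      apply ciSup_le
      intro y
      have hp : 0 ≤ n * dist (y : ℂ) z := by positivity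
      by_cases hy : dist (y : ℂ) z < δ
      · have := h hy y.2; linarith
      · push Not at hy
        have h5 : (C + N) < n₀ * δ := by rwa [div_lt_iff₀ hδ] at hn₀
        have h6 : (n₀ : ℝ) * δ ≤ n * dist (y : ℂ) z := by
          have : (n₀ : ℝ) ≤ n := by exact_mod_cast hn
          gcongr
        have := hC' y y.2
        have := hN z
        linarith
    have h2 := hkge n z hz
    rw [Real.dist_eq, abs_lt]; constructor <;> linarith
  have hT : Filter.Tendsto (fun n => Real.circleAverage (k n) c r) Filter.atTop
      (nhds (Real.circleAverage H c r)) := by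
    simp only [Real.circleAverage_def]
    apply Filter.Tendsto.const_smul
    apply intervalIntegral.tendsto_integral_filter_of_dominated_convergence (fun _ => max |C| |N|)
    · exact Filter.Eventually.of_forall fun n =>
        ((hlip n).comp (continuous_circleMap c r)).aestronglyMeasurable
    · refine Filter.Eventually.of_forall fun n => Filter.Eventually.of_forall fun θ _ => ?_
      have hm := circleMap_mem_sphere c hr.le θ
      have h1 := hkle n (circleMap c r θ)
      have h2 := (hN _).trans (hkge n _ hm)
      rw [Real.norm_eq_abs, abs_le]
      constructor
      · have := le_max_right |C| |N|; have := le_abs_self N; linarith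
      · have := le_max_left |C| |N|; have := le_abs_self C; linarith
    · exact intervalIntegrable_const
    · exact Filter.Eventually.of_forall fun θ _ => hlim _ (circleMap_mem_sphere c hr.le θ)
  exact ge_of_tendsto' hT fun n => hx _ (hlip n).continuousOn (hkge n)

theorem trunc_sub_mean {u : ℂ → EReal} (hu : SubharmonicOn u univ) (ht : ∀ z, u z ≠ ⊤) (N : ℝ)
    (c : ℂ) (r : ℝ) (hr : 0 < r) : trunc u N c ≤ Real.circleAverage (trunc u N) c r := by
  apply le_avg_of_cont_majorants hr ((trunc_usc N hu.1 ht).mono (subset_univ _))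
    (fun z => neg_le_trunc (ht z))
  intro k hk hle
  apply trunc_le (ht c)
  · exact sub_mean_cont hu k c r hr hk fun z hz =>
      (le_trunc (ht z)).trans (by exact_mod_cast hle z hz)
  · rw [← Real.circleAverage_const (-N) c r]
    apply Real.circleAverage_mono (circleIntegrable_const _ _ _)
    · apply ContinuousOn.circleIntegrable'; rwa [abs_of_pos hr]
    · intro z hz
      rw [abs_of_pos hr] at hz
      exact (neg_le_trunc (ht z)).trans (hle z hz)

theorem trunc_sub_mean_cont {u : ℂ → EReal} (hu : SubharmonicOn u univ) (ht : ∀ z, u z ≠ ⊤) (N : ℝ)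
    (c : ℂ) (r : ℝ) (hr : 0 < r) (k : ℂ → ℝ) (hk : ContinuousOn k (sphere c r))
    (hle : ∀ z ∈ sphere c r, trunc u N z ≤ k z) : trunc u N c ≤ Real.circleAverage k c r := by
  apply trunc_le (ht c)
  · exact sub_mean_cont hu k c r hr hk fun z hz =>
      (le_trunc (ht z)).trans (by exact_mod_cast hle z hz)
  · rw [← Real.circleAverage_const (-N) c r]
    apply Real.circleAverage_mono (circleIntegrable_const _ _ _)
    · apply ContinuousOn.circleIntegrable'; rwa [abs_of_pos hr]
    · intro z hz
      rw [abs_of_pos hr] at hz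
      exact (neg_le_trunc (ht z)).trans (hle z hz)

theorem avg_normSq (w c : ℂ) (s : ℝ) (hs : 0 < s) :
    Real.circleAverage (fun z => ‖z - c‖ ^ 2) w s = ‖w - c‖ ^ 2 + s ^ 2 := by
  let p : ℂ[X] := C (((‖w - c‖ ^ 2 + s ^ 2 : ℝ)) : ℂ) + C (2 * (starRingEnd ℂ) (w - c)) * (X - C w)
  have h1 : Real.circleAverage (fun z => ‖z - c‖ ^ 2) w s
      = Real.circleAverage (fun z => (p.eval z).re) w s := by
    apply Real.circleAverage_congr_sphere
    intro z hz
    rw [abs_of_pos hs, mem_sphere, dist_eq_norm] at hz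
    simp only [p, eval_add, eval_C, eval_mul, eval_sub, eval_X]
    rw [← hz]
    simp only [← Complex.normSq_eq_norm_sq, Complex.normSq_apply]
    simp
    ring
  rw [h1, poly_re_circleAverage]
  simp [p]
  norm_cast

/-- A maximum principle. -/
theorem max_principle {H V : ℂ → ℝ} (hH : UpperSemicontinuousOn H univ)
    (hsub : ∀ (c : ℂ) (r : ℝ), 0 < r → ∀ k : ℂ → ℝ, ContinuousOn k (sphere c r) →
      (∀ z ∈ sphere c r, H z ≤ k z) → H c ≤ Real.circleAverage k c r)
    (hV : Continuous V) (c : ℂ) (R : ℝ) (B : ℝ) (bad : Set ℂ)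
    (hbad : ∀ z ∈ closedBall c R, z ∈ bad → H z + V z ≤ B)
    (hgood : ∀ z ∈ closedBall c R, z ∉ bad → ∃ s > 0, closedBall z s ⊆ closedBall c R ∧
      Real.circleAverage V z s = V z) :
    ∀ z ∈ closedBall c R, H z + V z ≤ B := by
  intro z₁ hz₁
  by_contra! hcon
  have hRnn : 0 ≤ R := dist_nonneg.trans hz₁
  set τ := (H z₁ + V z₁ - B) / (2 * (R ^ 2 + 1)) with hτ
  have hτp : 0 < τ := by apply div_pos <;> nlinarith
  have hτe : τ * (R ^ 2 + 1) * 2 = H z₁ + V z₁ - B := by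
    rw [hτ]; field_simp
  have husc : UpperSemicontinuousOn (fun z => H z + (V z + τ * ‖z - c‖ ^ 2)) (closedBall c R) := by
    apply UpperSemicontinuousOn.add (hH.mono (subset_univ _))
    apply ContinuousOn.upperSemicontinuousOn
    fun_prop
  obtain ⟨w, hw, hmax⟩ := husc.exists_isMaxOn ⟨z₁, hz₁⟩ (isCompact_closedBall c R)
  have hm1 : H z₁ + (V z₁ + τ * ‖z₁ - c‖ ^ 2) ≤ H w + (V w + τ * ‖w - c‖ ^ 2) := hmax hz₁
  have hwR : ‖w - c‖ ≤ R := by simpa [dist_eq_norm] using hw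
  have hwR2 : ‖w - c‖ ^ 2 ≤ R ^ 2 := by gcongr
  have hnb : w ∉ bad := by
    intro hb
    have := hbad w hw hb
    have : 0 ≤ τ * ‖z₁ - c‖ ^ 2 := by positivity
    have : τ * ‖w - c‖ ^ 2 ≤ τ * R ^ 2 := by gcongr
    nlinarith
  obtain ⟨s, hs, hsub2, havg⟩ := hgood w hw hnb
  set m := H w + (V w + τ * ‖w - c‖ ^ 2) with hm
  have h1 := hsub w s hs (fun z => m - (V z + τ * ‖z - c‖ ^ 2)) (by fun_prop) (by
    intro z hz
    have : H z + (V z + τ * ‖z - c‖ ^ 2) ≤ m := hmax (hsub2 (sphere_subset_closedBall hz))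
    linarith)
  have hci : ∀ f : ℂ → ℝ, Continuous f → CircleIntegrable f w s :=
    fun f hf => hf.continuousOn.circleIntegrable'
  have h2 : Real.circleAverage (fun z => m - (V z + τ * ‖z - c‖ ^ 2)) w s
      = m - (V w + τ * (‖w - c‖ ^ 2 + s ^ 2)) := by
    rw [Real.circleAverage_fun_sub (hci _ (by fun_prop)) (hci _ (by fun_prop)),
      Real.circleAverage_fun_add (hci _ hV) (hci _ (by fun_prop)), havg, Real.circleAverage_const,
      ← avg_normSq w c s hs]
    congr 2
    exact Real.circleAverage_fun_smul (a := τ) (f := fun z => ‖z - c‖ ^ 2)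
  rw [h2] at h1
  have : 0 < τ * s ^ 2 := by positivity
  nlinarith

theorem sum_log_bound (α β : ℝ) (hαβ : α < β) (R : ℝ) : ∃ C₁ : ℝ, ∀ (N : ℕ), 0 < N →
    ∀ x ∈ Icc 0 R, ∀ ρ, 2 * ρ * N = β - α →
    (1 / (N : ℝ)) * ∑ j ∈ Finset.range N, -Real.log (max |x - (α + (2 * j + 1) * ρ)| ρ) ≤ C₁ := by
  have hg : Continuous (fun x : ℝ => (x - α) * Real.log (x - α) - (x - β) * Real.log (x - β)) := by
    have h := Real.continuous_mul_log
    exact (h.comp (by fun_prop : Continuous fun x : ℝ => x - α)).sub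
      (h.comp (by fun_prop : Continuous fun x : ℝ => x - β))
  obtain ⟨K, hK⟩ := (isCompact_Icc (a := (0:ℝ)) (b := R)).bddBelow_image hg.continuousOn
  have hK' : ∀ x ∈ Icc 0 R, K ≤ (x - α) * Real.log (x - α) - (x - β) * Real.log (x - β) :=
    fun x hx => hK (mem_image_of_mem _ hx)
  refine ⟨Real.log 2 - (K - (β - α)) / (β - α), ?_⟩
  intro N hN x hx ρ hρ
  have hNp : (0:ℝ) < N := by exact_mod_cast hN
  have hρp : 0 < ρ := by
    by_contra! h
    nlinarith
  have hintg : ∀ a b : ℝ, IntervalIntegrable (fun t => Real.log 2 - Real.log (x - t))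
      MeasureTheory.volume a b := by
    intro a b
    apply intervalIntegrable_const.sub
    have : IntervalIntegrable Real.log MeasureTheory.volume (x - a) (x - b) :=
      intervalIntegral.intervalIntegrable_log'
    simpa using this.comp_sub_left x
  have hterm : ∀ j : ℕ, 2 * ρ * -Real.log (max |x - (α + (2 * j + 1) * ρ)| ρ)
      ≤ ∫ t in (α + 2 * j * ρ)..(α + 2 * (j + 1 : ℕ) * ρ), (Real.log 2 - Real.log (x - t)) := by
    intro j
    have hle : α + 2 * j * ρ ≤ α + 2 * (j + 1 : ℕ) * ρ := by push_cast; nlinarith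
    have e1 : 2 * ρ * -Real.log (max |x - (α + (2 * j + 1) * ρ)| ρ)
        = ∫ t in (α + 2 * j * ρ)..(α + 2 * (j + 1 : ℕ) * ρ),
          -Real.log (max |x - (α + (2 * j + 1) * ρ)| ρ) := by
      rw [intervalIntegral.integral_const, smul_eq_mul]; push_cast; ring
    rw [e1]
    apply intervalIntegral.integral_mono_ae_restrict hle intervalIntegrable_const (hintg _ _)
    have hne : ∀ᵐ t ∂(MeasureTheory.volume.restrict (Icc (α + 2 * j * ρ) (α + 2 * (j + 1 : ℕ) * ρ))), t ≠ x :=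
      MeasureTheory.ae_restrict_of_ae (by rw [MeasureTheory.ae_iff]; simp)
    filter_upwards [hne, MeasureTheory.ae_restrict_mem measurableSet_Icc] with t ht htI
    have h0 : 0 < |x - t| := abs_pos.2 (sub_ne_zero.2 (Ne.symm ht))
    have hmaxp : 0 < max |x - (α + (2 * j + 1) * ρ)| ρ := lt_max_of_lt_right hρp
    have h1 : |x - t| ≤ 2 * max |x - (α + (2 * j + 1) * ρ)| ρ := by
      have h2 : |x - t| ≤ |x - (α + (2 * j + 1) * ρ)| + |(α + (2 * j + 1) * ρ) - t| :=
        abs_sub_le _ _ _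
      have h3 : |(α + (2 * j + 1) * ρ) - t| ≤ ρ := by
        obtain ⟨h4, h5⟩ := htI
        push_cast at h5
        rw [abs_le]; constructor <;> nlinarith
      have := le_max_left |x - (α + (2 * j + 1) * ρ)| ρ
      have := le_max_right |x - (α + (2 * j + 1) * ρ)| ρ
      linarith
    have h2 := Real.log_le_log h0 h1
    rw [Real.log_mul (by norm_num) hmaxp.ne', Real.log_abs] at h2
    linarith
  have hsum : ∑ j ∈ Finset.range N, 2 * ρ * -Real.log (max |x - (α + (2 * j + 1) * ρ)| ρ)
      ≤ ∫ t in α..β, (Real.log 2 - Real.log (x - t)) := by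
    refine (Finset.sum_le_sum fun j _ => hterm j).trans ?_
    have := intervalIntegral.sum_integral_adjacent_intervals (f := fun t => (Real.log 2 - Real.log (x - t)))
      (μ := MeasureTheory.volume)
      (a := fun j : ℕ => α + 2 * j * ρ) (n := N) (fun k _ => hintg _ _)
    rw [this]
    have e2 : α + 2 * (N : ℝ) * ρ = β := by linarith
    simp only [Nat.cast_zero, e2]
    simp
  have hval : ∫ t in α..β, (Real.log 2 - Real.log (x - t))
      = (β - α) * Real.log 2 - ((x - α) * Real.log (x - α) - (x - β) * Real.log (x - β) - (β - α)) := by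
    rw [intervalIntegral.integral_sub intervalIntegrable_const]
    · rw [intervalIntegral.integral_const, intervalIntegral.integral_comp_sub_left (fun t => Real.log t), integral_log, smul_eq_mul]
      ring
    · have : IntervalIntegrable Real.log MeasureTheory.volume (x - α) (x - β) :=
        intervalIntegral.intervalIntegrable_log'
      simpa using this.comp_sub_left x
  rw [hval, ← Finset.mul_sum] at hsum
  have hba : 0 < β - α := by linarith
  have e3 : (1 / (N : ℝ)) = 2 * ρ / (β - α) := by
    rw [← hρ]; field_simp
  rw [e3, div_mul_eq_mul_div, div_le_iff₀ hba]
  refine hsum.trans ?_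
  have := hK' x hx
  have e4 : (Real.log 2 - (K - (β - α)) / (β - α)) * (β - α) = (β - α) * Real.log 2 - (K - (β - α)) := by
    field_simp
  rw [e4]; linarith

theorem uniform_balls {E : Set ℂ} (hE : IsOpen E) (c : ℂ) {α β : ℝ} (hα : 0 < α)
    (h : ∀ r ∈ Icc α β, ∃ w ∈ sphere c r, w ∈ E) :
    ∃ ρ₀ > 0, ∀ r ∈ Icc α β, ∃ w ∈ sphere c r, closedBall w ρ₀ ⊆ E := by
  refine (isCompact_Icc (a := α) (b := β)).induction_on
    (p := fun s => ∃ ρ₀ > 0, ∀ r ∈ s, ∃ w ∈ sphere c r, closedBall w ρ₀ ⊆ E) ?_ ?_ ?_ ?_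
  · exact ⟨1, one_pos, by simp⟩
  · rintro s t hst ⟨ρ, hρ, h1⟩
    exact ⟨ρ, hρ, fun r hr => h1 r (hst hr)⟩
  · rintro s t ⟨ρ, hρ, h1⟩ ⟨ρ', hρ', h2⟩
    refine ⟨min ρ ρ', lt_min hρ hρ', ?_⟩
    rintro r (hr | hr)
    · obtain ⟨w, hw, hb⟩ := h1 r hr
      exact ⟨w, hw, (closedBall_subset_closedBall (min_le_left _ _)).trans hb⟩
    · obtain ⟨w, hw, hb⟩ := h2 r hr
      exact ⟨w, hw, (closedBall_subset_closedBall (min_le_right _ _)).trans hb⟩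
  · intro r hr
    obtain ⟨w, hw, hwE⟩ := h r hr
    obtain ⟨e, he, heb⟩ := Metric.isOpen_iff.1 hE w hwE
    have hrp : 0 < r := hα.trans_le hr.1
    refine ⟨Icc α β ∩ ball r (e / 2), Filter.inter_mem self_mem_nhdsWithin
      (mem_nhdsWithin_of_mem_nhds (ball_mem_nhds _ (by linarith))), e / 4, by linarith, ?_⟩
    rintro r' ⟨hr', hr'b⟩
    have hr'p : 0 < r' := hα.trans_le hr'.1
    have hwn : ‖w - c‖ = r := by simpa [dist_eq_norm] using hw
    have hrc : (r : ℂ) ≠ 0 := by exact_mod_cast hrp.ne'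
    refine ⟨c + (r' / r : ℝ) * (w - c), ?_, ?_⟩
    · rw [mem_sphere, dist_eq_norm]
      simp only [add_sub_cancel_left, norm_mul, hwn, Complex.norm_real, Real.norm_eq_abs]
      rw [abs_of_pos (by positivity)]; field_simp
    · intro y hy
      apply heb
      rw [mem_ball]
      have h1 : dist (c + (r' / r : ℝ) * (w - c)) w = |r' - r| := by
        rw [dist_eq_norm]
        have : c + ((r' / r : ℝ) : ℂ) * (w - c) - w = (((r' - r) / r : ℝ) : ℂ) * (w - c) := by
          push_cast; field_simp; ring
        rw [this, norm_mul, hwn, Complex.norm_real, Real.norm_eq_abs, abs_div, abs_of_pos hrp]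
        field_simp
      have h2 : |r' - r| < e / 2 := by simpa [Real.dist_eq] using hr'b
      have h3 := dist_triangle y (c + (r' / r : ℝ) * (w - c)) w
      have h4 : dist y (c + (r' / r : ℝ) * (w - c)) ≤ e / 4 := hy
      linarith

theorem avg_log_max {w z : ℂ} {ρ s : ℝ} (hs : 0 < s) (hρ : 0 < ρ) (h : ρ + s < ‖z - w‖) :
    Real.circleAverage (fun y => Real.log (max ‖y - w‖ ρ)) z s = Real.log (max ‖z - w‖ ρ) := by
  have hgt : ∀ y ∈ closedBall z s, ρ < ‖y - w‖ := by
    intro y hy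
    have h1 : ‖y - z‖ ≤ s := by simpa [dist_eq_norm] using hy
    have h2 : ‖z - w‖ ≤ ‖y - z‖ + ‖y - w‖ := by
      rw [norm_sub_rev y z]; simpa using norm_add_le (z - y) (y - w)
    linarith
  rw [max_eq_left (by linarith)]
  have h1 : Real.circleAverage (fun y => Real.log (max ‖y - w‖ ρ)) z s
      = Real.circleAverage (fun y => Real.log ‖y - w‖) z s := by
    apply Real.circleAverage_congr_sphere
    intro y hy
    rw [abs_of_pos hs] at hy
    simp only
    rw [max_eq_left (hgt y (sphere_subset_closedBall hy)).le]
  rw [h1]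
  have : InnerProductSpace.HarmonicOnNhd (fun y => Real.log ‖y - w‖) (closedBall z |s|) := by
    intro y hy
    rw [abs_of_pos hs] at hy
    apply AnalyticAt.harmonicAt_log_norm (f := fun y => y - w) (by fun_prop)
    intro h0
    have := hgt y hy
    rw [h0, norm_zero] at this; linarith
  exact this.circleAverage_eq

theorem circle_lemma {u : ℂ → EReal} (hu : SubharmonicOn u univ) (ht : ∀ z, u z ≠ ⊤)
    (hne : ∃ z, u z ≠ ⊥) (c : ℂ) (r₁ : ℝ) (hr₁ : 0 < r₁) :
    ∃ r, 0 < r ∧ r < r₁ ∧ ∃ M : ℝ, ∀ z ∈ sphere c r, ((-M : ℝ) : EReal) ≤ u z := by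
  by_contra! hcon
  obtain ⟨z₀, hz₀⟩ := hne
  set α := r₁ / 4 with hα
  set β := r₁ / 2 with hβ
  have hαp : 0 < α := by rw [hα]; linarith
  have hαβ : α < β := by rw [hα, hβ]; linarith
  have hβp : 0 < β := hαp.trans hαβ
  set R := 4 * β with hR
  obtain ⟨C₀, hC₀⟩ := usc_bdd (isCompact_closedBall c R) (hu.1.mono (subset_univ _)) ht
  obtain ⟨C₁', hC₁'⟩ := sum_log_bound α β hαβ R
  set v₀ := -Real.log (3 * β) with hv₀
  set C₁ := max C₁' (v₀ + 1) with hC₁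
  have hC₁v : 0 < C₁ - v₀ := by have := le_max_right C₁' (v₀ + 1); linarith
  set L := Real.log (3 * β) - Real.log (2 * β) with hL
  have hLp : 0 < L := by
    have := Real.log_lt_log (by positivity : 0 < 2 * β) (by linarith : 2 * β < 3 * β)
    linarith
  have main : ∀ M : ℝ, -C₀ ≤ M → ∀ z ∈ closedBall c β,
      u z ≤ ((C₀ - (M + C₀) / (C₁ - v₀) * L : ℝ) : EReal) := by
    intro M hM
    set κ := (M + C₀) / (C₁ - v₀) with hκ
    have hκp : 0 ≤ κ := div_nonneg (by linarith) hC₁v.le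
    have hκe : κ * (C₁ - v₀) = M + C₀ := by rw [hκ]; field_simp
    have hEo : IsOpen {z | u z < ((-M : ℝ) : EReal)} := by
      have h1 : UpperSemicontinuous u := upperSemicontinuousOn_univ_iff.1 hu.1
      exact h1.isOpen_preimage _
    obtain ⟨ρ₀, hρ₀, hunif⟩ := uniform_balls hEo c hαp (β := β) (by
      intro r hr
      obtain ⟨w, hw, hw2⟩ := hcon r (hαp.trans_le hr.1) (by have := hr.2; linarith) M
      exact ⟨w, hw, hw2⟩)
    obtain ⟨N', hN'⟩ := exists_nat_gt ((β - α) / (2 * ρ₀))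
    set N := N' + 1 with hN
    have hNp : (0:ℝ) < N := by positivity
    set ρ := (β - α) / (2 * N) with hρ
    have hρp : 0 < ρ := div_pos (by linarith) (by positivity)
    have hρe : 2 * ρ * N = β - α := by rw [hρ]; field_simp
    have hρρ : ρ ≤ ρ₀ := by
      rw [div_lt_iff₀ (by positivity)] at hN'
      rw [hρ, div_le_iff₀ (by positivity), hN]
      push_cast; nlinarith
    have hrange : ∀ j ∈ Finset.range N, (α + (2 * (j:ℝ) + 1) * ρ) ∈ Icc α β := by
      intro j hj
      have hj' : ((j:ℝ) + 1) ≤ N := by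
        have := Finset.mem_range.1 hj
        exact_mod_cast this
      constructor
      · have : 0 ≤ (2 * (j:ℝ) + 1) * ρ := by positivity
        linarith
      · nlinarith
    have hex : ∀ j : ℕ, ∃ w : ℂ, j ∈ Finset.range N →
        w ∈ sphere c (α + (2 * (j:ℝ) + 1) * ρ) ∧ closedBall w ρ₀ ⊆ {z | u z < ((-M : ℝ) : EReal)} := by
      intro j
      by_cases hj : j ∈ Finset.range N
      · obtain ⟨w, h1, h2⟩ := hunif _ (hrange j hj)
        exact ⟨w, fun _ => ⟨h1, h2⟩⟩
      · exact ⟨0, fun h => absurd h hj⟩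
    choose w hw using hex
    set S : ℂ → ℝ := fun z => ∑ j ∈ Finset.range N, Real.log (max ‖z - w j‖ ρ) with hS
    have hmaxpos : ∀ (z : ℂ) (j : ℕ), 0 < max ‖z - w j‖ ρ := fun z j => lt_max_of_lt_right hρp
    have hScont1 : ∀ j, Continuous (fun z : ℂ => Real.log (max ‖z - w j‖ ρ)) := by
      intro j
      exact Continuous.log (by fun_prop) (fun z => (hmaxpos z j).ne')
    have hScont : Continuous S := continuous_finsetSum _ fun j _ => hScont1 j
    set V : ℂ → ℝ := fun z => (-(κ / N)) * S z with hV
    have hVcont : Continuous V := by fun_prop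
    -- upper bound
    have hVC : ∀ z ∈ closedBall c R, V z ≤ κ * C₁ := by
      intro z hz
      have hzR : ‖z - c‖ ∈ Icc 0 R := ⟨norm_nonneg _, by simpa [dist_eq_norm] using hz⟩
      have h1 := hC₁' N (by omega) ‖z - c‖ hzR ρ hρe
      have h2 : -S z ≤ ∑ j ∈ Finset.range N,
          -Real.log (max |‖z - c‖ - (α + (2 * j + 1) * ρ)| ρ) := by
        rw [hS, ← Finset.sum_neg_distrib]
        apply Finset.sum_le_sum
        intro j hj
        apply neg_le_neg
        apply Real.log_le_log (lt_max_of_lt_right hρp)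
        apply max_le_max _ le_rfl
        have hwj : ‖w j - c‖ = α + (2 * (j:ℝ) + 1) * ρ := by
          have := (hw j hj).1; simpa [dist_eq_norm] using this
        rw [← hwj]
        have := abs_norm_sub_norm_le (z - c) (w j - c)
        simpa using this
      have h3 : (1 / (N:ℝ)) * -S z ≤ C₁ := by
        refine (mul_le_mul_of_nonneg_left h2 (by positivity)).trans (h1.trans (le_max_left _ _))
      have h4 : V z = κ * ((1 / (N:ℝ)) * -S z) := by rw [hV]; ring
      rw [h4]; gcongr
    have hVlow : ∀ z ∈ closedBall c β, -κ * Real.log (2 * β) ≤ V z := by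
      intro z hz
      have h1 : S z ≤ N * Real.log (2 * β) := by
        have : S z ≤ ∑ j ∈ Finset.range N, Real.log (2 * β) := by
          apply Finset.sum_le_sum
          intro j hj
          apply Real.log_le_log (hmaxpos z j)
          apply max_le
          · have h5 : ‖z - c‖ ≤ β := by simpa [dist_eq_norm] using hz
            have h6 : ‖w j - c‖ ≤ β := by
              have := (hw j hj).1; rw [mem_sphere, dist_eq_norm] at this
              rw [this]; exact (hrange j hj).2
            have h7 := norm_sub_le (z - c) (w j - c)
            rw [sub_sub_sub_cancel_right] at h7
            linarith
          · have : ρ * 1 ≤ ρ * N := by gcongr; rw [hN]; push_cast; linarith [N'.cast_nonneg (α := ℝ)]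
            nlinarith
        simpa using this
      have h4 : V z = -(κ / N * S z) := by rw [hV]; ring
      rw [h4]
      have : κ / N * S z ≤ κ / N * (N * Real.log (2 * β)) := by gcongr
      have e : κ / N * (N * Real.log (2 * β)) = κ * Real.log (2 * β) := by field_simp
      linarith
    have hVsph : ∀ z ∈ sphere c R, V z ≤ κ * v₀ := by
      intro z hz
      have h1 : N * Real.log (3 * β) ≤ S z := by
        have : ∑ j ∈ Finset.range N, Real.log (3 * β) ≤ S z := by
          apply Finset.sum_le_sum
          intro j hj
          apply Real.log_le_log (by positivity)
          apply le_max_of_le_left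
          have h5 : ‖z - c‖ = R := by simpa [dist_eq_norm] using hz
          have h6 : ‖w j - c‖ ≤ β := by
            have := (hw j hj).1; rw [mem_sphere, dist_eq_norm] at this
            rw [this]; exact (hrange j hj).2
          have h7 := norm_sub_norm_le (z - c) (w j - c)
          rw [sub_sub_sub_cancel_right] at h7
          linarith
        simpa using this
      have h4 : V z = -(κ / N * S z) := by rw [hV]; ring
      rw [h4]
      have : κ / N * (N * Real.log (3 * β)) ≤ κ / N * S z := by gcongr
      have e : κ / N * (N * Real.log (3 * β)) = κ * Real.log (3 * β) := by field_simp
      rw [hv₀]; linarith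
    set B := C₀ + κ * v₀ with hB
    obtain ⟨Q, hQ⟩ := (isCompact_closedBall c R).bddAbove_image hVcont.continuousOn
    have hQ' : ∀ z ∈ closedBall c R, V z ≤ Q := fun z hz => hQ (mem_image_of_mem _ hz)
    set T := Q - B with hT
    have hmp := max_principle (H := trunc u T) (V := V) (trunc_usc T hu.1 ht)
      (fun c r hr k hk hle => trunc_sub_mean_cont hu ht T c r hr k hk hle) hVcont c R B
      (sphere c R ∪ {z | ∃ j ∈ Finset.range N, ‖z - w j‖ ≤ ρ}) (by
        rintro z hz hzb
        have : trunc u T z ≤ B - V z := by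
          apply trunc_le (ht z) _ (by have := hQ' z hz; linarith)
          rcases hzb with hzs | ⟨j, hj, hzj⟩
          · have h1 := hVsph z hzs
            exact (hC₀ z hz).trans (by exact_mod_cast (by linarith : C₀ ≤ B - V z))
          · have h1 : u z < ((-M : ℝ) : EReal) :=
              (hw j hj).2 (by rw [mem_closedBall, dist_eq_norm]; linarith)
            have h2 := hVC z hz
            refine h1.le.trans ?_
            have : -M ≤ B - V z := by
              rw [mul_sub] at hκe; linarith
            exact_mod_cast this
        linarith) (by
        intro z hz hzb
        simp only [mem_union, not_or, mem_setOf_eq, not_exists, not_and, not_le] at hzb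
        obtain ⟨hz1, hz2⟩ := hzb
        have hzlt : dist z c < R := lt_of_le_of_ne hz hz1
        obtain ⟨s, hs, hsj⟩ : ∃ s > 0, ∀ j ∈ Finset.range N, ρ + s < ‖z - w j‖ := by
          have : ∀ᶠ s in nhdsWithin (0:ℝ) (Ioi 0), ∀ j ∈ Finset.range N, ρ + s < ‖z - w j‖ := by
            rw [Filter.eventually_all_finset]
            intro j hj
            apply eventually_nhdsWithin_of_eventually_nhds
            apply ContinuousAt.eventually_lt (by fun_prop) (by fun_prop)
            simpa using hz2 j hj
          obtain ⟨s, h1, h2⟩ := (this.and self_mem_nhdsWithin).exists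
          exact ⟨s, h2, h1⟩
        refine ⟨min s (R - dist z c), lt_min hs (by linarith), ?_, ?_⟩
        · apply closedBall_subset_closedBall'
          have := min_le_right s (R - dist z c); linarith
        · have hmin := min_le_left s (R - dist z c)
          have hS' : Real.circleAverage S z (min s (R - dist z c)) = S z := by
            rw [hS]
            rw [Real.circleAverage_fun_sum]
            · apply Finset.sum_congr rfl
              intro j hj
              exact avg_log_max (lt_min hs (by linarith)) hρp (by have := hsj j hj; linarith)
            · intro j _
              exact (hScont1 j).continuousOn.circleIntegrable'
          rw [hV]
          have := Real.circleAverage_fun_smul (a := -(κ / N)) (f := S) (c := z)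
            (R := min s (R - dist z c))
          simp only [smul_eq_mul] at this
          rw [this, hS'])
    intro z hz
    have hzR : z ∈ closedBall c R := closedBall_subset_closedBall (by linarith) hz
    have h1 := hmp z hzR
    have h2 := hVlow z hz
    refine (le_trunc (N := T) (ht z)).trans ?_
    have : trunc u T z ≤ C₀ - κ * L := by
      rw [hL]; rw [hB, hv₀] at h1; nlinarith
    exact_mod_cast this
  apply hz₀
  apply subharmonic_bot_of_ball hu ht (c₁ := c) hβp
  intro z hz
  refine EReal.eq_bot_iff_forall_lt _ |>.2 fun y => ?_
  have hq : 0 < L / (C₁ - v₀) := by positivity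
  set M := max (-C₀) ((C₀ - y + 1) / (L / (C₁ - v₀)) - C₀) with hM
  refine (main M (le_max_left _ _) z (ball_subset_closedBall hz)).trans_lt ?_
  have h1 : (C₀ - y + 1) / (L / (C₁ - v₀)) ≤ M + C₀ := by
    have := le_max_right (-C₀) ((C₀ - y + 1) / (L / (C₁ - v₀)) - C₀); linarith
  rw [div_le_iff₀ hq] at h1
  have e : (M + C₀) / (C₁ - v₀) * L = (M + C₀) * (L / (C₁ - v₀)) := by ring
  exact_mod_cast (by rw [e]; linarith : C₀ - (M + C₀) / (C₁ - v₀) * L < y)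

section
open MeasureTheory

/-- rotation by a unit complex number preserves volume on `ℂ × ℂ` -/
theorem rot_mp (u : ℂ) (hu : ‖u‖ = 1) :
    MeasurePreserving (fun p : ℂ × ℂ => u • p) volume volume := by
  have h1 : MeasurePreserving (fun z : ℂ => u * z) volume volume := by
    have := (rotation (⟨u, by simp [Submonoid.unitSphere, hu]⟩ : Circle)).measurePreserving
    exact this
  exact h1.prod h1

theorem exists_mollifier (τ : ℝ) (hτ : 0 < τ) : ∃ ρ : ℂ × ℂ → ℝ, ContDiff ℝ 2 ρ ∧ HasCompactSupport ρ ∧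
    (∀ p, 0 ≤ ρ p) ∧ (∀ p, τ < ‖p‖ → ρ p = 0) ∧ (∫ p, ρ p = 1) ∧
    ∀ (u : ℂ), ‖u‖ = 1 → ∀ p, ρ (u • p) = ρ p := by
  let f : ContDiffBump (0:ℝ) := ⟨τ^2/2, τ^2, by positivity, by nlinarith [sq_pos_of_pos hτ]⟩
  let g : ℂ × ℂ → ℝ := fun p => f (‖p.1‖^2 + ‖p.2‖^2)
  have hg0 : ∀ p, 0 ≤ g p := fun p => f.nonneg
  have hgs : ContDiff ℝ 2 g := by
    apply f.contDiff.comp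
    exact (contDiff_fst.norm_sq ℝ).add (contDiff_snd.norm_sq ℝ)
  have hz : ∀ p, τ < ‖p‖ → g p = 0 := by
    intro p hp
    apply f.zero_of_le_dist
    rw [Prod.norm_def, lt_max_iff] at hp
    rw [Real.dist_0_eq_abs, abs_of_nonneg (by positivity)]
    show τ^2 ≤ _
    rcases hp with hp | hp
    · nlinarith [sq_nonneg ‖p.2‖, norm_nonneg p.1]
    · nlinarith [sq_nonneg ‖p.1‖, norm_nonneg p.2]
  have hcs : HasCompactSupport g := by
    apply HasCompactSupport.intro (isCompact_closedBall (0 : ℂ × ℂ) τ)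
    intro p hp
    apply hz
    simpa using hp
  have hintg : 0 < ∫ p, g p := by
    apply hgs.continuous.integral_pos_of_hasCompactSupport_nonneg_nonzero hcs hg0 (x := 0)
    simp only [g]
    have : f (0:ℝ) = 1 := f.one_of_mem_closedBall (by simp [f]; positivity)
    simp [this]
  refine ⟨fun p => (∫ p, g p)⁻¹ * g p, contDiff_const.mul hgs, hcs.mul_left, ?_, ?_, ?_, ?_⟩
  · intro p; exact mul_nonneg (inv_nonneg.2 hintg.le) (hg0 p)
  · intro p hp; simp [hz p hp]
  · rw [integral_const_mul, inv_mul_cancel₀ hintg.ne']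
  · intro u hu p
    simp [g, hu]

theorem usc_sup_ball {H : ℂ × ℂ → ℝ} (hH : UpperSemicontinuous H) (r : ℝ) :
    ∃ C, ∀ p, ‖p‖ ≤ r → H p ≤ C := by
  obtain ⟨C, hC⟩ := (hH.upperSemicontinuousOn (closedBall 0 r)).bddAbove_of_isCompact
    (isCompact_closedBall (0 : ℂ × ℂ) r)
  exact ⟨C, fun p hp => hC (mem_image_of_mem _ (by simpa using hp))⟩

theorem usc_bound {H : ℂ × ℂ → ℝ} (hH : UpperSemicontinuous H) {B : ℝ} (hB : ∀ p, -B ≤ H p) (r : ℝ) :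
    ∃ C, 0 ≤ C ∧ ∀ p, ‖p‖ ≤ r → |H p| ≤ C := by
  obtain ⟨C, hC⟩ := usc_sup_ball hH r
  refine ⟨max |C| |B|, le_max_of_le_left (abs_nonneg _), fun p hp => abs_le.2 ⟨?_, ?_⟩⟩
  · linarith [hB p, le_abs_self B, le_max_right |C| |B|]
  · linarith [hC p hp, le_abs_self C, le_max_left |C| |B|]

theorem moll_fubini {H : ℂ × ℂ → ℝ} (hH : UpperSemicontinuous H) {B : ℝ} (hB : ∀ p, -B ≤ H p)
    {ρ : ℂ × ℂ → ℝ} (hρc : Continuous ρ) (hρs : HasCompactSupport ρ)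
    (X : (ℂ × ℂ) × ℝ → ℂ × ℂ) (hX : Continuous X) :
    Integrable (fun q : (ℂ × ℂ) × ℝ => ρ q.1 * H (X q))
      ((volume : Measure (ℂ × ℂ)).prod (volume.restrict (Ioc 0 (2 * Real.pi)))) := by
  have hK : IsCompact (tsupport ρ ×ˢ Icc (0:ℝ) (2 * Real.pi)) := hρs.isCompact.prod isCompact_Icc
  obtain ⟨r, hr⟩ := (hK.image hX).isBounded.exists_norm_le
  obtain ⟨C, hC0, hC⟩ := usc_bound hH hB r
  obtain ⟨R, hR⟩ := hρs.exists_bound_of_continuous hρc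
  have hR0 : 0 ≤ R := (norm_nonneg _).trans (hR 0)
  have hm : Measurable (fun q : (ℂ × ℂ) × ℝ => ρ q.1 * H (X q)) :=
    (hρc.measurable.comp measurable_fst).mul (hH.measurable.comp hX.measurable)
  have hS : MeasurableSet (tsupport ρ) := (isClosed_tsupport ρ).measurableSet
  have e : (fun q : (ℂ × ℂ) × ℝ => ρ q.1 * H (X q)) =
      indicator (tsupport ρ ×ˢ univ) (fun q : (ℂ × ℂ) × ℝ => ρ q.1 * H (X q)) := by
    symm
    rw [Set.indicator_eq_self]
    intro q hq
    refine ⟨?_, trivial⟩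
    apply subset_tsupport
    intro h0
    apply hq
    simp [h0]
  rw [e, integrable_indicator_iff (hS.prod MeasurableSet.univ), IntegrableOn]
  rw [← Measure.prod_restrict, Measure.restrict_univ]
  have hfin : IsFiniteMeasure (volume.restrict (tsupport ρ)) :=
    ⟨by simpa using hρs.isCompact.measure_lt_top⟩
  apply Integrable.of_bound hm.aestronglyMeasurable (R * C)
  rw [Measure.prod_restrict]
  apply ae_restrict_of_forall_mem (hS.prod measurableSet_Ioc)
  rintro q ⟨h1, h2⟩
  rw [norm_mul]
  apply mul_le_mul (hR _) (hC _ (hr _ ⟨q, ⟨h1, Ioc_subset_Icc_self h2⟩, rfl⟩)) (abs_nonneg _) hR0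

end

section
open MeasureTheory

theorem moll_swap {H : ℂ × ℂ → ℝ} (hH : UpperSemicontinuous H) {B : ℝ} (hB : ∀ p, -B ≤ H p)
    {ρ : ℂ × ℂ → ℝ} (hρc : Continuous ρ) (hρs : HasCompactSupport ρ) (q : ℂ × ℂ → ℂ × ℂ)
    (w : ℂ × ℂ → ℂ × ℂ) (hq : Continuous q) (hw : Continuous w) :
    Integrable (fun y => ρ y * Real.circleAverage (fun t => H (q y + t • w y)) 0 1) ∧
    ∫ y, ρ y * Real.circleAverage (fun t => H (q y + t • w y)) 0 1
      = Real.circleAverage (fun t => ∫ y, ρ y * H (q y + t • w y)) 0 1 := by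
  have hI := moll_fubini hH hB hρc hρs (fun s => q s.1 + circleMap 0 1 s.2 • w s.1)
    ((hq.comp continuous_fst).add (((continuous_circleMap 0 1).comp continuous_snd).smul
      (hw.comp continuous_fst)))
  have e : ∀ y, ρ y * Real.circleAverage (fun t => H (q y + t • w y)) 0 1 =
      (2 * Real.pi)⁻¹ * ∫ θ in Ioc 0 (2 * Real.pi), ρ y * H (q y + circleMap 0 1 θ • w y) := by
    intro y
    rw [Real.circleAverage_def, smul_eq_mul, intervalIntegral.integral_of_le Real.two_pi_pos.le,
      integral_const_mul]
    ring
  constructor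
  · simp_rw [e]
    exact hI.integral_prod_left.const_mul _
  · simp_rw [e]
    rw [integral_const_mul, Real.circleAverage_def, smul_eq_mul,
      intervalIntegral.integral_of_le Real.two_pi_pos.le]
    congr 1
    exact integral_integral_swap hI

theorem moll_int {H : ℂ × ℂ → ℝ} (hH : UpperSemicontinuous H) {B : ℝ} (hB : ∀ p, -B ≤ H p)
    {ρ : ℂ × ℂ → ℝ} (hρc : Continuous ρ) (hρs : HasCompactSupport ρ) (q : ℂ × ℂ → ℂ × ℂ)
    (hq : Continuous q) : Integrable (fun y => ρ y * H (q y)) := by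
  have := (moll_swap hH hB hρc hρs q 0 hq continuous_zero).1
  simpa [Real.circleAverage_const] using this

/-- Smoothing of functions with the sub-mean value property on complex lines. -/
theorem smoothing {H : ℂ × ℂ → ℝ} (hH : UpperSemicontinuous H) {B : ℝ} (hB : ∀ p, -B ≤ H p)
    (hsub : ∀ p v, H p ≤ Real.circleAverage (fun t => H (p + t • v)) 0 1) (τ : ℝ) (hτ : 0 < τ) :
    ∃ Ψ : ℂ × ℂ → ℝ, ContDiff ℝ 2 Ψ ∧ (∀ p, H p ≤ Ψ p) ∧
      (∀ p C, (∀ q, dist q p ≤ τ → H q ≤ C) → Ψ p ≤ C) ∧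
      (∀ p v, Ψ p ≤ Real.circleAverage (fun t => Ψ (p + t • v)) 0 1) := by
  obtain ⟨ρ, hρ, hρs, hρ0, hρτ, hρ1, hρr⟩ := exists_mollifier τ hτ
  have hρc := hρ.continuous
  have hρi : Integrable ρ := hρc.integrable_of_hasCompactSupport hρs
  refine ⟨fun p => ∫ y, ρ y * H (p - y), ?_, ?_, ?_, ?_⟩
  · have hl : LocallyIntegrable H := by
      rw [locallyIntegrable_iff]
      intro K hK
      obtain ⟨r, hr⟩ := hK.isBounded.exists_norm_le
      obtain ⟨C, hC0, hC⟩ := usc_bound hH hB r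
      refine Measure.integrableOn_of_bounded hK.measure_lt_top.ne
        hH.measurable.aestronglyMeasurable (M := C) ?_
      exact ae_restrict_of_forall_mem hK.measurableSet fun p hp => hC p (hr p hp)
    have : (volume : Measure (ℂ × ℂ)).IsAddLeftInvariant :=
      inferInstanceAs (((volume : Measure ℂ).prod (volume : Measure ℂ)).IsAddLeftInvariant)
    have : (volume : Measure (ℂ × ℂ)).IsNegInvariant := by
      constructor
      have := (rot_mp (-1) (by simp)).map_eq
      simpa [Measure.neg] using this
    exact hρs.contDiff_convolution_left (ContinuousLinearMap.mul ℝ ℝ) hρ hl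
  · intro p
    have h1 : ∀ u : ℂ, ‖u‖ = 1 → ∫ y, ρ y * H (p + u • y) = ∫ y, ρ y * H (p - y) := by
      intro u hu
      have hm := rot_mp (-u) (by simpa using hu)
      have he : MeasurableEmbedding (fun p : ℂ × ℂ => (-u) • p) :=
        measurableEmbedding_const_smul₀ (by intro h; simp at h; simp [h] at hu)
      rw [← hm.integral_comp he (fun y => ρ y * H (p - y))]
      congr 1; ext y
      rw [hρr _ (by simpa using hu)]
      simp
    obtain ⟨i1, i2⟩ := moll_swap hH hB hρc hρs (fun _ => p) id continuous_const continuous_id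
    have h2 : Real.circleAverage (fun t => ∫ y, ρ y * H (p + t • id y)) 0 1 =
        ∫ y, ρ y * H (p - y) := by
      rw [← Real.circleAverage_const (∫ y, ρ y * H (p - y)) 0 1]
      apply Real.circleAverage_congr_sphere
      intro t ht
      exact h1 t (by simpa using ht)
    show H p ≤ ∫ y, ρ y * H (p - y)
    rw [← h2, ← i2]
    calc H p = ∫ y, ρ y * H p := by rw [integral_mul_const, hρ1, one_mul]
      _ ≤ _ := integral_mono (hρi.mul_const _) i1
        fun y => mul_le_mul_of_nonneg_left (hsub p y) (hρ0 y)
  · intro p C hC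
    calc ∫ y, ρ y * H (p - y) ≤ ∫ y, ρ y * C := by
          refine integral_mono (moll_int hH hB hρc hρs _ (continuous_const.sub continuous_id))
            (hρi.mul_const _) fun y => ?_
          rcases lt_or_ge τ ‖y‖ with h | h
          · simp [hρτ y h]
          · exact mul_le_mul_of_nonneg_left (hC _ (by simpa [dist_eq_norm] using h)) (hρ0 y)
      _ = C := by rw [integral_mul_const, hρ1, one_mul]
  · intro p v
    obtain ⟨i1, i2⟩ := moll_swap hH hB hρc hρs (fun y => p - y) (fun _ => v)
      (continuous_const.sub continuous_id) continuous_const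
    calc ∫ y, ρ y * H (p - y) ≤ _ := integral_mono
            (moll_int hH hB hρc hρs _ (continuous_const.sub continuous_id)) i1
            fun y => mul_le_mul_of_nonneg_left (hsub _ v) (hρ0 y)
      _ = _ := i2
      _ = _ := by
        congr 1; ext t; congr 1; ext y; congr 2; abel

end

theorem taylor1 {g gone gtwo : ℝ → ℝ} (h1 : ∀ t, HasDerivAt g (gone t) t) (h2 : ∀ t, HasDerivAt gone (gtwo t) t)
    {c : ℝ} (hc : ∀ t ∈ Icc (0:ℝ) 1, c ≤ gtwo t) : g 0 + gone 0 + c / 2 ≤ g 1 := by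
  have m1 : MonotoneOn (fun t => gone t - c * t) (Icc 0 1) := by
    have hd : ∀ t, HasDerivAt (fun t => gone t - c * t) (gtwo t - c) t := fun t => by
      simpa using (h2 t).fun_sub ((hasDerivAt_id' t).const_mul c)
    apply monotoneOn_of_deriv_nonneg (convex_Icc 0 1) (fun t _ => (hd t).continuousAt.continuousWithinAt)
      (fun t _ => (hd t).differentiableAt.differentiableWithinAt)
    intro t ht
    rw [(hd t).deriv]
    linarith [hc t (interior_subset ht)]
  have m2 : MonotoneOn (fun t => g t - gone 0 * t - c * t ^ 2 / 2) (Icc 0 1) := by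
    have hd : ∀ t, HasDerivAt (fun t => g t - gone 0 * t - c * t ^ 2 / 2) (gone t - gone 0 - c * t) t := fun t => by
      have := ((h1 t).fun_sub ((hasDerivAt_id' t).const_mul (gone 0))).fun_sub ((((hasDerivAt_id' t).fun_pow 2).const_mul c).div_const 2)
      refine this.congr_deriv ?_
      simp; ring
    apply monotoneOn_of_deriv_nonneg (convex_Icc 0 1) (fun t _ => (hd t).continuousAt.continuousWithinAt)
      (fun t _ => (hd t).differentiableAt.differentiableWithinAt)
    intro t ht
    rw [(hd t).deriv]
    have ht' := interior_subset ht
    have := m1 (left_mem_Icc.2 zero_le_one) ht' ht'.1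
    simp at this
    linarith
  have := m2 (left_mem_Icc.2 zero_le_one) (right_mem_Icc.2 zero_le_one) zero_le_one
  simp at this
  linarith

abbrev DD (ψ : ℂ × ℂ → ℝ) (q : ℂ × ℂ) : ℂ × ℂ →L[ℝ] ℂ × ℂ →L[ℝ] ℝ := fderiv ℝ (fderiv ℝ ψ) q

theorem cd_fderiv {ψ : ℂ × ℂ → ℝ} (hψ : ContDiff ℝ 2 ψ) : ContDiff ℝ 1 (fderiv ℝ ψ) :=
  hψ.fderiv_right (by norm_num)

theorem cd_DD {ψ : ℂ × ℂ → ℝ} (hψ : ContDiff ℝ 2 ψ) : Continuous (DD ψ) :=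
  (cd_fderiv hψ).continuous_fderiv (by norm_num)

theorem line_deriv1 {ψ : ℂ × ℂ → ℝ} (hψ : ContDiff ℝ 2 ψ) (x h : ℂ × ℂ) (t : ℝ) :
    HasDerivAt (fun t : ℝ => ψ (x + t • h)) (fderiv ℝ ψ (x + t • h) h) t := by
  have h1 : HasDerivAt (fun t : ℝ => x + t • h) h t := by
    simpa using ((hasDerivAt_id t).smul_const h).const_add x
  exact ((hψ.differentiable (by norm_num) _).hasFDerivAt).comp_hasDerivAt t h1

theorem line_deriv2 {ψ : ℂ × ℂ → ℝ} (hψ : ContDiff ℝ 2 ψ) (x h : ℂ × ℂ) (t : ℝ) :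
    HasDerivAt (fun t : ℝ => fderiv ℝ ψ (x + t • h) h) (DD ψ (x + t • h) h h) t := by
  have h1 : HasDerivAt (fun t : ℝ => x + t • h) h t := by
    simpa using ((hasDerivAt_id t).smul_const h).const_add x
  have := (((cd_fderiv hψ).differentiable (by norm_num) _).hasFDerivAt).comp_hasDerivAt t h1
  have h3 : HasDerivAt (fun t : ℝ => fderiv ℝ ψ (x + t • h)) (DD ψ (x + t • h) h) t := this
  simpa using h3.clm_apply (hasDerivAt_const t h)

theorem taylor_lower {ψ : ℂ × ℂ → ℝ} (hψ : ContDiff ℝ 2 ψ) (x h : ℂ × ℂ) {c : ℝ}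
    (hc : ∀ t ∈ Icc (0:ℝ) 1, c ≤ DD ψ (x + t • h) h h) :
    ψ x + fderiv ℝ ψ x h + c / 2 ≤ ψ (x + h) := by
  have := taylor1 (line_deriv1 hψ x h) (line_deriv2 hψ x h) hc
  simpa using this

theorem taylor_upper {ψ : ℂ × ℂ → ℝ} (hψ : ContDiff ℝ 2 ψ) (x h : ℂ × ℂ) {c : ℝ}
    (hc : ∀ t ∈ Icc (0:ℝ) 1, DD ψ (x + t • h) h h ≤ c) :
    ψ (x + h) ≤ ψ x + fderiv ℝ ψ x h + c / 2 := by
  have := taylor1 (fun t => (line_deriv1 hψ x h t).neg) (fun t => (line_deriv2 hψ x h t).neg)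
    (c := -c) (fun t ht => neg_le_neg (hc t ht))
  simp at this
  linarith

theorem csmul_eq (u : ℂ) (v : ℂ × ℂ) : u • v = u.re • v + u.im • (Complex.I • v) := by
  conv_lhs => rw [← Complex.re_add_im u]
  rw [add_smul, mul_smul]
  rfl

theorem levi {ψ : ℂ × ℂ → ℝ} (hψ : ContDiff ℝ 2 ψ) {κ : ℝ} 
    (hsub : ∀ p v : ℂ × ℂ, ψ p + κ * (‖v.1‖ ^ 2 + ‖v.2‖ ^ 2) ≤
      Real.circleAverage (fun t : ℂ => ψ (p + t • v)) 0 1) (q v : ℂ × ℂ) :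
    4 * κ * (‖v.1‖ ^ 2 + ‖v.2‖ ^ 2) ≤ DD ψ q v v + DD ψ q (Complex.I • v) (Complex.I • v) := by
  apply le_of_forall_pos_le_add
  intro η hη
  set ε := η / (2 * (‖v‖ ^ 2 + 1)) with hε
  have hεpos : 0 < ε := by positivity
  have hcc := (cd_DD hψ).continuousAt (x := q)
  obtain ⟨δ, hδ, hδ'⟩ := (Metric.continuousAt_iff (α := ℂ × ℂ)
    (β := ℂ × ℂ →L[ℝ] ℂ × ℂ →L[ℝ] ℝ)).1 hcc ε hεpos
  set s := δ / (2 * (‖v‖ + 1)) with hs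
  have hspos : 0 < s := by positivity
  have hsv : s * ‖v‖ < δ := by
    rw [hs, div_mul_eq_mul_div, div_lt_iff₀ (by positivity)]
    nlinarith [norm_nonneg v]
  set iv := Complex.I • v with hiv
  set B := DD ψ q with hB
  set A := fderiv ℝ ψ q with hA
  have hsymm : B iv v = B v iv := by
    have : IsSymmSndFDerivAt ℝ ψ q := hψ.contDiffAt.isSymmSndFDerivAt (by simp)
    exact this.eq iv v
  set P : ℂ[X] := C ((ψ q + ε * s^2 * ‖v‖^2 / 2 + s^2 * (B v v + B iv iv)/4 : ℝ) : ℂ) +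
      C (s * ((A v : ℂ) - Complex.I * (A iv : ℂ))) * X +
      C (s^2/2 * (((B v v - B iv iv)/2 : ℝ) - Complex.I * (B v iv : ℂ))) * X ^ 2 with hP
  have key : ∀ t ∈ sphere (0:ℂ) 1, ψ (q + t • (s • v)) ≤ (P.eval t).re := by
    intro t ht
    have hnt : ‖t‖ = 1 := by simpa using ht
    have hnt2 : t.re ^ 2 + t.im ^ 2 = 1 := by
      have := Complex.sq_norm t
      rw [hnt, Complex.normSq_apply] at this
      nlinarith
    set h := t • (s • v) with hh
    have hnh : ‖h‖ = s * ‖v‖ := by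
      rw [hh, norm_smul, norm_smul, hnt, Real.norm_of_nonneg hspos.le, one_mul]
    have hup : ψ (q + h) ≤ ψ q + A h + (B h h + ε * ‖h‖^2) / 2 := by
      apply taylor_upper hψ
      intro r hr
      have h1 : dist (q + r • h) q < δ := by
        rw [dist_eq_norm, add_sub_cancel_left, norm_smul, Real.norm_of_nonneg hr.1, hnh]
        calc r * (s * ‖v‖) ≤ 1 * (s * ‖v‖) := by gcongr; exact hr.2
          _ < δ := by linarith
      have h2 : ‖DD ψ (q + r • h) - B‖ < ε :=
        lt_of_eq_of_lt (dist_eq_norm (E := ℂ × ℂ →L[ℝ] ℂ × ℂ →L[ℝ] ℝ) _ _).symm (hδ' h1)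
      have h3 : (DD ψ (q + r • h) - B) h h ≤ ε * ‖h‖^2 := by
        calc _ ≤ ‖(DD ψ (q + r • h) - B) h h‖ := Real.le_norm_self _
          _ ≤ ‖(DD ψ (q + r • h) - B)‖ * ‖h‖ * ‖h‖ := ContinuousLinearMap.le_opNorm₂ _ _ _
          _ ≤ ε * ‖h‖ * ‖h‖ := by gcongr
          _ = _ := by ring
      simp only [ContinuousLinearMap.sub_apply] at h3
      linarith
    have eh : h = (s * t.re) • v + (s * t.im) • iv := by
      rw [hh, csmul_eq, hiv, smul_comm Complex.I s v, smul_smul, smul_smul, mul_comm s, mul_comm s]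
    have e1 : A h = s * t.re * A v + s * t.im * A iv := by
      rw [eh]; simp
    have e2 : B h h = s^2 * (t.re^2 * B v v + 2 * t.re * t.im * B v iv + t.im^2 * B iv iv) := by
      rw [eh]; simp only [map_add, map_smul, _root_.add_apply, _root_.smul_apply, smul_eq_mul, hsymm]
      ring
    have e3 : (P.eval t).re = ψ q + ε * s^2 * ‖v‖^2 / 2 + s^2 * (B v v + B iv iv)/4 +
        (s * t.re * A v + s * t.im * A iv) + s^2/2 * ((B v v - B iv iv)/2 * (t.re^2-t.im^2) + B v iv * (2 * t.re * t.im)) := by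
      simp [hP, pow_two]
      ring
    rw [e3]
    refine hup.trans (le_of_eq ?_)
    rw [e1, e2, hnh]
    have : t.im^2 = 1 - t.re^2 := by linarith
    rw [this]; ring
  have havg : Real.circleAverage (fun t : ℂ => ψ (q + t • (s • v))) 0 1 ≤ (P.eval 0).re := by
    rw [← poly_re_circleAverage P 0 1]
    apply Real.circleAverage_mono
    · apply ContinuousOn.circleIntegrable'
      exact (hψ.continuous.comp (by fun_prop)).continuousOn
    · apply ContinuousOn.circleIntegrable'
      exact (Complex.continuous_re.comp P.continuous).continuousOn
    · intro t ht
      exact key t (by simpa using ht)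
  have h0 := hsub q (s • v)
  have e0 : (P.eval 0).re = ψ q + ε * s^2 * ‖v‖^2 / 2 + s^2 * (B v v + B iv iv)/4 := by
    simp only [hP]
    simp only [eval_add, eval_mul, eval_C, eval_X, eval_pow, mul_zero, zero_pow two_ne_zero, add_zero, Complex.ofReal_re]
  have e4 : ‖(s • v).1‖ ^ 2 + ‖(s • v).2‖ ^ 2 = s^2 * (‖v.1‖^2+‖v.2‖^2) := by
    simp [norm_smul, mul_pow]; ring
  rw [e4] at h0
  have h5 := h0.trans havg
  rw [e0] at h5
  have h6 : 4 * κ * (‖v.1‖ ^ 2 + ‖v.2‖ ^ 2) ≤ B v v + B iv iv + 2 * ε * ‖v‖^2 := by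
    have : s^2 * (4 * κ * (‖v.1‖ ^ 2 + ‖v.2‖ ^ 2)) ≤ s^2 * (B v v + B iv iv + 2 * ε * ‖v‖^2) := by linarith
    exact le_of_mul_le_mul_left this (by positivity)
  have h7 : 2 * ε * ‖v‖^2 ≤ η := by
    have : η = 2 * ε * (‖v‖^2+1) := by rw [hε]; field_simp
    rw [this]; nlinarith
  linarith

theorem exists_quad_root (a b c : ℂ) (hc : c ≠ 0) : ∃ t : ℂ, a + 2 * t * b + t ^ 2 * c = 0 := by
  obtain ⟨s, hs⟩ := IsAlgClosed.exists_pow_nat_eq (b ^ 2 - a * c) (n := 2) (by norm_num)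
  refine ⟨(s - b) / c, ?_⟩
  field_simp
  linear_combination hs

theorem null_dir (B : ℂ × ℂ →L[ℝ] ℂ × ℂ →L[ℝ] ℝ) (hB : ∀ x y, B x y = B y x) :
    ∃ v : ℂ × ℂ, ‖v‖ = 1 ∧ B v v = B (Complex.I • v) (Complex.I • v) ∧ B v (Complex.I • v) = 0 := by
  suffices h : ∃ v : ℂ × ℂ, v ≠ 0 ∧ B v v = B (Complex.I • v) (Complex.I • v) ∧ B v (Complex.I • v) = 0 by
    obtain ⟨v, hv, h1, h2⟩ := h
    refine ⟨(‖v‖⁻¹ : ℝ) • v, ?_, ?_, ?_⟩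
    · rw [norm_smul, norm_inv, norm_norm, inv_mul_cancel₀ (norm_ne_zero_iff.2 hv)]
    · rw [smul_comm Complex.I]
      simp only [map_smul, _root_.smul_apply, h1]
    · rw [smul_comm Complex.I]
      simp only [map_smul, _root_.smul_apply, h2, smul_zero]
  set e1 : ℂ × ℂ := (1, 0) with he1
  set e2 : ℂ × ℂ := (0, 1) with he2
  set f1 := Complex.I • e1 with hf1
  set f2 := Complex.I • e2 with hf2
  by_cases hc : (⟨B e2 e2 - B f2 f2, -2 * B e2 f2⟩ : ℂ) = 0
  · refine ⟨e2, by simp [he2], ?_, ?_⟩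
    · have := congrArg Complex.re hc
      simp at this
      linarith
    · have := congrArg Complex.im hc
      simpa using this
  · obtain ⟨t, ht⟩ := exists_quad_root ⟨B e1 e1 - B f1 f1, -2 * B e1 f1⟩
      ⟨B e1 e2 - B f1 f2, -(B e1 f2 + B f1 e2)⟩ _ hc
    have hv : e1 + t • e2 = e1 + t.re • e2 + t.im • f2 := by
      rw [csmul_eq t e2, add_assoc]
    have hiv : Complex.I • (e1 + t • e2) = f1 + t.re • f2 - t.im • e2 := by
      rw [hv, smul_add, smul_add, smul_comm Complex.I t.re, smul_comm Complex.I t.im, hf2, smul_smul,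
        Complex.I_mul_I, neg_one_smul, smul_neg, sub_eq_add_neg]
    refine ⟨e1 + t • e2, ?_, ?_, ?_⟩
    · intro h
      have := congrArg Prod.fst h
      simp [he1, he2] at this
    · have := congrArg Complex.re ht
      simp [pow_two] at this
      rw [hiv, hv]
      simp only [map_add, map_sub, map_smul, _root_.add_apply, _root_.sub_apply, _root_.smul_apply, smul_eq_mul]
      have s1 := hB e2 e1
      have s2 := hB f2 f1
      have s3 := hB f2 e1
      have s4 := hB e2 f1
      have s5 := hB f2 e2
      rw [s1, s2, s3, s4, s5]
      linear_combination this
    · have := congrArg Complex.im ht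
      simp [pow_two] at this
      rw [hiv, hv]
      simp only [map_add, map_sub, map_smul, _root_.add_apply, _root_.sub_apply, _root_.smul_apply, smul_eq_mul]
      have s1 := hB e2 e1
      have s2 := hB f2 f1
      have s3 := hB f2 e1
      have s4 := hB e2 f1
      have s5 := hB f2 e2
      rw [s2, s4, s5]
      linear_combination (-1/2) * this

theorem analytic_facts {ψ : ℂ × ℂ → ℝ} (hψ : ContDiff ℝ 2 ψ) {κ : ℝ} (hκ : 0 < κ)
    (hlevi : ∀ q v : ℂ × ℂ, 4 * κ * (‖v.1‖ ^ 2 + ‖v.2‖ ^ 2) ≤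
      DD ψ q v v + DD ψ q (Complex.I • v) (Complex.I • v)) (R : ℝ) :
    ∃ M ρ₀ : ℝ, 1 ≤ M ∧ 0 < ρ₀ ∧
      (∀ x ∈ closedBall (0 : ℂ × ℂ) R, ∀ y ∈ closedBall (0 : ℂ × ℂ) R,
        ψ x + fderiv ℝ ψ x (y - x) - M * ‖y - x‖ ^ 2 ≤ ψ y) ∧
      (∀ x ∈ closedBall (0 : ℂ × ℂ) R, ∀ y ∈ closedBall (0 : ℂ × ℂ) R,
        ‖fderiv ℝ ψ y - fderiv ℝ ψ x‖ ≤ M * ‖y - x‖) ∧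
      (∀ q ∈ closedBall (0 : ℂ × ℂ) R, ∃ v : ℂ × ℂ, ‖v‖ = 1 ∧ ∀ q', dist q' q ≤ ρ₀ → ∀ u : ℂ, ‖u‖ ≤ ρ₀ →
        ψ q' + fderiv ℝ ψ q' (u • v) + κ / 2 * ‖u‖ ^ 2 ≤ ψ (q' + u • v)) := by
  obtain ⟨M₀, hM₀⟩ := (isCompact_closedBall (0 : ℂ × ℂ) R).exists_bound_of_continuousOn
    (f := DD ψ) (E := ℂ × ℂ →L[ℝ] ℂ × ℂ →L[ℝ] ℝ) (cd_DD hψ).continuousOn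
  have huc := (isCompact_closedBall (0 : ℂ × ℂ) (R + 2)).uniformContinuousOn_of_continuous
    (f := DD ψ) (β := ℂ × ℂ →L[ℝ] ℂ × ℂ →L[ℝ] ℝ) (cd_DD hψ).continuousOn
  obtain ⟨δ, hδ, hδ'⟩ := (Metric.uniformContinuousOn_iff (β := ℂ × ℂ →L[ℝ] ℂ × ℂ →L[ℝ] ℝ)).1 huc κ hκ
  have hM : ∀ x ∈ closedBall (0 : ℂ × ℂ) R, ‖DD ψ x‖ ≤ max M₀ 1 := fun x hx =>
    (hM₀ x hx).trans (le_max_left _ _)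
  have hMpos : 0 < max M₀ 1 := lt_of_lt_of_le one_pos (le_max_right _ _)
  refine ⟨max M₀ 1, min 1 (δ / 3), le_max_right _ _, by positivity, ?_, ?_, ?_⟩
  · intro x hx y hy
    have := taylor_lower hψ x (y - x) (c := -(2 * (max M₀ 1 * ‖y - x‖ ^ 2))) ?_
    · rw [add_sub_cancel] at this
      linarith
    · intro t ht
      have hmem : x + t • (y - x) ∈ closedBall (0 : ℂ × ℂ) R :=
        (convex_closedBall _ _).add_smul_sub_mem hx hy ht
      have h1 : ‖DD ψ (x + t • (y - x)) (y - x) (y - x)‖ ≤ max M₀ 1 * ‖y - x‖ * ‖y - x‖ :=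
        (ContinuousLinearMap.le_opNorm₂ _ _ _).trans (by gcongr; exact hM _ hmem)
      have h2 := neg_le_of_abs_le h1
      have h3 : 0 ≤ max M₀ 1 * ‖y - x‖ ^ 2 := by positivity
      nlinarith
  · intro x hx y hy
    exact (convex_closedBall (0 : ℂ × ℂ) R).norm_image_sub_le_of_norm_fderiv_le
      (fun z _ => (cd_fderiv hψ).differentiable (by norm_num) z) hM hx hy
  · intro q hq
    have hsymm : IsSymmSndFDerivAt ℝ ψ q := hψ.contDiffAt.isSymmSndFDerivAt (by simp)
    obtain ⟨v, hv1, hv2, hv3⟩ := null_dir (DD ψ q) (fun x y => hsymm.eq x y)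
    refine ⟨v, hv1, ?_⟩
    intro q' hq' u hu
    have hl := hlevi q v
    have hn : 1 ≤ ‖v.1‖ ^ 2 + ‖v.2‖ ^ 2 := by
      rw [Prod.norm_def] at hv1
      rcases max_choice ‖v.1‖ ‖v.2‖ with h | h <;> rw [h] at hv1 <;> rw [hv1] <;> nlinarith [sq_nonneg ‖v.1‖, sq_nonneg ‖v.2‖]
    have hvv : 2 * κ ≤ DD ψ q v v := by nlinarith
    have hBu : DD ψ q (u • v) (u • v) = ‖u‖ ^ 2 * DD ψ q v v := by
      rw [csmul_eq u v]
      simp only [map_add, map_smul, _root_.add_apply, _root_.smul_apply, smul_eq_mul]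
      have s1 : DD ψ q (Complex.I • v) v = DD ψ q v (Complex.I • v) := hsymm.eq _ _
      rw [s1, ← hv2, hv3, Complex.sq_norm, Complex.normSq_apply]
      ring
    have hnu : ‖u • v‖ = ‖u‖ := by rw [norm_smul, hv1, mul_one]
    have := taylor_lower hψ q' (u • v) (c := κ * ‖u‖ ^ 2) ?_
    · linarith
    · intro t ht
      rw [mem_closedBall, dist_zero_right] at hq
      have hu1 : ‖u‖ ≤ 1 := hu.trans (min_le_left _ _)
      have hu2 : ‖u‖ ≤ δ / 3 := hu.trans (min_le_right _ _)
      have hq1 : dist q' q ≤ 1 := hq'.trans (min_le_left _ _)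
      have hq2 : dist q' q ≤ δ / 3 := hq'.trans (min_le_right _ _)
      have hd : dist (q' + t • (u • v)) q ≤ dist q' q + ‖u‖ := by
        calc dist (q' + t • (u • v)) q ≤ dist (q' + t • (u • v)) q' + dist q' q := dist_triangle _ _ _
          _ ≤ ‖u‖ + dist q' q := by
            gcongr
            rw [dist_eq_norm, add_sub_cancel_left, norm_smul, hnu, Real.norm_of_nonneg ht.1]
            nlinarith [ht.2, norm_nonneg u]
          _ = _ := by ring
      have m1 : q' + t • (u • v) ∈ closedBall (0 : ℂ × ℂ) (R + 2) := by
        rw [mem_closedBall, dist_zero_right]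
        have := norm_le_norm_add_norm_sub q (q' + t • (u • v))
        rw [← dist_eq_norm, dist_comm] at this
        linarith
      have m2 : q ∈ closedBall (0 : ℂ × ℂ) (R + 2) := by
        rw [mem_closedBall, dist_zero_right]; linarith
      have h4 : ‖DD ψ (q' + t • (u • v)) - DD ψ q‖ < κ :=
        lt_of_eq_of_lt (dist_eq_norm (E := ℂ × ℂ →L[ℝ] ℂ × ℂ →L[ℝ] ℝ) _ _).symm
          (hδ' _ m1 _ m2 (by linarith))
      have h1 : ‖(DD ψ (q' + t • (u • v)) - DD ψ q) (u • v) (u • v)‖ ≤ κ * ‖u • v‖ * ‖u • v‖ :=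
        (ContinuousLinearMap.le_opNorm₂ _ _ _).trans (by gcongr)
      have h2 := neg_le_of_abs_le h1
      simp only [_root_.sub_apply] at h2
      rw [hnu, hBu] at h2
      nlinarith [sq_nonneg ‖u‖]

set_option maxHeartbeats 4000000 in
theorem local_conn {ψ : ℂ × ℂ → ℝ} {D : ℂ × ℂ → ℂ × ℂ →L[ℝ] ℝ} {R M ρ₀ κ : ℝ} (hκ : 0 < κ) (hM : 1 ≤ M)
    (hρ : 0 < ρ₀)
    (h1 : ∀ x ∈ closedBall (0 : ℂ × ℂ) R, ∀ y ∈ closedBall (0 : ℂ × ℂ) R,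
        ψ x + D x (y - x) - M * ‖y - x‖ ^ 2 ≤ ψ y)
    (h2 : ∀ x ∈ closedBall (0 : ℂ × ℂ) R, ∀ y ∈ closedBall (0 : ℂ × ℂ) R,
        ‖D y - D x‖ ≤ M * ‖y - x‖)
    (h3 : ∀ q ∈ closedBall (0 : ℂ × ℂ) R, ∃ v : ℂ × ℂ, ‖v‖ = 1 ∧ ∀ q', dist q' q ≤ ρ₀ → ∀ u : ℂ, ‖u‖ ≤ ρ₀ →
        ψ q' + D q' (u • v) + κ * ‖u‖ ^ 2 ≤ ψ (q' + u • v)) :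
    ∃ C ε₀ : ℝ, 2 ≤ C ∧ 0 < ε₀ ∧ ∀ ε, 0 < ε → ε ≤ ε₀ → ∃ η, 0 < η ∧ ∀ s q, ‖q‖ ≤ R - 1 → s - η ≤ ψ q →
      (∃ p, dist p q ≤ ε / 2 ∧ s ≤ ψ p) ∧
      ∀ a b, dist a q ≤ ε → dist b q ≤ ε → s ≤ ψ a → s ≤ ψ b →
        ∃ S, IsPreconnected S ∧ a ∈ S ∧ b ∈ S ∧ ∀ x ∈ S, s ≤ ψ x ∧ dist x q ≤ C * ε := by
  set K := 24 * M with hK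
  set L := (2 * (K + M) + 1) / κ + 1 with hL
  have hL1 : 1 ≤ L := by
    rw [hL]; have : 0 ≤ (2 * (K + M) + 1) / κ := by positivity
    linarith
  have hκL : 2 * (K + M) + 1 ≤ κ * L := by
    have : κ * L = 2 * (K + M) + 1 + κ := by rw [hL]; field_simp
    linarith
  refine ⟨L + 2, min ρ₀ 1 / (L + 2), by linarith, by positivity, ?_⟩
  intro ε hε hε0
  rw [le_div_iff₀ (by linarith)] at hε0
  have hερ : ε * (L + 2) ≤ ρ₀ := hε0.trans (min_le_left _ _)
  have hε1 : ε * (L + 2) ≤ 1 := hε0.trans (min_le_right _ _)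
  refine ⟨min (ε ^ 2) (κ * ε ^ 2 / 4), by positivity, ?_⟩
  intro s q hq hs
  have hs1 : s - ε ^ 2 ≤ ψ q := by linarith [min_le_left (ε ^ 2) (κ * ε ^ 2 / 4)]
  have hs2 : s - κ * ε ^ 2 / 4 ≤ ψ q := by linarith [min_le_right (ε ^ 2) (κ * ε ^ 2 / 4)]
  have hball : ∀ x, dist x q ≤ ε * (L + 2) → x ∈ closedBall (0 : ℂ × ℂ) R := by
    intro x hx
    rw [mem_closedBall, dist_zero_right]
    have := norm_le_norm_add_norm_sub q x
    rw [← dist_eq_norm, dist_comm] at this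
    linarith
  have hsm : ε ≤ ε * (L + 2) := le_mul_of_one_le_right hε.le (by linarith)
  have hsm2 : 2 * ε ≤ ε * (L + 2) := by
    rw [mul_comm]; exact mul_le_mul_of_nonneg_left (by linarith) hε.le
  have hqR : q ∈ closedBall (0 : ℂ × ℂ) R := hball q (by rw [dist_self]; positivity)
  have hDD : ∀ a, dist a q ≤ ε → ‖D a - D q‖ ≤ M * ε := by
    intro a ha
    refine (h2 q hqR a (hball a (by linarith))).trans ?_
    rw [← dist_eq_norm]; gcongr
  have hDv : ∀ a, dist a q ≤ ε → ∀ x, |D a x - D q x| ≤ M * ε * ‖x‖ := by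
    intro a ha x
    have := (D a - D q).le_opNorm x
    rw [_root_.sub_apply, Real.norm_eq_abs] at this
    exact this.trans (by gcongr; exact hDD a ha)
  rcases le_or_gt (K * ε) ‖D q‖ with hcase | hcase
  · -- gradient case
    obtain ⟨n, hn1, hn2⟩ : ∃ n : ℂ × ℂ, ‖n‖ ≤ 1 ∧ 12 * M * ε ≤ D q n := by
      have : 12 * M * ε < ‖D q‖ := by linarith [mul_pos (lt_of_lt_of_le one_pos hM) hε]
      obtain ⟨x, hx1, hx2⟩ := (D q).exists_lt_apply_of_lt_opNorm this
      rcases le_total 0 (D q x) with h | h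
      · exact ⟨x, hx1.le, by rw [Real.norm_of_nonneg h] at hx2; exact hx2.le⟩
      · refine ⟨-x, by simpa using hx1.le, ?_⟩
        rw [Real.norm_of_nonpos h] at hx2
        rw [map_neg]; exact hx2.le
    have hstep : ∀ a, dist a q ≤ ε → ∀ τ ∈ Icc 0 ε, ψ a + 10 * M * ε * τ ≤ ψ (a + τ • n) := by
      intro a ha τ hτ
      have hτn : ‖τ • n‖ ≤ τ := by
        rw [norm_smul, Real.norm_of_nonneg hτ.1]; exact mul_le_of_le_one_right hτ.1 hn1
      have hd : dist (a + τ • n) q ≤ 2 * ε := by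
        have : dist (a + τ • n) a ≤ τ := by rw [dist_eq_norm, add_sub_cancel_left]; exact hτn
        linarith [dist_triangle (a + τ • n) a q, hτ.2]
      have := h1 a (hball a (by linarith)) (a + τ • n) (hball _ (by linarith))
      rw [add_sub_cancel_left, map_smul, smul_eq_mul] at this
      have h5 := abs_le.1 (hDv a ha n)
      have h6 : M * ε * ‖n‖ ≤ M * ε := by
        have : 0 ≤ M * ε := by positivity
        exact mul_le_of_le_one_right this hn1
      have h7 : 11 * M * ε ≤ D a n := by linarith [h5.1]
      have h8 : τ * (11 * M * ε) ≤ τ * D a n := mul_le_mul_of_nonneg_left h7 hτ.1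
      have h9 : M * ‖τ • n‖ ^ 2 ≤ M * (ε * τ) := by
        gcongr
        calc ‖τ • n‖ ^ 2 ≤ τ ^ 2 := by gcongr
          _ ≤ ε * τ := by rw [pow_two]; exact mul_le_mul_of_nonneg_right hτ.2 hτ.1
      linarith
    refine ⟨⟨q + (ε / 2) • n, ?_, ?_⟩, ?_⟩
    · rw [dist_eq_norm, add_sub_cancel_left, norm_smul, Real.norm_of_nonneg (by positivity)]
      exact mul_le_of_le_one_right (by positivity) hn1
    · have := hstep q (by rw [dist_self]; exact hε.le) (ε / 2) ⟨by positivity, by linarith⟩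
      linarith [sq_nonneg ε, mul_le_mul_of_nonneg_right hM (sq_nonneg ε)]
    · intro a b ha hb hsa hsb
      have hεn : ‖ε • n‖ ≤ ε := by
        rw [norm_smul, Real.norm_of_nonneg hε.le]; exact mul_le_of_le_one_right hε.le hn1
      have hmid : ∀ θ ∈ Icc (0:ℝ) 1, dist (a + θ • (b - a)) q ≤ ε ∧ s - 8 * M * ε ^ 2 ≤ ψ (a + θ • (b - a)) := by
        intro θ hθ
        have hd : a + θ • (b - a) ∈ closedBall q ε := (convex_closedBall q ε).add_smul_sub_mem ha hb hθ
        refine ⟨hd, ?_⟩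
        have hmR := hball _ (le_trans hd hsm)
        have haR := hball a (by linarith)
        have hbR := hball b (by linarith)
        have hab : ‖b - a‖ ≤ 2 * ε := by
          rw [← dist_eq_norm]; linarith [dist_triangle_right b a q]
        have hab2 : ‖b - a‖ ^ 2 ≤ 4 * ε ^ 2 := by
          have := pow_le_pow_left₀ (norm_nonneg (b - a)) hab 2
          linarith
        have t1 := h1 a haR _ hmR
        have t2 := h1 b hbR _ hmR
        rw [add_sub_cancel_left, map_smul, smul_eq_mul, norm_smul, Real.norm_of_nonneg hθ.1, mul_pow] at t1
        have e : a + θ • (b - a) - b = -((1 - θ) • (b - a)) := by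
          rw [sub_smul, one_smul]; abel
        rw [e, map_neg, map_smul, smul_eq_mul, norm_neg, norm_smul, Real.norm_of_nonneg (by linarith [hθ.2]), mul_pow] at t2
        have t3 := h2 a haR b hbR
        have t4 : |D b (b - a) - D a (b - a)| ≤ M * (4 * ε ^ 2) := by
          have := (D b - D a).le_opNorm (b - a)
          rw [_root_.sub_apply, Real.norm_eq_abs] at this
          refine this.trans ?_
          calc ‖D b - D a‖ * ‖b - a‖ ≤ M * ‖b - a‖ * ‖b - a‖ := by gcongr
            _ = M * ‖b - a‖ ^ 2 := by ring
            _ ≤ _ := by gcongr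
        have t5 : θ ^ 2 * ‖b - a‖ ^ 2 ≤ 4 * ε ^ 2 := by
          have : θ ^ 2 ≤ 1 := pow_le_one₀ hθ.1 hθ.2
          exact (mul_le_of_le_one_left (sq_nonneg _) this).trans hab2
        have t6 : (1 - θ) ^ 2 * ‖b - a‖ ^ 2 ≤ 4 * ε ^ 2 := by
          have : (1 - θ) ^ 2 ≤ 1 := pow_le_one₀ (by linarith [hθ.2]) (by linarith [hθ.1])
          exact (mul_le_of_le_one_left (sq_nonneg _) this).trans hab2
        have t5' := mul_le_mul_of_nonneg_left t5 (by linarith : (0:ℝ) ≤ M)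
        have t6' := mul_le_mul_of_nonneg_left t6 (by linarith : (0:ℝ) ≤ M)
        have hpos : 0 ≤ M * ε ^ 2 := by positivity
        rcases le_total 0 (D a (b - a)) with h | h
        · have : 0 ≤ θ * D a (b - a) := mul_nonneg hθ.1 h
          linarith
        · have h7 : D b (b - a) ≤ 4 * (M * ε ^ 2) := by linarith [(abs_le.1 t4).2]
          have : (1 - θ) * D b (b - a) ≤ 4 * (M * ε ^ 2) := by
            have := mul_le_mul_of_nonneg_left h7 (by linarith [hθ.2] : 0 ≤ 1 - θ)
            have h9 := mul_nonneg hθ.1 hpos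
            linarith
          linarith
      have seg1 : ∀ c, dist c q ≤ ε → s ≤ ψ c → ∀ x ∈ segment ℝ c (c + ε • n), s ≤ ψ x ∧ dist x q ≤ (L + 2) * ε := by
        intro c hc hsc x hx
        rw [segment_eq_image'] at hx
        obtain ⟨θ, hθ, rfl⟩ := hx
        simp only [add_sub_cancel_left, smul_smul]
        have hτ : θ * ε ∈ Icc 0 ε := ⟨mul_nonneg hθ.1 hε.le, mul_le_of_le_one_left hε.le hθ.2⟩
        constructor
        · have := hstep c hc (θ * ε) hτ
          have : 0 ≤ 10 * M * ε * (θ * ε) := by have := hτ.1; positivity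
          linarith
        · have : dist (c + (θ * ε) • n) c ≤ ε := by
            rw [dist_eq_norm, add_sub_cancel_left, norm_smul, Real.norm_of_nonneg hτ.1]
            exact (mul_le_of_le_one_right hτ.1 hn1).trans hτ.2
          linarith [dist_triangle (c + (θ * ε) • n) c q]
      refine ⟨segment ℝ a (a + ε • n) ∪ segment ℝ (a + ε • n) (b + ε • n) ∪ segment ℝ b (b + ε • n), ?_, ?_, ?_, ?_⟩
      · apply IsPreconnected.union (b + ε • n) (Or.inr (right_mem_segment _ _ _)) (right_mem_segment _ _ _)
        · exact IsPreconnected.union (a + ε • n) (right_mem_segment _ _ _) (left_mem_segment _ _ _)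
            (convex_segment _ _).isPreconnected (convex_segment _ _).isPreconnected
        · exact (convex_segment _ _).isPreconnected
      · exact Or.inl (Or.inl (left_mem_segment _ _ _))
      · exact Or.inr (left_mem_segment _ _ _)
      · rintro x ((hx | hx) | hx)
        · exact seg1 a ha hsa x hx
        · rw [segment_eq_image'] at hx
          obtain ⟨θ, hθ, rfl⟩ := hx
          have e : a + ε • n + θ • (b + ε • n - (a + ε • n)) = a + θ • (b - a) + ε • n := by
            rw [add_sub_add_right_eq_sub]; abel
          simp only [e]
          obtain ⟨m1, m2⟩ := hmid θ hθ
          constructor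
          · have := hstep _ m1 ε ⟨hε.le, le_rfl⟩
            linarith [mul_pos (lt_of_lt_of_le one_pos hM) (pow_pos hε 2)]
          · have : dist (a + θ • (b - a) + ε • n) (a + θ • (b - a)) ≤ ε := by
              rw [dist_eq_norm, add_sub_cancel_left]; exact hεn
            linarith [dist_triangle (a + θ • (b - a) + ε • n) (a + θ • (b - a)) q]
        · exact seg1 b hb hsb x hx
  · -- small gradient case
    obtain ⟨v, hv, hvv⟩ := h3 q hqR
    have hLε : L * ε ≤ ρ₀ := by linarith
    have hsegv : ∀ a, dist a q ≤ ε → ∃ w : ℂ, ‖w‖ = 1 ∧ ∀ τ ∈ Icc 0 (L * ε), ψ a + κ * τ ^ 2 ≤ ψ (a + τ • (w • v)) := by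
      intro a ha
      have : ∃ w : ℂ, ‖w‖ = 1 ∧ 0 ≤ D a (w • v) := by
        rcases le_total 0 (D a v) with h | h
        · exact ⟨1, by simp, by simpa using h⟩
        · exact ⟨-1, by simp, by simpa using h⟩
      obtain ⟨w, hw, hw0⟩ := this
      refine ⟨w, hw, fun τ hτ => ?_⟩
      have hnτ : ‖τ • w‖ = τ := by rw [norm_smul, hw, mul_one, Real.norm_of_nonneg hτ.1]
      have := hvv a (by linarith) (τ • w) (by rw [hnτ]; linarith [hτ.2])
      rw [hnτ, smul_assoc, map_smul, smul_eq_mul] at this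
      have : 0 ≤ τ * D a (w • v) := mul_nonneg hτ.1 hw0
      linarith
    constructor
    · obtain ⟨w, hw, hw'⟩ := hsegv q (by rw [dist_self]; exact hε.le)
      refine ⟨q + (ε / 2) • (w • v), ?_, ?_⟩
      · rw [dist_eq_norm, add_sub_cancel_left, norm_smul, norm_smul, hw, hv, Real.norm_of_nonneg (by positivity)]
        linarith
      · have := hw' (ε / 2) ⟨by positivity, by linarith [mul_le_mul_of_nonneg_right hL1 hε.le]⟩
        linarith
    · intro a b ha hb hsa hsb
      set T := (fun z : (ℂ × ℂ) × ℂ => z.1 + z.2 • v) '' (closedBall q ε ×ˢ sphere (0:ℂ) (L * ε)) with hT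
      have hTc : IsPreconnected T := by
        apply IsPreconnected.image _ _ (by fun_prop)
        apply IsPreconnected.prod (convex_closedBall _ _).isPreconnected
        apply isPreconnected_sphere
        rw [Complex.rank_real_complex]; norm_num
      have hTs : ∀ x ∈ T, s ≤ ψ x ∧ dist x q ≤ (L + 2) * ε := by
        rintro _ ⟨⟨c, x⟩, ⟨hc, hx⟩, rfl⟩
        simp only [mem_closedBall] at hc
        have hx' : ‖x‖ = L * ε := by simpa using hx
        have hnx : ‖x • v‖ = L * ε := by rw [norm_smul, hv, mul_one, hx']
        constructor
        · have t1 := hvv c (by linarith) x (by rw [hx']; exact hLε)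
          have t2 := h1 q hqR c (hball c (by linarith))
          have t3 : |D q (c - q)| ≤ K * ε * ε := by
            have := (D q).le_opNorm (c - q)
            rw [Real.norm_eq_abs] at this
            refine this.trans ?_
            rw [← dist_eq_norm]; gcongr
          have t4 : |D q (x • v)| ≤ K * ε * (L * ε) := by
            have := (D q).le_opNorm (x • v)
            rw [Real.norm_eq_abs, hnx] at this
            refine this.trans ?_
            gcongr
          have t5 := hDv c hc (x • v)
          rw [hnx] at t5
          have t6 : ‖c - q‖ ^ 2 ≤ ε ^ 2 := by rw [← dist_eq_norm]; gcongr
          have t6' := mul_le_mul_of_nonneg_left t6 (by linarith : (0:ℝ) ≤ M)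
          rw [hx'] at t1
          have t7 : (2 * (K + M) + 1) * L * ε ^ 2 ≤ κ * (L * ε) ^ 2 := by
            have := mul_le_mul_of_nonneg_right hκL (by positivity : 0 ≤ L * ε ^ 2)
            linarith
          have t8 : (K + M + 1) * ε ^ 2 ≤ (K + M + 1) * L * ε ^ 2 := by
            have : (K + M + 1) * 1 ≤ (K + M + 1) * L := by gcongr
            have := mul_le_mul_of_nonneg_right this (sq_nonneg ε)
            linarith
          have := (abs_le.1 t3).1
          have := (abs_le.1 t4).1
          have := (abs_le.1 t5).1
          show s ≤ ψ (c + x • v)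
          linarith
        · have : dist (c + x • v) c = L * ε := by rw [dist_eq_norm, add_sub_cancel_left, hnx]
          show dist (c + x • v) q ≤ _
          linarith [dist_triangle (c + x • v) c q]
      have hseg : ∀ c, dist c q ≤ ε → s ≤ ψ c → ∃ e ∈ T, ∀ x ∈ segment ℝ c e, s ≤ ψ x ∧ dist x q ≤ (L + 2) * ε := by
        intro c hc hsc
        obtain ⟨w, hw, hw'⟩ := hsegv c hc
        refine ⟨c + (L * ε) • (w • v), ⟨(c, (L * ε) • w), ⟨hc, ?_⟩, ?_⟩, ?_⟩
        · simp [hw, abs_of_pos (by positivity : 0 < L), abs_of_pos hε]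
        · simp only [smul_assoc]
        · intro x hx
          rw [segment_eq_image'] at hx
          obtain ⟨θ, hθ, rfl⟩ := hx
          simp only [add_sub_cancel_left]
          rw [← smul_assoc θ, smul_eq_mul]
          have hτ : θ * (L * ε) ∈ Icc 0 (L * ε) := ⟨mul_nonneg hθ.1 (by positivity), by
            have : 0 ≤ L * ε := by positivity
            exact mul_le_of_le_one_left this hθ.2⟩
          constructor
          · have := hw' _ hτ
            have : 0 ≤ κ * (θ * (L * ε)) ^ 2 := by positivity
            linarith
          · have : dist (c + (θ * (L * ε)) • (w • v)) c ≤ L * ε := by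
              rw [dist_eq_norm, add_sub_cancel_left, norm_smul, norm_smul, hw, hv, Real.norm_of_nonneg hτ.1]
              linarith [hτ.2]
            linarith [dist_triangle (c + (θ * (L * ε)) • (w • v)) c q]
      obtain ⟨ea, hea, hsa'⟩ := hseg a ha hsa
      obtain ⟨eb, heb, hsb'⟩ := hseg b hb hsb
      refine ⟨segment ℝ a ea ∪ T ∪ segment ℝ b eb, ?_, ?_, ?_, ?_⟩
      · apply IsPreconnected.union eb (Or.inr heb) (right_mem_segment _ _ _)
        · exact IsPreconnected.union ea (right_mem_segment _ _ _) hea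
            (convex_segment _ _).isPreconnected hTc
        · exact (convex_segment _ _).isPreconnected
      · exact Or.inl (Or.inl (left_mem_segment _ _ _))
      · exact Or.inr (left_mem_segment _ _ _)
      · rintro x ((hx | hx) | hx)
        · exact hsa' x hx
        · exact hTs x hx
        · exact hsb' x hx

theorem exp_locInj : IsLocallyInjective Complex.exp := by
  intro x
  refine ⟨ball x 1, isOpen_ball, mem_ball_self one_pos, ?_⟩
  intro y hy z hz h
  rw [Complex.exp_eq_exp_iff_exists_int] at h
  obtain ⟨n, hn⟩ := h
  have hd : ‖y - z‖ < 2 := by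
    rw [← dist_eq_norm]
    linarith [dist_triangle_right y z x, mem_ball.1 hy, mem_ball.1 hz]
  have e : y - z = n * (2 * Real.pi * Complex.I) := by rw [hn]; ring
  rw [e] at hd
  simp at hd
  have hn0 : n = 0 := by
    by_contra h0
    have : (1:ℝ) ≤ |(n:ℝ)| := by exact_mod_cast Int.one_le_abs h0
    rw [abs_of_pos Real.pi_pos] at hd
    nlinarith [Real.pi_gt_three]
  rw [hn, hn0]; simp

theorem exp_const {α : Type*} [TopologicalSpace α] {S : Set α} (hS : IsPreconnected S) {G : α → ℂ}
    (hG : ContinuousOn G S) {c : ℂ} (hc : ∀ x ∈ S, Complex.exp (G x) = c) {a b : α} (ha : a ∈ S) (hb : b ∈ S) :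
    G a = G b :=
  (T2Space.isSeparatedMap Complex.exp).constOn_of_comp exp_locInj hS hG
    (fun x hx y hy => by rw [hc x hx, hc y hy]) ha hb

theorem log_mul_re_pos {x y : ℂ} (hx : 0 < x.re) (hy : 0 < y.re) :
    Complex.log (x * y) = Complex.log x + Complex.log y := by
  have hx0 : x ≠ 0 := fun h => by simp [h] at hx
  have hy0 : y ≠ 0 := fun h => by simp [h] at hy
  rw [Complex.log_mul_eq_add_log_iff hx0 hy0]
  have h1 := abs_lt.1 (Complex.abs_arg_lt_pi_div_two_iff.2 (Or.inl hx))
  have h2 := abs_lt.1 (Complex.abs_arg_lt_pi_div_two_iff.2 (Or.inl hy))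
  constructor <;> linarith [h1.1, h1.2, h2.1, h2.2]

theorem extend_step {ψ : ℂ × ℂ → ℝ} (hψ : Continuous ψ) {F : ℂ × ℂ → ℂ}
    (hF : ContinuousOn F {q | 0 ≤ ψ q}) (hF0 : ∀ q, 0 ≤ ψ q → F q ≠ 0) {R ε C η s s' : ℝ}
    (hε : 0 < ε) (hC : 2 ≤ C)
    (hrat : ∀ q x y, ‖q‖ ≤ R → 0 ≤ ψ x → 0 ≤ ψ y → dist x q ≤ C * ε → dist y q ≤ C * ε → 0 < (F y / F x).re)
    (hbig : ∀ q, ψ q ≤ s → ‖q‖ ≤ R)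
    (hloc : ∀ q, ‖q‖ ≤ R → s - η ≤ ψ q →
      (∃ p, dist p q ≤ ε / 2 ∧ s ≤ ψ p) ∧
      ∀ a b, dist a q ≤ ε → dist b q ≤ ε → s ≤ ψ a → s ≤ ψ b →
        ∃ S, IsPreconnected S ∧ a ∈ S ∧ b ∈ S ∧ ∀ x ∈ S, s ≤ ψ x ∧ dist x q ≤ C * ε)
    (hs' : 0 ≤ s') (hss : s' ≤ s) (hsη : s - η ≤ s')
    {Λ : ℂ × ℂ → ℂ} (hΛ : ContinuousOn Λ {q | s ≤ ψ q}) (hΛF : ∀ q, s ≤ ψ q → Complex.exp (Λ q) = F q) :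
    ∃ Λ' : ℂ × ℂ → ℂ, ContinuousOn Λ' {q | s' ≤ ψ q} ∧ ∀ q, s' ≤ ψ q → Complex.exp (Λ' q) = F q := by
  have hs0 : 0 ≤ s := hs'.trans hss
  have claim : ∀ q, ‖q‖ ≤ R → s - η ≤ ψ q → ∀ a b, dist a q ≤ ε → dist b q ≤ ε → s ≤ ψ a → s ≤ ψ b →
      Λ b = Λ a + Complex.log (F b / F a) := by
    intro q hq hqs a b ha hb hsa hsb
    obtain ⟨S, hS, haS, hbS, hSx⟩ := (hloc q hq hqs).2 a b ha hb hsa hsb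
    have hre : ∀ x ∈ S, 0 < (F x / F a).re := fun x hx =>
      hrat q a x hq (hs0.trans hsa) (hs0.trans (hSx x hx).1) (hSx a haS).2 (hSx x hx).2
    have hFS : ContinuousOn F S := hF.mono fun x hx => hs0.trans (hSx x hx).1
    have hc : ContinuousOn (fun x => Λ x - Complex.log (F x / F a)) S := by
      refine (hΛ.mono fun x hx => (hSx x hx).1).sub ?_
      refine (hFS.div_const _).clog fun x hx => Or.inl (hre x hx)
    have := exp_const hS hc (c := F a) (fun x hx => ?_) haS hbS
    · simp only [div_self (hF0 a (hs0.trans hsa)), Complex.log_one, sub_zero] at this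
      rw [this]; ring
    · have hx0 := hF0 x (hs0.trans (hSx x hx).1)
      have ha0 := hF0 a (hs0.trans hsa)
      rw [Complex.exp_sub, hΛF x (hSx x hx).1, Complex.exp_log (div_ne_zero hx0 ha0)]
      field_simp
  have hp : ∀ q, ∃ p, s' ≤ ψ q → dist p q ≤ ε / 2 ∧ s ≤ ψ p ∧ (s ≤ ψ q → p = q) := by
    intro q
    by_cases h1 : s ≤ ψ q
    · exact ⟨q, fun _ => ⟨by rw [dist_self]; positivity, h1, fun _ => rfl⟩⟩
    · by_cases h2 : s' ≤ ψ q
      · obtain ⟨p, hp1, hp2⟩ := (hloc q (hbig q (by linarith)) (by linarith)).1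
        exact ⟨p, fun _ => ⟨hp1, hp2, fun h => absurd h h1⟩⟩
      · exact ⟨q, fun h => absurd h h2⟩
  choose p hp using hp
  refine ⟨fun q => Λ (p q) + Complex.log (F q / F (p q)), ?_, ?_⟩
  · intro q₀ hq₀
    change s' ≤ ψ q₀ at hq₀
    rcases le_or_gt (ψ q₀) s with hle | hgt
    · have hqR := hbig q₀ hle
      obtain ⟨p1, p2, p3⟩ := hp q₀ hq₀
      have hC1 : ε ≤ C * ε := by nlinarith
      have heq : ∀ q ∈ {q | s' ≤ ψ q}, dist q q₀ < ε / 2 →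
          Λ (p q) + Complex.log (F q / F (p q)) = Λ (p q₀) + Complex.log (F q / F (p q₀)) := by
        intro q hq hd
        change s' ≤ ψ q at hq
        obtain ⟨q1, q2, q3⟩ := hp q hq
        have d1 : dist (p q) q₀ ≤ ε := by linarith [dist_triangle (p q) q q₀]
        have d2 : dist (p q₀) q₀ ≤ ε := by linarith
        rw [claim q₀ hqR (by linarith) (p q₀) (p q) d2 d1 p2 q2, add_assoc,
          ← log_mul_re_pos]
        · have := hF0 _ (hs0.trans q2)
          congr 2
          field_simp
        · exact hrat q₀ _ _ hqR (hs0.trans p2) (hs0.trans q2) (by linarith) (by linarith)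
        · exact hrat q₀ _ _ hqR (hs0.trans q2) (hs'.trans hq) (by linarith) (by linarith)
      have hcont : ContinuousWithinAt (fun q => Λ (p q₀) + Complex.log (F q / F (p q₀))) {q | s' ≤ ψ q} q₀ := by
        have hFw : ContinuousWithinAt F {q | s' ≤ ψ q} q₀ :=
          (hF q₀ (hs'.trans hq₀)).mono fun q hq => hs'.trans hq
        refine continuousWithinAt_const.add ((hFw.div_const _).clog ?_)
        left
        exact hrat q₀ _ _ hqR (hs0.trans p2) (hs'.trans hq₀) (by linarith) (by rw [dist_self]; positivity)
      refine hcont.congr_of_eventuallyEq ?_ (heq q₀ hq₀ (by rw [dist_self]; positivity))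
      filter_upwards [self_mem_nhdsWithin, mem_nhdsWithin_of_mem_nhds (ball_mem_nhds q₀ (half_pos hε))] with q h1 h2
      exact heq q h1 h2
    · have hopen : {q | s < ψ q} ∈ nhds q₀ := (isOpen_lt continuous_const hψ).mem_nhds hgt
      have hc : ContinuousAt Λ q₀ := (hΛ q₀ hgt.le).continuousAt
        (Filter.mem_of_superset hopen fun q (hq : s < ψ q) => hq.le)
      have heq : ∀ q, s < ψ q → Λ (p q) + Complex.log (F q / F (p q)) = Λ q := by
        intro q hq
        rw [(hp q (hss.trans hq.le)).2.2 hq.le, div_self (hF0 q (hs0.trans hq.le))]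
        simp
      refine (hc.congr ?_).continuousWithinAt
      filter_upwards [hopen] with q hq
      exact (heq q hq).symm
  · intro q hq
    obtain ⟨q1, q2, q3⟩ := hp q hq
    have h1 := hF0 _ (hs0.trans q2)
    have h2 := hF0 q (hs'.trans hq)
    rw [Complex.exp_add, hΛF _ q2, Complex.exp_log (div_ne_zero h2 h1)]
    field_simp

theorem core {ψ : ℂ × ℂ → ℝ} (hψ : ContDiff ℝ 2 ψ) {κ : ℝ} (hκ : 0 < κ)
    (hlevi : ∀ q v : ℂ × ℂ, 4 * κ * (‖v.1‖ ^ 2 + ‖v.2‖ ^ 2) ≤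
      DD ψ q v v + DD ψ q (Complex.I • v) (Complex.I • v))
    (hprop : ∀ s, ∃ R, ∀ q, ψ q ≤ s → ‖q‖ ≤ R) {F : ℂ × ℂ → ℂ}
    (hF : ContinuousOn F {q | 0 ≤ ψ q}) (hF0 : ∀ q, 0 ≤ ψ q → F q ≠ 0) {R₁ : ℝ}
    (hR₁ : ∀ q, R₁ ≤ ‖q‖ → 0 ≤ ψ q → 0 < (F q).re) :
    ∃ Λ : ℂ × ℂ → ℂ, ContinuousOn Λ {q | 0 ≤ ψ q} ∧ ∀ q, 0 ≤ ψ q → Complex.exp (Λ q) = F q := by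
  have hψc := hψ.continuous
  obtain ⟨s₁, hs₁⟩ := (isCompact_closedBall (0 : ℂ × ℂ) R₁).exists_bound_of_continuousOn hψc.continuousOn
  set sm := max s₁ 0 + 1 with hsm
  have hsm0 : 0 ≤ sm := by have := le_max_right s₁ 0; linarith
  have hsmb : ∀ q, sm ≤ ψ q → R₁ ≤ ‖q‖ := by
    intro q hq
    by_contra h
    have := hs₁ q (by simpa using (not_le.1 h).le)
    have := le_max_left s₁ 0
    linarith [Real.le_norm_self (ψ q)]
  obtain ⟨R, hR⟩ := hprop sm
  obtain ⟨M, ρ₀, hM, hρ₀, h1, h2, h3⟩ := analytic_facts hψ hκ hlevi (R + 1)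
  obtain ⟨C, ε₀, hC, hε₀, hloc⟩ := local_conn (half_pos hκ) hM hρ₀ h1 h2 h3
  -- uniform continuity of `F`
  set X := {q | 0 ≤ ψ q} ∩ closedBall (0 : ℂ × ℂ) (R + 1) with hX
  have hXc : IsCompact X := (isCompact_closedBall _ _).inter_left (isClosed_le continuous_const hψc)
  have hFX : ContinuousOn F X := hF.mono inter_subset_left
  obtain ⟨mI, hmI⟩ := hXc.exists_bound_of_continuousOn (hFX.inv₀ fun q hq => hF0 q hq.1)
  have hFu := hXc.uniformContinuousOn_of_continuous hFX
  rw [Metric.uniformContinuousOn_iff] at hFu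
  obtain ⟨δ, hδ, hδ'⟩ := hFu (1 / (2 * (|mI| + 1))) (by positivity)
  set ε := min ε₀ (min (δ / (4 * C)) (1 / C)) with hε
  have hCpos : 0 < C := by linarith
  have hεpos : 0 < ε := by positivity
  have hCε : C * ε ≤ δ / 4 := by
    have : ε ≤ δ / (4 * C) := (min_le_right _ _).trans (min_le_left _ _)
    calc C * ε ≤ C * (δ / (4 * C)) := by gcongr
      _ = δ / 4 := by field_simp
  have hCε1 : C * ε ≤ 1 := by
    have : ε ≤ 1 / C := (min_le_right _ _).trans (min_le_right _ _)
    calc C * ε ≤ C * (1 / C) := by gcongr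
      _ = 1 := by field_simp
  obtain ⟨η, hη, hlocη⟩ := hloc ε hεpos (min_le_left _ _)
  have hrat : ∀ q x y, ‖q‖ ≤ R → 0 ≤ ψ x → 0 ≤ ψ y → dist x q ≤ C * ε → dist y q ≤ C * ε → 0 < (F y / F x).re := by
    intro q x y hq hx hy hxq hyq
    have hmem : ∀ z, 0 ≤ ψ z → dist z q ≤ C * ε → z ∈ X := by
      intro z hz hzq
      refine ⟨hz, ?_⟩
      rw [mem_closedBall, dist_zero_right]
      have := norm_le_norm_add_norm_sub q z
      rw [← dist_eq_norm, dist_comm] at this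
      linarith
    have hd := hδ' y (hmem y hy hyq) x (hmem x hx hxq) (by linarith [dist_triangle_right y x q])
    have hx0 := hF0 x hx
    have hi : ‖(F x)⁻¹‖ ≤ mI := hmI x (hmem x hx hxq)
    have e : F y / F x = 1 + (F y - F x) * (F x)⁻¹ := by field_simp; ring
    have hb : ‖(F y - F x) * (F x)⁻¹‖ ≤ 1 / 2 := by
      rw [norm_mul, ← dist_eq_norm]
      calc dist (F y) (F x) * ‖(F x)⁻¹‖ ≤ 1 / (2 * (|mI| + 1)) * (|mI| + 1) := by
            gcongr
            linarith [le_abs_self mI]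
        _ = 1 / 2 := by field_simp
    rw [e, Complex.add_re, Complex.one_re]
    linarith [(abs_le.1 ((Complex.abs_re_le_norm _).trans hb)).1]
  have ind : ∀ k : ℕ, ∃ Λ : ℂ × ℂ → ℂ, ContinuousOn Λ {q | max 0 (sm - k * η) ≤ ψ q} ∧
      ∀ q, max 0 (sm - k * η) ≤ ψ q → Complex.exp (Λ q) = F q := by
    intro k
    induction k with
    | zero =>
      have e : max 0 (sm - (0:ℕ) * η) = sm := by simp [hsm0]
      rw [e]
      have hre : ∀ q, sm ≤ ψ q → 0 < (F q).re := fun q hq => hR₁ q (hsmb q hq) (hsm0.trans hq)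
      refine ⟨fun q => Complex.log (F q), ?_, fun q hq => Complex.exp_log (hF0 q (hsm0.trans hq))⟩
      exact (hF.mono fun q hq => hsm0.trans hq).clog fun q hq => Or.inl (hre q hq)
    | succ k ih =>
      obtain ⟨Λ, hΛ, hΛF⟩ := ih
      have hle : max 0 (sm - k * η) ≤ sm := max_le hsm0 (by have : 0 ≤ k * η := by positivity
                                                            linarith)
      refine extend_step hψc hF hF0 hεpos hC hrat (fun q hq => hR q (hq.trans hle))
        (fun q hq hs => hlocη _ q (by linarith) hs) (le_max_left _ _) ?_ ?_ hΛ hΛF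
      · apply max_le_max le_rfl
        push_cast; linarith
      · push_cast
        rcases le_total 0 (sm - k * η) with h | h
        · rw [max_eq_right h]
          refine le_trans ?_ (le_max_right _ _)
          linarith
        · rw [max_eq_left h]
          refine le_trans ?_ (le_max_left _ _)
          linarith
  obtain ⟨k, hk⟩ := exists_nat_gt (sm / η)
  rw [div_lt_iff₀ hη] at hk
  have := ind k
  rwa [max_eq_left (by linarith)] at this

/-- plurisubharmonic functions on `ℂ²` -/
def PSH2 (Φ : ℂ × ℂ → EReal) : Prop :=
  UpperSemicontinuous Φ ∧ (∀ p, Φ p ≠ ⊤) ∧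
    ∀ a b : ℂ × ℂ, SubharmonicOn (fun t : ℂ => Φ (a + t • b)) univ

theorem avg_line_normSq (a b : ℂ) :
    Real.circleAverage (fun t : ℂ => ‖a + t * b‖ ^ 2) 0 1 = ‖a‖ ^ 2 + ‖b‖ ^ 2 := by
  by_cases hb : b = 0
  · simp [hb, Real.circleAverage_const]
  have h := avg_normSq 0 (-(a / b)) 1 one_pos
  have e : (fun t : ℂ => ‖a + t * b‖ ^ 2) = fun t => ‖b‖ ^ 2 • ‖t - -(a / b)‖ ^ 2 := by
    funext t
    rw [smul_eq_mul, ← mul_pow, ← norm_mul]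
    congr 2
    field_simp
    ring
  rw [e, Real.circleAverage_fun_smul, h]
  have hb' : ‖b‖ ≠ 0 := norm_ne_zero_iff.2 hb
  simp
  field_simp

theorem H_submean {Φ : ℂ × ℂ → EReal} (hΦ : PSH2 Φ) {A : ℂ × ℂ → ℂ} (hA : Continuous A)
    (hAp : ∀ p v : ℂ × ℂ, ∃ P : ℂ[X], ∀ t : ℂ, A (p + t • v) = P.eval t) {δ ε N : ℝ} (hε : 0 < ε) 
    {H : ℂ × ℂ → ℝ} (hH : UpperSemicontinuous H)
    (hHd : ∀ p, H p = max ((A p).re - δ + ε * trunc Φ N p) (-1)) (p v : ℂ × ℂ) :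
    H p ≤ Real.circleAverage (fun t : ℂ => H (p + t • v)) 0 1 := by
  have hl : Continuous (fun t : ℂ => p + t • v) := by fun_prop
  refine le_avg_of_cont_majorants (H := fun t : ℂ => H (p + t • v)) one_pos ((hH.comp hl).upperSemicontinuousOn _) (N := 1) 
    (fun z => by simp only [hHd]; exact le_max_right _ _) ?_
  intro k hk hle
  rw [hHd]
  have hki : CircleIntegrable k 0 1 := by
    apply ContinuousOn.circleIntegrable'; rwa [abs_one]
  apply max_le
  · obtain ⟨P, hP⟩ := hAp p v
    have hPc : Continuous (fun t : ℂ => (P.eval t).re) := Complex.continuous_re.comp P.continuous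
    have h := trunc_sub_mean_cont (hΦ.2.2 p v) (fun z => hΦ.2.1 _) N 0 1 one_pos
      (fun t => ε⁻¹ • ((k t - (P.eval t).re) + δ)) 
      (by
        have := hPc.continuousOn (s := sphere (0:ℂ) 1)
        fun_prop) (by
        intro t ht
        have h1 := hle t ht
        simp only [hHd] at h1
        have h2 := (le_max_left _ _).trans h1
        rw [hP] at h2
        rw [smul_eq_mul, inv_mul_eq_div, le_div_iff₀ hε]
        have : trunc (fun t : ℂ => Φ (p + t • v)) N t = trunc Φ N (p + t • v) := rfl
        rw [this]; linarith)
    have e1 : trunc (fun t : ℂ => Φ (p + t • v)) N 0 = trunc Φ N p := by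
      simp [trunc]
    have hpi : CircleIntegrable (fun t : ℂ => (P.eval t).re) 0 1 := 
      ContinuousOn.circleIntegrable' hPc.continuousOn
    rw [e1, Real.circleAverage_fun_smul, Real.circleAverage_fun_add (f₁ := fun t : ℂ => k t - (P.eval t).re) (hki.sub hpi) (circleIntegrable_const _ _ _),
      Real.circleAverage_fun_sub hki hpi, poly_re_circleAverage, Real.circleAverage_const,
      smul_eq_mul, inv_mul_eq_div, le_div_iff₀ hε] at h
    have e2 : A p = P.eval 0 := by rw [← hP 0]; simp
    rw [e2]; linarith
  · rw [← Real.circleAverage_const (-1 : ℝ) 0 1]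
    apply Real.circleAverage_mono (circleIntegrable_const _ _ _) hki
    intro z hz
    rw [abs_one] at hz
    refine le_trans ?_ (hle z hz)
    simp only [hHd]; exact le_max_right _ _

theorem exists_psi {Φ : ℂ × ℂ → EReal} (hΦ : PSH2 Φ) {A : ℂ × ℂ → ℂ} (hA : Continuous A)
    (hAp : ∀ p v : ℂ × ℂ, ∃ P : ℂ[X], ∀ t : ℂ, A (p + t • v) = P.eval t)
    {S Cir : Set (ℂ × ℂ)} (hSc : IsCompact S) {δ M0 : ℝ} (hδ : 0 < δ) (hδ1 : δ ≤ 1)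
    (hS : ∀ p ∈ S, Φ p = ⊥ ∨ (A p).re ≤ 0)
    (hC : ∀ p ∈ Cir, 2 * δ ≤ (A p).re ∧ ((-M0 : ℝ) : EReal) ≤ Φ p) :
    ∃ (ψ : ℂ × ℂ → ℝ) (κ : ℝ), ContDiff ℝ 2 ψ ∧ 0 < κ ∧
      (∀ q v, 4 * κ * (‖v.1‖ ^ 2 + ‖v.2‖ ^ 2) ≤ DD ψ q v v + DD ψ q (Complex.I • v) (Complex.I • v)) ∧
      (∀ s, ∃ R, ∀ q, ψ q ≤ s → ‖q‖ ≤ R) ∧ (∀ p ∈ S, ψ p < 0) ∧ ∀ p ∈ Cir, 0 < ψ p := by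
  obtain ⟨C, hCb⟩ := usc_bdd hSc (hΦ.1.upperSemicontinuousOn S) hΦ.2.1
  obtain ⟨K, hK⟩ := hSc.bddAbove_image (f := fun p => (A p).re) (Complex.continuous_re.comp hA).continuousOn
  have hK' : ∀ p ∈ S, (A p).re ≤ K := fun p hp => hK (mem_image_of_mem _ hp)
  obtain ⟨Q, hQ⟩ := hSc.bddAbove_image (f := fun p : ℂ × ℂ => ‖p.1‖ ^ 2 + ‖p.2‖ ^ 2) (by fun_prop)
  have hQ' : ∀ p ∈ S, ‖p.1‖ ^ 2 + ‖p.2‖ ^ 2 ≤ Q := fun p hp => hQ (mem_image_of_mem _ hp)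
  set L : ℝ := |C| + |M0| + 1 with hL
  have hLpos : 0 < L := by positivity
  set ε : ℝ := δ / (4 * L) with hεd
  have hε : 0 < ε := by positivity
  have hεL : ε * L = δ / 4 := by rw [hεd]; field_simp
  set N : ℝ := (|K| + 1) / ε with hN
  have hN0 : 0 ≤ N := by positivity
  have hεN : ε * N = |K| + 1 := by rw [hN]; field_simp
  set H : ℂ × ℂ → ℝ := fun p => max ((A p).re - δ + ε * trunc Φ N p) (-1) with hHd
  have htr : UpperSemicontinuous (trunc Φ N) :=
    upperSemicontinuousOn_univ_iff.1 (trunc_usc N (hΦ.1.upperSemicontinuousOn _) hΦ.2.1)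
  have hH : UpperSemicontinuous H := by
    have h1 : UpperSemicontinuous (fun p => ε * trunc Φ N p) :=
      Continuous.comp_upperSemicontinuous (g := fun x : ℝ => ε * x) (by fun_prop) htr
        (fun x y h => by simp only; gcongr)
    have h2 : UpperSemicontinuous (fun p => ((A p).re - δ) + ε * trunc Φ N p) :=
      UpperSemicontinuous.add (Continuous.upperSemicontinuous (by fun_prop)) h1
    exact Continuous.comp_upperSemicontinuous (g := fun x : ℝ => max x (-1)) (by fun_prop) h2
        (fun x y h => max_le_max_right _ h)
  have hHS : ∀ p ∈ S, H p < -(δ / 2) := by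
    intro p hp
    apply max_lt _ (by linarith)
    have hC1 : |C| ≤ L := by rw [hL]; linarith [abs_nonneg M0]
    rcases hS p hp with h | h
    · rw [trunc_bot h]
      have := hK' p hp
      have := le_abs_self K
      have : ε * -N = - (|K| + 1) := by rw [← hεN]; ring
      linarith
    · have : trunc Φ N p ≤ L := trunc_le (hΦ.2.1 p) ((hCb p hp).trans (by
        exact_mod_cast (le_abs_self C).trans hC1)) (by linarith)
      have : ε * trunc Φ N p ≤ ε * L := by gcongr
      linarith
  obtain ⟨τ, hτ, hτS⟩ := hSc.exists_cthickening_subset_open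
    (t := H ⁻¹' Iio (-(δ / 2))) (hH.isOpen_preimage _) (fun p hp => hHS p hp)
  obtain ⟨Ψ, hΨ, hge, hle, hsub⟩ := smoothing hH (B := 1) (fun p => le_max_right _ _)
    (H_submean hΦ hA hAp hε hH (fun p => rfl)) τ hτ
  set κ : ℝ := δ / (4 * (|Q| + 1)) with hκd
  have hκ : 0 < κ := by positivity
  have hκQ : κ * (|Q| + 1) = δ / 4 := by rw [hκd]; field_simp
  have hψ : ContDiff ℝ 2 (fun q : ℂ × ℂ => Ψ q + κ * (‖q.1‖ ^ 2 + ‖q.2‖ ^ 2)) :=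
    hΨ.add (contDiff_const.mul ((contDiff_fst.norm_sq ℝ).add (contDiff_snd.norm_sq ℝ)))
  refine ⟨fun q => Ψ q + κ * (‖q.1‖ ^ 2 + ‖q.2‖ ^ 2), κ, hψ, hκ, levi hψ ?_, ?_, ?_, ?_⟩
  · intro p v
    have hc1 : Continuous (fun t : ℂ => Ψ (p + t • v)) := hΨ.continuous.comp (by fun_prop)
    have hc2 : Continuous (fun t : ℂ => ‖p.1 + t * v.1‖ ^ 2) := by fun_prop
    have hc3 : Continuous (fun t : ℂ => ‖p.2 + t * v.2‖ ^ 2) := by fun_prop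
    have e : (fun t : ℂ => Ψ (p + t • v) + κ * (‖(p + t • v).1‖ ^ 2 + ‖(p + t • v).2‖ ^ 2)) =
      fun t : ℂ => Ψ (p + t • v) + κ • (‖p.1 + t * v.1‖ ^ 2 + ‖p.2 + t * v.2‖ ^ 2) := by
      funext t; simp
    have ci : ∀ {f : ℂ → ℝ}, Continuous f → CircleIntegrable f 0 1 := fun h => 
      ContinuousOn.circleIntegrable' h.continuousOn
    have ck : Continuous (fun t : ℂ => κ • (‖p.1 + t * v.1‖ ^ 2 + ‖p.2 + t * v.2‖ ^ 2)) := by fun_prop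
    rw [e, Real.circleAverage_fun_add (ci hc1) (ci ck),
      Real.circleAverage_fun_smul, Real.circleAverage_fun_add (ci hc2) (ci hc3), avg_line_normSq, avg_line_normSq,
      smul_eq_mul]
    have := hsub p v
    linarith
  · intro s
    refine ⟨|s + 1| / κ + 1, ?_⟩
    intro q hq
    simp only at hq
    by_contra! h
    have h1 : -1 ≤ Ψ q := (le_max_right _ _).trans (hge q)
    have h0 : 0 ≤ |s + 1| / κ := by positivity
    have h2 : ‖q‖ ^ 2 ≤ ‖q.1‖ ^ 2 + ‖q.2‖ ^ 2 := by
      rw [Prod.norm_def]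
      rcases max_choice ‖q.1‖ ‖q.2‖ with h | h <;> rw [h] <;> nlinarith [sq_nonneg ‖q.1‖, sq_nonneg ‖q.2‖]
    have h3 : ‖q‖ ≤ ‖q‖ ^ 2 := by
      have : 1 ≤ ‖q‖ := by linarith
      rw [pow_two]; exact le_mul_of_one_le_left (by linarith) this
    have h4 : κ * (|s + 1| / κ + 1) < κ * (‖q.1‖ ^ 2 + ‖q.2‖ ^ 2) := by
      apply mul_lt_mul_of_pos_left _ hκ; linarith
    have h5 : κ * (|s + 1| / κ + 1) = |s + 1| + κ := by field_simp
    linarith [le_abs_self (s + 1)]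
  · intro p hp
    have h1 := hle p (-(δ / 2)) (fun q hq => 
      le_of_lt (hτS (mem_cthickening_of_dist_le q p τ S hp hq)))
    have h2 : κ * (‖p.1‖ ^ 2 + ‖p.2‖ ^ 2) ≤ κ * (|Q| + 1) := by
      apply mul_le_mul_of_nonneg_left _ hκ.le; linarith [hQ' p hp, le_abs_self Q]
    simp only
    linarith
  · intro p hp
    obtain ⟨h1, h2⟩ := hC p hp
    have h3 : -M0 ≤ trunc Φ N p := by exact_mod_cast h2.trans (le_trunc (hΦ.2.1 p))
    have h4 : -L ≤ trunc Φ N p := by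
      rw [hL]; linarith [neg_abs_le M0, abs_nonneg C, le_abs_self M0]
    have h5 : ε * -L ≤ ε * trunc Φ N p := by gcongr
    have h6 := hge p
    have h7 : (A p).re - δ + ε * trunc Φ N p ≤ H p := le_max_left _ _
    have h8 : 0 ≤ κ * (‖p.1‖ ^ 2 + ‖p.2‖ ^ 2) := by positivity
    simp only
    linarith

theorem psh2_bot {Φ : ℂ × ℂ → EReal} (hΦ : PSH2 Φ) {W : Set (ℂ × ℂ)} (hW : IsOpen W) {p : ℂ × ℂ}
    (hp : p ∈ W) (hb : ∀ q ∈ W, Φ q = ⊥) (q : ℂ × ℂ) : Φ q = ⊥ := by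
  have hc : Continuous (fun t : ℂ => p + t • (q - p)) := by fun_prop
  have ho := hW.preimage hc
  obtain ⟨ρ, hρ, hsub⟩ := Metric.isOpen_iff.1 ho 0 (by simpa using hp)
  have := subharmonic_bot_of_ball (hΦ.2.2 p (q - p)) (fun _ => hΦ.2.1 _) hρ
    (fun z hz => hb _ (hsub hz)) 1
  simpa using this

theorem winding {c α : ℂ} {r : ℝ} (hr : 0 < r) (hα : α ≠ 0) {G : ℂ → ℂ}
    (hG : ContinuousOn G (sphere c r)) (he : ∀ w ∈ sphere c r, Complex.exp (G w) = α * (w - c)) : False := by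
  have hc : ContinuousOn (fun θ : ℝ => G (circleMap c r θ) - θ * Complex.I) univ := by
    apply ContinuousOn.sub
    · exact hG.comp (continuous_circleMap c r).continuousOn (fun θ _ => circleMap_mem_sphere c hr.le θ)
    · fun_prop
  have h := exp_const isPreconnected_univ hc (c := α * r) (by
    intro θ _
    rw [Complex.exp_sub, he _ (circleMap_mem_sphere c hr.le θ), circleMap_sub_center, circleMap_zero]
    field_simp) (mem_univ (0:ℝ)) (mem_univ (2 * Real.pi))
  have e : circleMap c r (2 * Real.pi) = circleMap c r 0 := by
    have := periodic_circleMap c r 0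
    simpa using this
  simp only [e] at h
  have : (2 * Real.pi : ℂ) * Complex.I = 0 := by
    push_cast at h
    linear_combination h
  simp [Real.pi_ne_zero] at this

theorem exists_log {ψ : ℂ × ℂ → ℝ} (hψ : ContDiff ℝ 2 ψ) {κ : ℝ} (hκ : 0 < κ)
    (hlevi : ∀ q v, 4 * κ * (‖v.1‖ ^ 2 + ‖v.2‖ ^ 2) ≤ DD ψ q v v + DD ψ q (Complex.I • v) (Complex.I • v))
    (hprop : ∀ s, ∃ R, ∀ q, ψ q ≤ s → ‖q‖ ≤ R) {c₀ : ℂ} {R : ℝ} {k T : ℂ → ℂ} (hk : Continuous k)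
    (hT : Continuous T) (hk0 : ∀ z ∉ closedBall c₀ R, k z = 0)
    (h1 : ∀ z ∈ closedBall c₀ R, ψ (z, -T z) < 0) (h2 : ∀ z ∈ closedBall c₀ R, ψ (z, k z - T z) < 0) :
    ∃ Λ : ℂ × ℂ → ℂ, ContinuousOn Λ {q | 0 ≤ ψ q} ∧
      ∀ q, 0 ≤ ψ q → Complex.exp (Λ q) = 1 - k q.1 / (q.2 + T q.1) := by
  obtain ⟨Ck, hCk⟩ := (isCompact_closedBall c₀ R).bddAbove_image (f := fun z => ‖k z‖) (by fun_prop)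
  obtain ⟨CT, hCT⟩ := (isCompact_closedBall c₀ R).bddAbove_image (f := fun z => ‖T z‖) (by fun_prop)
  have hCk' : ∀ z ∈ closedBall c₀ R, ‖k z‖ ≤ Ck := fun p hp => hCk (mem_image_of_mem _ hp)
  have hCT' : ∀ z ∈ closedBall c₀ R, ‖T z‖ ≤ CT := fun p hp => hCT (mem_image_of_mem _ hp)
  refine core hψ hκ hlevi hprop (F := fun q => 1 - k q.1 / (q.2 + T q.1)) ?_ ?_ 
    (R₁ := ‖c₀‖ + |R| + |Ck| * 2 + |CT| + 1) ?_
  · intro q hq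
    apply ContinuousAt.continuousWithinAt
    by_cases hz : q.1 ∈ closedBall c₀ R
    · have hne : q.2 + T q.1 ≠ 0 := by
        intro h
        have e : q = (q.1, - T q.1) := by ext <;> simp; linear_combination h
        have := h1 _ hz
        rw [← e] at this
        exact absurd hq (not_le.2 this)
      have e1 : ContinuousAt (fun q : ℂ × ℂ => k q.1) q := by fun_prop
      have e2 : ContinuousAt (fun q : ℂ × ℂ => q.2 + T q.1) q := by fun_prop
      exact continuousAt_const.sub (e1.div e2 hne)
    · have hev : ∀ᶠ p : ℂ × ℂ in nhds q, p.1 ∉ closedBall c₀ R :=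
        continuousAt_fst.eventually (isClosed_closedBall.isOpen_compl.mem_nhds hz)
      apply (continuousAt_const (y := (1:ℂ))).congr
      filter_upwards [hev] with p hp
      simp [hk0 _ hp]
  · intro q hq h0
    have hz : q.1 ∈ closedBall c₀ R := by
      by_contra hz
      simp [hk0 _ hz] at h0
    have hne : q.2 + T q.1 ≠ 0 := by
      intro h
      simp [h] at h0
    have e : q = (q.1, k q.1 - T q.1) := by
      ext <;> simp
      rw [sub_eq_zero, eq_comm, div_eq_one_iff_eq hne] at h0
      linear_combination -h0
    have := h2 _ hz
    rw [← e] at this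
    linarith
  · intro q hq _
    by_cases hz : q.1 ∈ closedBall c₀ R
    · have a1 : ‖q.1‖ ≤ ‖c₀‖ + |R| := by
        have := mem_closedBall.1 hz
        rw [dist_eq_norm] at this
        have h3 := norm_sub_norm_le q.1 c₀
        linarith [le_abs_self R]
      have a2 : ‖c₀‖ + |R| + |Ck| * 2 + |CT| + 1 ≤ ‖q.2‖ := by
        rw [Prod.norm_def] at hq
        rcases le_max_iff.1 hq with h | h
        · linarith [abs_nonneg Ck, abs_nonneg CT]
        · exact h
      have a3 : |Ck| * 2 + 1 ≤ ‖q.2 + T q.1‖ := by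
        have h3 := norm_sub_le_norm_add q.2 (T q.1)
        linarith [hCT' _ hz, le_abs_self CT, norm_nonneg c₀, abs_nonneg R]
      have a4 : ‖k q.1 / (q.2 + T q.1)‖ < 1 := by
        rw [norm_div, div_lt_one (by linarith [abs_nonneg Ck])]
        linarith [hCk' _ hz, le_abs_self Ck, abs_nonneg Ck]
      have a5 := Complex.re_le_norm (k q.1 / (q.2 + T q.1))
      rw [Complex.sub_re, Complex.one_re]; linarith
    · simp [hk0 _ hz]

theorem key {Φ : ℂ × ℂ → EReal} (hΦ : PSH2 Φ) (hne : ∃ p, Φ p ≠ ⊥) {f : ℂ → ℂ} {c₀ : ℂ} {R : ℝ}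
    (hR : 0 < R) (hf : ContinuousOn f (closedBall c₀ R)) (hb : ∀ z ∈ closedBall c₀ R, Φ (z, f z) = ⊥)
    (a g : ℂ[X]) (ha : ∀ z ∈ closedBall c₀ R, a.eval z ≠ 0)
    (hs : ∀ z ∈ sphere c₀ R, (a.eval z * f z - g.eval z).re < 0) :
    ∀ z ∈ closedBall c₀ R, (a.eval z * f z - g.eval z).re ≤ 0 := by
  intro z₁ hz₁
  by_contra! hpos₁
  have hz₁b : z₁ ∈ ball c₀ R := by
    rw [mem_ball]
    apply lt_of_le_of_ne hz₁
    intro h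
    exact absurd (hs z₁ h) (not_lt.2 hpos₁.le)
  set h : ℂ → ℝ := fun z => (a.eval z * f z - g.eval z).re with hh
  have hac : Continuous (fun z => a.eval z) := a.continuous
  have hgc : Continuous (fun z => g.eval z) := g.continuous
  have hhc : ContinuousOn h (closedBall c₀ R) := 
    Complex.continuous_re.comp_continuousOn ((hac.continuousOn.mul hf).sub hgc.continuousOn)
  -- choice of a good fibre
  obtain ⟨z, hzb, hzpos, hzne⟩ : ∃ z ∈ ball c₀ R, 0 < h z ∧ ∃ w, Φ (z, w) ≠ ⊥ := by
    by_contra! hcon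
    obtain ⟨p, hp⟩ := hne
    apply hp
    have ho : IsOpen (ball c₀ R ∩ h ⁻¹' Ioi 0) :=
      (hhc.mono ball_subset_closedBall).isOpen_inter_preimage isOpen_ball isOpen_Ioi
    apply psh2_bot hΦ (W := (ball c₀ R ∩ h ⁻¹' Ioi 0) ×ˢ univ) (ho.prod isOpen_univ) (p := (z₁, 0))
    · exact ⟨⟨hz₁b, hpos₁⟩, mem_univ _⟩
    · rintro ⟨x, y⟩ ⟨⟨h1, h2⟩, -⟩
      exact hcon x h1 h2 y
  have hzc := ball_subset_closedBall hzb
  -- the circle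
  have hline := hΦ.2.2 (z, 0) (0, 1)
  have e0 : (fun t : ℂ => Φ ((z, 0) + t • (0, 1))) = fun t => Φ (z, t) := by
    funext t; simp
  rw [e0] at hline
  set r₁ : ℝ := h z / (2 * (‖a.eval z‖ + 1)) with hr₁
  have hr₁pos : 0 < r₁ := by positivity
  obtain ⟨r, hr, hrr, M0, hM0⟩ := circle_lemma hline (fun _ => hΦ.2.1 _) hzne (f z) r₁ hr₁pos
  have har : ‖a.eval z‖ * r ≤ h z / 2 := by
    have h1 : (‖a.eval z‖ + 1) * r₁ = h z / 2 := by rw [hr₁]; field_simp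
    have h2 : ‖a.eval z‖ * r ≤ (‖a.eval z‖ + 1) * r₁ := by
      apply mul_le_mul (by linarith) hrr.le hr.le (by positivity)
    linarith
  set A : ℂ × ℂ → ℂ := fun p => a.eval p.1 * p.2 - g.eval p.1 with hA
  have hAcirc : ∀ w ∈ sphere (f z) r, h z / 2 ≤ (A (z, w)).re := by
    intro w hw
    have e : A (z, w) = (a.eval z * f z - g.eval z) + a.eval z * (w - f z) := by
      simp only [hA]; ring
    have h1 : ‖a.eval z * (w - f z)‖ ≤ h z / 2 := by
      rw [norm_mul, ← dist_eq_norm, mem_sphere.1 hw]; exact har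
    have h2 := (abs_le.1 (Complex.abs_re_le_norm (a.eval z * (w - f z)))).1
    rw [e, Complex.add_re]
    have : h z = (a.eval z * f z - g.eval z).re := rfl
    linarith
  -- functions T, k
  obtain ⟨T, hT⟩ := ContinuousMap.exists_restrict_eq (isClosed_closedBall (x := c₀) (ε := R))
    ⟨_, ((continuousOn_const.sub hgc.continuousOn).div hac.continuousOn ha : 
      ContinuousOn (fun z => (1 - g.eval z) / a.eval z) (closedBall c₀ R)).domRestrict⟩
  have hTe : ∀ x ∈ closedBall c₀ R, T x = (1 - g.eval x) / a.eval x := by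
    intro x hx
    have := DFunLike.congr_fun hT ⟨x, hx⟩
    simpa using this
  have haT : ∀ x ∈ closedBall c₀ R, a.eval x * T x = 1 - g.eval x := by
    intro x hx; rw [hTe x hx]; field_simp [ha x hx]
  obtain ⟨xm, hxm, hmax⟩ := (isCompact_sphere c₀ R).exists_isMaxOn (NormedSpace.sphere_nonempty.2 hR.le)
    (hhc.mono sphere_subset_closedBall)
  set δ : ℝ := - h xm with hδd
  have hδ : 0 < δ := by have := hs xm hxm; simp only [hδd, hh]; linarith
  have hδs : ∀ x ∈ sphere c₀ R, δ ≤ - h x := fun x hx => neg_le_neg (hmax hx)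
  set θ : ℂ → ℝ := fun x => max 0 (min 1 (- h x / δ)) with hθ
  have hθc : ContinuousOn θ (closedBall c₀ R) := by
    simp only [hθ]
    fun_prop
  have hθs : ∀ x ∈ sphere c₀ R, θ x = 1 := by
    intro x hx
    have : 1 ≤ - h x / δ := by rw [le_div_iff₀ hδ]; linarith [hδs x hx]
    simp [hθ, min_eq_left this]
  have hθ01 : ∀ x, 0 ≤ θ x ∧ θ x ≤ 1 := fun x => 
    ⟨le_max_left _ _, max_le zero_le_one (min_le_left _ _)⟩
  have hθ0 : ∀ x, 0 ≤ h x → θ x = 0 := by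
    intro x hx
    have : - h x / δ ≤ 0 := div_nonpos_of_nonpos_of_nonneg (by linarith) hδ.le
    simp only [hθ]
    exact max_eq_left ((min_le_right _ _).trans this)
  set k : ℂ → ℂ := (closedBall c₀ R).indicator (fun x => (1 - θ x) * (f x + T x)) with hk
  have hkc : Continuous k := by
    apply continuous_indicator
    · intro x hx
      rw [frontier_closedBall _ hR.ne'] at hx
      simp [hθs x hx]
    · rw [isClosed_closedBall.closure_eq]
      have := T.continuous.continuousOn (s := closedBall c₀ R)
      have h3 : ContinuousOn (fun x => (θ x : ℂ)) (closedBall c₀ R) := Complex.continuous_ofReal.comp_continuousOn hθc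
      exact (continuousOn_const.sub h3).mul (hf.add this)
  have hke : ∀ x ∈ closedBall c₀ R, k x = (1 - θ x) * (f x + T x) := fun x hx => indicator_of_mem hx _
  -- the function ψ
  obtain ⟨ψ, κ, hψ, hκ, hlevi, hprop, hneg, hpos⟩ := exists_psi hΦ (A := A) (by simp only [hA]; fun_prop) 
    (S := (fun x => (x, - T x)) '' closedBall c₀ R ∪ (fun x => (x, k x - T x)) '' closedBall c₀ R)
    (Cir := (fun w => (z, w)) '' sphere (f z) r) (δ := min (h z / 4) 1) (M0 := M0)
    (by
      intro p v
      refine ⟨a.comp (C p.1 + X * C v.1) * (C p.2 + X * C v.2) - g.comp (C p.1 + X * C v.1), ?_⟩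
      intro t; simp [hA, mul_comm t])
    (by
      apply IsCompact.union
      · exact (isCompact_closedBall _ _).image (by fun_prop)
      · exact (isCompact_closedBall _ _).image (by fun_prop))
    (lt_min (by linarith) one_pos) (min_le_right _ _)
    (by
      rintro p (⟨x, hx, rfl⟩ | ⟨x, hx, rfl⟩)
      · right
        have : A (x, - T x) = -1 := by simp only [hA]; linear_combination - haT x hx
        rw [this]; simp
      · by_cases hθx : 0 ≤ h x
        · left
          have : k x - T x = f x := by rw [hke x hx, hθ0 x hθx]; simp
          simp only [this]; exact hb x hx
        · right
          have e1 : A (x, k x - T x) = (1 - θ x : ℝ) * (a.eval x * f x - g.eval x) - θ x := by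
            simp only [hA]; rw [hke x hx]; push_cast
            linear_combination (- (θ x : ℂ)) * haT x hx
          rw [e1, Complex.sub_re, Complex.re_ofReal_mul, Complex.ofReal_re]
          have h1 := (hθ01 x).1
          have h2 := (hθ01 x).2
          have h3 : (1 - θ x) * (a.eval x * f x - g.eval x).re ≤ 0 :=
            mul_nonpos_of_nonneg_of_nonpos (by linarith) (not_le.1 hθx).le
          linarith)
    (by
      rintro p ⟨w, hw, rfl⟩
      refine ⟨?_, hM0 w hw⟩
      have := hAcirc w hw
      linarith [min_le_left (h z / 4) 1])
  obtain ⟨Λ, hΛ, hexp⟩ := exists_log hψ hκ hlevi hprop (c₀ := c₀) (R := R) hkc T.continuous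
    (fun x hx => indicator_of_notMem hx _) (fun x hx => hneg _ (Or.inl ⟨x, hx, rfl⟩))
    (fun x hx => hneg _ (Or.inr ⟨x, hx, rfl⟩))
  -- the contradiction
  have hre : ∀ w ∈ sphere (f z) r, 0 < (a.eval z * (w + T z)).re := by
    intro w hw
    have e : a.eval z * (w + T z) = A (z, w) + 1 := by simp only [hA]; linear_combination haT z hzc
    rw [e, Complex.add_re, Complex.one_re]
    linarith [hAcirc w hw]
  apply winding (c := f z) (α := a.eval z) hr (ha z hzc) 
    (G := fun w => Λ (z, w) + Complex.log (a.eval z * (w + T z)))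
  · apply ContinuousOn.add
    · refine hΛ.comp (by fun_prop) ?_
      intro w hw
      exact (hpos _ ⟨w, hw, rfl⟩).le
    · apply ContinuousOn.clog (by fun_prop)
      intro w hw
      exact Or.inl (hre w hw)
  · intro w hw
    have hnz : a.eval z * (w + T z) ≠ 0 := by
      intro h0; have := hre w hw; rw [h0] at this; simp at this
    have hnz2 : w + T z ≠ 0 := right_ne_zero_of_mul hnz
    rw [Complex.exp_add, Complex.exp_log hnz, hexp (z, w) (hpos _ ⟨w, hw, rfl⟩).le, hke z hzc, 
      hθ0 z hzpos.le]
    simp only [Complex.ofReal_zero, sub_zero, one_mul]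
    field_simp
    ring

/-- Poisson kernel -/
def PK (c w z : ℂ) : ℝ := ((z - c + (w - c)) / ((z - c) - (w - c))).re

theorem sphere_sub_ne {c w z : ℂ} {R : ℝ} (hz : z ∈ sphere c R) (hw : w ∈ ball c R) :
    (z - c) - (w - c) ≠ 0 := by
  intro h
  have : z = w := by linear_combination h
  rw [this, mem_sphere] at hz
  rw [mem_ball] at hw
  linarith

theorem PK_cont {c w : ℂ} {R : ℝ} (hw : w ∈ ball c R) : ContinuousOn (PK c w) (sphere c R) := by
  apply Complex.continuous_re.comp_continuousOn
  apply ContinuousOn.div (by fun_prop) (by fun_prop)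
  intro z hz
  exact sphere_sub_ne hz hw

theorem PK_nonneg {c w z : ℂ} {R : ℝ} (hw : w ∈ ball c R) (hz : z ∈ sphere c R) : 0 ≤ PK c w z := by
  refine le_trans ?_ (le_re_herglotzRieszKernel hz hw)
  have : ‖w - c‖ < R := mem_ball_iff_norm.1 hw
  apply div_nonneg <;> linarith [norm_nonneg (w - c)]

theorem ci_of_sphere {E : Type*} [NormedAddCommGroup E] {f : ℂ → E} {c : ℂ} {R : ℝ} (hR : 0 < R)
    (hf : ContinuousOn f (sphere c R)) : CircleIntegrable f c R := by
  apply ContinuousOn.circleIntegrable'; rwa [abs_of_pos hR]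

theorem PK_poly {c w : ℂ} {R : ℝ} (hR : 0 < R) (hw : w ∈ ball c R) (g : ℂ[X]) :
    Real.circleAverage (fun z => PK c w z * (g.eval z).re) c R = (g.eval w).re := by
  have h := DiffContOnCl.circleAverage_re_herglotzRieszKernel_smul' (f := fun z => g.eval z) (c := c)
    (w := w) (R := R) (g.differentiable.diffContOnCl) hw
  have hci : CircleIntegrable (fun z => PK c w z • g.eval z) c R := 
    ci_of_sphere hR ((PK_cont hw).smul g.continuous.continuousOn)
  have h2 := Complex.reCLM.circleAverage_comp_comm hci
  have e : (Complex.reCLM ∘ fun z => PK c w z • g.eval z) = fun z => PK c w z * (g.eval z).re := by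
    funext z; simp
  rw [e] at h2
  rw [h2, ← h]
  rfl

theorem PK_small {c w : ℂ} {R : ℝ} (hR : 0 < R) (hw : w ∈ ball c R) {u : ℂ → ℝ} {ε : ℝ}
    (hu : ContinuousOn u (sphere c R)) (hue : ∀ z ∈ sphere c R, |u z| ≤ ε) :
    |Real.circleAverage (fun z => PK c w z * u z) c R| ≤ ε := by
  have key : ∀ v : ℂ → ℝ, ContinuousOn v (sphere c R) → (∀ z ∈ sphere c R, v z ≤ ε) → 
      Real.circleAverage (fun z => PK c w z * v z) c R ≤ ε := by
    intro v hv hve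
    have h := PK_poly hR hw (C (ε : ℂ))
    simp only [eval_C, Complex.ofReal_re] at h
    rw [← h]
    apply Real.circleAverage_mono
    · exact ci_of_sphere hR ((PK_cont hw).mul hv)
    · exact ci_of_sphere hR ((PK_cont hw).mul continuousOn_const)
    · intro z hz
      rw [abs_of_pos hR] at hz
      exact mul_le_mul_of_nonneg_left (hve z hz) (PK_nonneg hw hz)
  rw [abs_le]
  constructor
  · have h := key (fun z => - u z) hu.neg (fun z hz => by linarith [(abs_le.1 (hue z hz)).1])
    have e : (fun z => PK c w z * -u z) = fun z => (-1 : ℝ) • (PK c w z * u z) := by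
      funext z; simp
    rw [e, Real.circleAverage_fun_smul, smul_eq_mul] at h
    linarith
  · exact key u hu (fun z hz => (abs_le.1 (hue z hz)).2)

theorem PK_re {c w : ℂ} {R : ℝ} (hR : 0 < R) (hw : w ∈ ball c R) {f : ℂ → ℂ}
    (hf : ContinuousOn f (closedBall c R)) 
    (hP : ∀ a g : ℂ[X], (∀ z ∈ closedBall c R, a.eval z ≠ 0) →
      (∀ z ∈ sphere c R, (a.eval z * f z - g.eval z).re < 0) →
      ∀ z ∈ closedBall c R, (a.eval z * f z - g.eval z).re ≤ 0) (a : ℂ[X]) 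
    (ha : ∀ z ∈ closedBall c R, a.eval z ≠ 0) :
    Real.circleAverage (fun z => PK c w z * (a.eval z * f z).re) c R = (a.eval w * f w).re := by
  have hac : Continuous (fun z => a.eval z) := a.continuous
  have hfs := hf.mono sphere_subset_closedBall
  have huc : ContinuousOn (fun z => (a.eval z * f z).re) (sphere c R) := 
    Complex.continuous_re.comp_continuousOn (hac.continuousOn.mul hfs)
  have hwc := ball_subset_closedBall hw
  rw [← sub_eq_zero, ← abs_nonpos_iff]
  apply le_of_forall_pos_le_add
  intro ε' hε'
  set ε := ε' / 2 with hεd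
  have hε : 0 < ε := by positivity
  obtain ⟨g, hg⟩ := exists_poly_approx _ c R hR huc ε hε
  have hgc : Continuous (fun z => (g.eval z).re) := Complex.continuous_re.comp g.continuous
  have h1 := hP a (g + C (ε : ℂ)) ha (by
    intro z hz
    have := (abs_lt.1 (hg z hz)).2
    simp only [eval_add, eval_C, Complex.sub_re, Complex.add_re, Complex.ofReal_re]
    linarith) w hwc
  have h2 := hP (-a) (-g + C (ε : ℂ)) (by simpa using ha) (by
    intro z hz
    have := (abs_lt.1 (hg z hz)).1
    simp only [eval_add, eval_C, Complex.sub_re, Complex.add_re, Complex.ofReal_re, eval_neg, neg_mul,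
      Complex.neg_re]
    linarith) w hwc
  simp only [eval_add, eval_C, Complex.sub_re, Complex.add_re, Complex.ofReal_re, eval_neg, neg_mul,
      Complex.neg_re] at h1 h2
  have h3 := PK_small hR hw (u := fun z => (a.eval z * f z).re - (g.eval z).re) (ε := ε)
    (huc.sub hgc.continuousOn) (fun z hz => (hg z hz).le)
  have e : (fun z => PK c w z * ((a.eval z * f z).re - (g.eval z).re)) =
      fun z => PK c w z * (a.eval z * f z).re - PK c w z * (g.eval z).re := by
    funext z; ring
  rw [e, Real.circleAverage_fun_sub (f₁ := fun z => PK c w z * (a.eval z * f z).re)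
    (f₂ := fun z => PK c w z * (g.eval z).re) (ci_of_sphere hR ((PK_cont hw).mul huc)) 
    (ci_of_sphere hR ((PK_cont hw).mul hgc.continuousOn)), PK_poly hR hw] at h3
  rw [abs_le] at h3 ⊢
  constructor <;> linarith [h3.1, h3.2]

theorem PK_cplx {c w : ℂ} {R : ℝ} (hR : 0 < R) (hw : w ∈ ball c R) {f : ℂ → ℂ}
    (hf : ContinuousOn f (closedBall c R)) 
    (hP : ∀ a g : ℂ[X], (∀ z ∈ closedBall c R, a.eval z ≠ 0) →
      (∀ z ∈ sphere c R, (a.eval z * f z - g.eval z).re < 0) →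
      ∀ z ∈ closedBall c R, (a.eval z * f z - g.eval z).re ≤ 0) (a : ℂ[X]) 
    (ha : ∀ z ∈ closedBall c R, a.eval z ≠ 0) :
    Real.circleAverage (fun z => PK c w z * (a.eval z * f z)) c R = a.eval w * f w := by
  have hac : Continuous (fun z => a.eval z) := a.continuous
  have hfs := hf.mono sphere_subset_closedBall
  have hci : CircleIntegrable (fun z => PK c w z * (a.eval z * f z)) c R := 
    ci_of_sphere hR ((Complex.continuous_ofReal.comp_continuousOn (PK_cont hw)).mul 
      (hac.continuousOn.mul hfs))
  have h1 := PK_re hR hw hf hP a ha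
  have h2 := PK_re hR hw hf hP (C (-Complex.I) * a) (by simpa using ha)
  have r1 := Complex.reCLM.circleAverage_comp_comm hci
  have r2 := Complex.imCLM.circleAverage_comp_comm hci
  have e1 : (Complex.reCLM ∘ fun z => PK c w z * (a.eval z * f z)) = fun z => PK c w z * (a.eval z * f z).re := by
    funext z; simp only [Function.comp, Complex.reCLM_apply, Complex.re_ofReal_mul]
  have e3 : ∀ z, (eval z (C (-Complex.I) * a) * f z).re = (a.eval z * f z).im := by
    intro z
    have : eval z (C (-Complex.I) * a) * f z = - (Complex.I * (a.eval z * f z)) := by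
      simp; ring
    rw [this, Complex.neg_re, Complex.I_mul_re, neg_neg]
  have e2 : (Complex.imCLM ∘ fun z => PK c w z * (a.eval z * f z)) = fun z => PK c w z * (a.eval z * f z).im := by
    funext z; simp only [Function.comp, Complex.imCLM_apply, Complex.im_ofReal_mul]
  simp only [e3] at h2
  rw [e1, h1] at r1
  rw [e2, h2] at r2
  apply Complex.ext
  · exact r1.symm
  · exact r2.symm

theorem PK_alg {s v sb vb P : ℂ} (h1 : s - v ≠ 0) (h2 : sb - vb ≠ 0) (h3 : s * sb - v * vb ≠ 0)
    (hP : P = ((s + v) / (s - v) + (sb + vb) / (sb - vb)) / 2) : 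
    P = s / (s - v) + vb / (s * sb - v * vb) * (P * (s - v)) := by
  have e : P = (s * sb - v * vb) / ((s - v) * (sb - vb)) := by
    rw [hP]; field_simp; ring
  rw [e]; field_simp; ring

theorem PK_ident {c w z : ℂ} {R : ℝ} (hw : w ∈ ball c R) (hz : z ∈ sphere c R) :
    (PK c w z : ℂ) = (z - c) / (z - w) + 
      (starRingEnd ℂ) (w - c) / ((R : ℂ) ^ 2 - (w - c) * (starRingEnd ℂ) (w - c)) * (PK c w z * (z - w)) := by
  have hne := sphere_sub_ne hz hw
  set s := z - c with hs
  set v := w - c with hv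
  have hzw : z - w = s - v := by rw [hs, hv]; ring
  have hsR : s * (starRingEnd ℂ) s = (R : ℂ) ^ 2 := by
    rw [Complex.mul_conj, Complex.normSq_eq_norm_sq, hs, ← dist_eq_norm, mem_sphere.1 hz]; push_cast; rfl
  have hR : 0 < R := pos_of_mem_ball hw
  have hvR : (R : ℂ) ^ 2 - v * (starRingEnd ℂ) v ≠ 0 := by
    rw [Complex.mul_conj, Complex.normSq_eq_norm_sq]
    have : ‖v‖ < R := mem_ball_iff_norm.1 hw
    have : ‖v‖ ^ 2 < R ^ 2 := by gcongr
    exact_mod_cast (sub_pos.2 this).ne'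
  have hne' : (starRingEnd ℂ) s - (starRingEnd ℂ) v ≠ 0 := by
    rw [← map_sub]; exact (_root_.map_ne_zero _).2 hne
  have hPK : (PK c w z : ℂ) = ((s + v) / (s - v) + (starRingEnd ℂ) ((s + v) / (s - v))) / 2 :=
    Complex.re_eq_add_conj _
  rw [map_div₀, map_add, map_sub _ s v] at hPK
  rw [← hsR] at hvR ⊢
  rw [hzw]
  clear_value s v
  exact PK_alg hne hne' hvR hPK

theorem lemma_H {c : ℂ} {R : ℝ} (hR : 0 < R) {f : ℂ → ℂ} (hf : ContinuousOn f (closedBall c R)) 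
    (hP : ∀ a g : ℂ[X], (∀ z ∈ closedBall c R, a.eval z ≠ 0) →
      (∀ z ∈ sphere c R, (a.eval z * f z - g.eval z).re < 0) →
      ∀ z ∈ closedBall c R, (a.eval z * f z - g.eval z).re ≤ 0) : DifferentiableOn ℂ f (ball c R) := by
  have hfs := hf.mono sphere_subset_closedBall
  have hcau : ∀ w ∈ ball c R, f w = (2 * Real.pi * Complex.I : ℂ)⁻¹ • ∮ z in C(c, R), (z - w)⁻¹ • f z := by
    intro w hw
    have hPc : ContinuousOn (fun z => (PK c w z : ℂ)) (sphere c R) :=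
      Complex.continuous_ofReal.comp_continuousOn (PK_cont hw)
    have h1 := PK_cplx hR hw hf hP 1 (by simp)
    have h2 := PK_cplx hR hw hf hP (X - C (c + R + 1)) (by
      intro z hz h0
      simp [sub_eq_zero] at h0
      rw [h0, mem_closedBall, dist_eq_norm] at hz
      have : c + R + 1 - c = ((R + 1 : ℝ) : ℂ) := by push_cast; ring
      rw [this, Complex.norm_real, Real.norm_eq_abs] at hz
      linarith [le_abs_self (R + 1)])
    simp only [eval_one, one_mul, eval_sub, eval_X, eval_C] at h1 h2
    have h3 : Real.circleAverage (fun z => PK c w z * ((z - w) * f z)) c R = 0 := by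
      have e : (fun z => PK c w z * ((z - w) * f z)) = fun z => PK c w z * ((z - (c + R + 1)) * f z) - 
          (w - (c + R + 1)) • (PK c w z * f z) := by
        funext z; simp only [smul_eq_mul]; ring
      rw [e, Real.circleAverage_fun_sub (ci_of_sphere hR (by fun_prop)) (ci_of_sphere hR (by fun_prop)),
        Real.circleAverage_fun_smul, h1, h2]
      simp
    set K := (starRingEnd ℂ) (w - c) / ((R : ℂ) ^ 2 - (w - c) * (starRingEnd ℂ) (w - c)) with hK
    have hdc : ContinuousOn (fun z => (z - c) / (z - w) * f z) (sphere c R) := by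
      apply ContinuousOn.mul _ hfs
      apply ContinuousOn.div (by fun_prop) (by fun_prop)
      intro z hz
      have := sphere_sub_ne hz hw
      rwa [sub_sub_sub_cancel_right] at this
    have h4 : Real.circleAverage (fun z => PK c w z * f z) c R = 
        Real.circleAverage (fun z => (z - c) / (z - w) * f z + K • (PK c w z * ((z - w) * f z))) c R := by
      apply Real.circleAverage_congr_sphere
      intro z hz
      rw [abs_of_pos hR] at hz
      simp only [smul_eq_mul]
      have := PK_ident hw hz
      rw [← hK] at this
      linear_combination f z * this
    rw [Real.circleAverage_fun_add (ci_of_sphere hR hdc) (ci_of_sphere hR (by fun_prop)), 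
      Real.circleAverage_fun_smul, h3, h1, smul_zero, add_zero] at h4
    rw [h4, Real.circleAverage_eq_circleIntegral hR.ne']
    congr 1
    apply circleIntegral.integral_congr hR.le
    intro z hz
    have h5 : z - c ≠ 0 := by
      intro h; rw [mem_sphere, dist_eq_norm, h] at hz; simp at hz; exact hR.ne hz
    have h6 : z - w ≠ 0 := by
      have := sphere_sub_ne hz hw
      rwa [sub_sub_sub_cancel_right] at this
    simp only [smul_eq_mul]
    field_simp
  lift R to NNReal using hR.le
  have hR' : 0 < R := by exact_mod_cast hR
  have hps := hasFPowerSeriesOn_cauchy_integral (ci_of_sphere hR hfs) hR'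
  have := hps.differentiableOn
  rw [Metric.eball_coe] at this
  exact this.congr hcau

theorem thm1D {Φ : ℂ × ℂ → EReal} (hΦ : PSH2 Φ) (hne : ∃ p, Φ p ≠ ⊥) {f : ℂ → ℂ} {U : Set ℂ}
    (hU : IsOpen U) (hf : ContinuousOn f U) (hb : ∀ z ∈ U, Φ (z, f z) = ⊥) : DifferentiableOn ℂ f U := by
  intro z hz
  obtain ⟨R, hR, hsub⟩ := Metric.nhds_basis_closedBall.mem_iff.1 (hU.mem_nhds hz)
  have := lemma_H hR (hf.mono hsub) (key hΦ hne hR (hf.mono hsub) (fun x hx => hb x (hsub hx)))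
  exact (this.differentiableAt (ball_mem_nhds z hR)).differentiableWithinAt

theorem rado {δ : ℂ → ℂ} {U : Set ℂ} (hU : IsOpen U) (hc : ContinuousOn δ U)
    (hd : ∀ z ∈ U, δ z ≠ 0 → DifferentiableAt ℂ δ z) : DifferentiableOn ℂ δ U := by
  intro z₀ hz₀
  obtain ⟨R, hR, hsub⟩ := Metric.nhds_basis_closedBall.mem_iff.1 (hU.mem_nhds hz₀)
  have hcc := hc.mono hsub
  refine ((lemma_H hR hcc ?_).differentiableAt (ball_mem_nhds z₀ hR)).differentiableWithinAt
  intro a g _ hs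
  set h : ℂ → ℂ := fun z => a.eval z * δ z - g.eval z with hh
  have hac : Continuous (fun z => a.eval z) := a.continuous
  have hgc : Continuous (fun z => g.eval z) := g.continuous
  have hhc : ContinuousOn h (closedBall z₀ R) := (hac.continuousOn.mul hcc).sub hgc.continuousOn
  have hrc : ContinuousOn (fun z => (h z).re) (closedBall z₀ R) := Complex.continuous_re.comp_continuousOn hhc
  obtain ⟨M, hM⟩ := (isCompact_closedBall z₀ R).bddAbove_image (f := fun z => ‖δ z‖) hcc.norm
  have hM' : ∀ z ∈ closedBall z₀ R, ‖δ z‖ ≤ M := fun p hp => hM (mem_image_of_mem _ hp)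
  have hbs : ∀ z ∈ closedBall z₀ R, z ∉ ball z₀ R → z ∈ sphere z₀ R := by
    intro z hz hz'
    rw [mem_ball, not_lt] at hz'
    exact le_antisymm hz hz'
  have hclos : ∀ V ⊆ ball z₀ R, closure V ⊆ closedBall z₀ R := fun V hV => 
    closure_minimal (hV.trans ball_subset_closedBall) isClosed_closedBall
  -- on δ ≠ 0
  have step1 : ∀ z ∈ ball z₀ R, δ z ≠ 0 → (h z).re ≤ 0 := by
    set Ω := ball z₀ R ∩ δ ⁻¹' {0}ᶜ with hΩ
    have hΩo : IsOpen Ω := (hcc.mono ball_subset_closedBall).isOpen_inter_preimage isOpen_ball isOpen_compl_singleton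
    have hb : ∀ n : ℕ, ∀ z ∈ Ω, ‖Complex.exp (n * h z) * δ z‖ ≤ M := by
      intro n z hz
      apply Complex.norm_le_of_forall_mem_frontier_norm_le (f := fun z => Complex.exp (n * h z) * δ z)
        (isBounded_ball.subset inter_subset_left) _ _ (subset_closure hz)
      · constructor
        · intro x hx
          have h1 := hd x (hsub (ball_subset_closedBall hx.1)) hx.2
          have h2 : DifferentiableAt ℂ h x := (a.differentiableAt.mul h1).sub g.differentiableAt
          exact (((h2.const_mul (n : ℂ)).cexp).mul h1).differentiableWithinAt
        · apply ContinuousOn.mono _ (hclos Ω inter_subset_left)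
          exact ((continuousOn_const.mul hhc).cexp).mul hcc
      · intro x hx
        rw [hΩo.frontier_eq] at hx
        have hxc := hclos Ω inter_subset_left hx.1
        by_cases hxb : x ∈ ball z₀ R
        · have : δ x = 0 := by
            by_contra h0
            exact hx.2 ⟨hxb, h0⟩
          simp [this]
          exact (norm_nonneg _).trans (hM' x hxc)
        · have hx0 := hs x (hbs x hxc hxb)
          rw [norm_mul, Complex.norm_exp]
          have : ((n : ℂ) * h x).re ≤ 0 := by
            rw [← Complex.ofReal_natCast, Complex.re_ofReal_mul]
            exact mul_nonpos_of_nonneg_of_nonpos (Nat.cast_nonneg n) hx0.le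
          calc _ ≤ 1 * ‖δ x‖ := by gcongr; exact Real.exp_le_one_iff.2 this
            _ ≤ M := by rw [one_mul]; exact hM' x hxc
    intro z hz hz0
    by_contra! hpos
    have hδ : 0 < ‖δ z‖ := norm_pos_iff.2 hz0
    obtain ⟨n, hn⟩ := exists_nat_gt (M / ‖δ z‖ / (h z).re)
    have h1 := hb n z ⟨hz, hz0⟩
    rw [norm_mul, Complex.norm_exp, ← Complex.ofReal_natCast, Complex.re_ofReal_mul] at h1
    have h2 := Real.add_one_le_exp (n * (h z).re)
    rw [div_lt_iff₀ hpos, div_lt_iff₀ hδ] at hn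
    have h3 : (n * (h z).re + 1) * ‖δ z‖ ≤ Real.exp (n * (h z).re) * ‖δ z‖ := by gcongr
    linarith
  intro p hp
  by_contra! hpos
  set W := ball z₀ R ∩ (fun z => (h z).re) ⁻¹' Ioi 0 with hW
  have hWo : IsOpen W := (hrc.mono ball_subset_closedBall).isOpen_inter_preimage isOpen_ball isOpen_Ioi
  have hpW : p ∈ W := by
    refine ⟨?_, hpos⟩
    by_contra hb
    exact absurd (hs p (hbs p hp hb)) (not_lt.2 hpos.le)
  have hWδ : ∀ z ∈ W, δ z = 0 := by
    intro z hz
    by_contra h0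
    exact absurd (step1 z hz.1 h0) (not_le.2 hz.2)
  have hcl := hclos W inter_subset_left
  have hWδ' : ∀ z ∈ closure W, δ z = 0 := by
    intro z hz
    have h1 : δ z ∈ closure (δ '' W) := (hcc.mono hcl).image_closure ⟨z, hz, rfl⟩
    have h2 : closure (δ '' W) ⊆ {0} := by
      apply closure_minimal _ isClosed_singleton
      rintro _ ⟨x, hx, rfl⟩
      exact hWδ x hx
    exact h2 h1
  have hWh : ∀ z ∈ closure W, 0 ≤ (h z).re := by
    intro z hz
    have h1 : (h z).re ∈ closure ((fun z => (h z).re) '' W) := (hrc.mono hcl).image_closure ⟨z, hz, rfl⟩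
    have h2 : closure ((fun z => (h z).re) '' W) ⊆ Ici 0 := by
      apply closure_minimal _ isClosed_Ici
      rintro _ ⟨x, hx, rfl⟩
      have h3 : 0 < (h x).re := hx.2
      exact h3.le
    exact h2 h1
  have hle : ‖Complex.exp (-(g.eval p))‖ ≤ 1 := by
    apply Complex.norm_le_of_forall_mem_frontier_norm_le (f := fun z => Complex.exp (-(g.eval z)))
        (isBounded_ball.subset inter_subset_left) _ _ (subset_closure hpW)
    · exact (g.differentiable.neg.cexp).diffContOnCl
    · intro x hx
      rw [hWo.frontier_eq] at hx
      have hxc := hcl hx.1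
      have hxb : x ∈ ball z₀ R := by
        by_contra hxb
        exact absurd (hs x (hbs x hxc hxb)) (not_lt.2 (hWh x hx.1))
      have : (h x).re ≤ 0 := by
        by_contra! h0
        exact hx.2 ⟨hxb, h0⟩
      simp only [hh, hWδ' x hx.1, mul_zero, zero_sub] at this
      rw [Complex.norm_exp]
      exact Real.exp_le_one_iff.2 this
  have : (h p).re ≤ 0 := by
    simp only [hh, hWδ p hpW, mul_zero, zero_sub]
    rw [Complex.norm_exp] at hle
    exact Real.exp_le_one_iff.1 hle
  exact absurd this (not_le.2 hpos)

theorem slice_unif {n : ℕ} {D : Set (Fin n → ℂ)} (hD : IsOpen D) {f : (Fin n → ℂ) → ℂ}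
    (hf : ContinuousOn f D) {e : Fin n → ℂ} (he : ‖e‖ ≤ 1) {z : Fin n → ℂ} (hz : z ∈ D) :
    ∃ r > 0, closedBall z (2 * r) ⊆ D ∧ 
      TendstoUniformlyOn (fun (z' : Fin n → ℂ) (ζ : ℂ) => f (z' + ζ • e)) (fun ζ => f (z + ζ • e)) (nhds z) (ball 0 r) := by
  obtain ⟨R, hR, hsub⟩ := Metric.nhds_basis_closedBall.mem_iff.1 (hD.mem_nhds hz)
  have hR2 : 2 * (R / 2) = R := by ring
  refine ⟨R / 2, by positivity, by rwa [hR2], ?_⟩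
  have huc := (isCompact_closedBall z R).uniformContinuousOn_of_continuous (hf.mono hsub)
  rw [Metric.uniformContinuousOn_iff] at huc
  rw [Metric.tendstoUniformlyOn_iff]
  intro ε hε
  obtain ⟨η, hη, hh⟩ := huc ε hε
  filter_upwards [ball_mem_nhds z (lt_min hη (half_pos hR))] with z' hz' ζ hζ
  rw [mem_ball, lt_min_iff] at hz'
  rw [mem_ball_zero_iff] at hζ
  have hn : ‖ζ • e‖ ≤ R / 2 := by
    rw [norm_smul]
    calc ‖ζ‖ * ‖e‖ ≤ (R / 2) * 1 := by gcongr
      _ = R / 2 := mul_one _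
  apply hh
  · rw [mem_closedBall, dist_self_add_left]; linarith
  · rw [mem_closedBall, dist_eq_norm]
    have e1 : z' + ζ • e - z = (z' - z) + ζ • e := by abel
    rw [e1]
    have := norm_add_le (z' - z) (ζ • e)
    rw [← dist_eq_norm] at this
    linarith [hz'.2]
  · rw [dist_add_right, dist_comm]; exact hz'.1

theorem slice_shift {n : ℕ} {f : (Fin n → ℂ) → ℂ} {y e : Fin n → ℂ} {τ : ℂ}
    (h : DifferentiableAt ℂ (fun ζ : ℂ => f (y + τ • e + ζ • e)) 0) :
    HasDerivAt (fun ζ : ℂ => f (y + ζ • e)) (deriv (fun ζ : ℂ => f (y + τ • e + ζ • e)) 0) τ := by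
  have h1 := h.hasDerivAt
  rw [← sub_self τ] at h1
  have h2 := h1.comp_sub_const τ τ
  rw [sub_self] at h2
  have h3 : (fun ζ : ℂ => f (y + ζ • e)) = fun x : ℂ => f (y + τ • e + (x - τ) • e) := by
    funext ζ
    congr 1
    rw [sub_smul]; abel
  rw [h3]
  exact h2

theorem slice_limit {n : ℕ} {D G : Set (Fin n → ℂ)} (hD : IsOpen D) {f : (Fin n → ℂ) → ℂ}
    (hf : ContinuousOn f D) {e : Fin n → ℂ} (he : ‖e‖ ≤ 1)
    (hG : ∀ V : Set (Fin n → ℂ), IsOpen V → V ⊆ D → V.Nonempty → (V ∩ G).Nonempty)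
    (hd : ∀ z ∈ D, z ∈ G → ∀ ζ : ℂ, z + ζ • e ∈ D → DifferentiableAt ℂ (fun ζ : ℂ => f (z + ζ • e)) ζ)
    {z : Fin n → ℂ} (hz : z ∈ D) : DifferentiableAt ℂ (fun ζ : ℂ => f (z + ζ • e)) 0 := by
  obtain ⟨r, hr, hsub, hu⟩ := slice_unif hD hf he hz
  have hne : (nhdsWithin z G).NeBot := by
    rw [← mem_closure_iff_nhdsWithin_neBot, _root_.mem_closure_iff]
    intro o ho hzo
    obtain ⟨x, hx⟩ := hG (o ∩ D) (ho.inter hD) inter_subset_right ⟨z, hzo, hz⟩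
    exact ⟨x, hx.1.1, hx.2⟩
  have hu' : TendstoUniformlyOn (fun (z' : Fin n → ℂ) (ζ : ℂ) => f (z' + ζ • e)) 
      (fun ζ => f (z + ζ • e)) (nhdsWithin z G) (ball 0 r) :=
    fun u hu1 => (hu u hu1).filter_mono nhdsWithin_le_nhds
  have hdo := hu'.tendstoLocallyUniformlyOn.differentiableOn (by
    filter_upwards [self_mem_nhdsWithin, nhdsWithin_le_nhds (ball_mem_nhds z hr)] with z' h1 h2
    intro ζ hζ
    apply DifferentiableAt.differentiableWithinAt
    apply hd z' (hsub _) h1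
    · apply hsub
      rw [mem_closedBall, dist_eq_norm]
      have e1 : z' + ζ • e - z = (z' - z) + ζ • e := by abel
      rw [e1]
      have := norm_add_le (z' - z) (ζ • e)
      rw [← dist_eq_norm] at this
      rw [mem_ball_zero_iff] at hζ
      have hn : ‖ζ • e‖ ≤ r := by
        rw [norm_smul]
        calc ‖ζ‖ * ‖e‖ ≤ r * 1 := by gcongr
          _ = r := mul_one _
      linarith [mem_ball.1 h2]
    · rw [mem_closedBall]; linarith [mem_ball.1 h2]) isOpen_ball
  exact hdo.differentiableAt (ball_mem_nhds 0 hr)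

theorem norm_single_le {n : ℕ} (i : Fin n) : ‖(Pi.single i 1 : Fin n → ℂ)‖ ≤ 1 := by
  rw [Pi.norm_single]; simp

theorem partial_cont {n : ℕ} {D : Set (Fin n → ℂ)} (hD : IsOpen D) {f : (Fin n → ℂ) → ℂ}
    (hf : ContinuousOn f D) {e : Fin n → ℂ} (he : ‖e‖ ≤ 1)
    (hd : ∀ z ∈ D, DifferentiableAt ℂ (fun ζ : ℂ => f (z + ζ • e)) 0) {z : Fin n → ℂ} (hz : z ∈ D) :
    ContinuousAt (fun z => deriv (fun ζ : ℂ => f (z + ζ • e)) 0) z := by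
  obtain ⟨r, hr, hsub, hu⟩ := slice_unif hD hf he hz
  have := (hu.tendstoLocallyUniformlyOn.deriv (by
    filter_upwards [ball_mem_nhds z hr] with z' h2
    intro ζ hζ
    apply DifferentiableAt.differentiableWithinAt
    refine (slice_shift (hd _ ?_)).differentiableAt
    · apply hsub
      rw [mem_closedBall, dist_eq_norm]
      have e1 : z' + ζ • e - z = (z' - z) + ζ • e := by abel
      rw [e1]
      have := norm_add_le (z' - z) (ζ • e)
      rw [← dist_eq_norm] at this
      rw [mem_ball_zero_iff] at hζ
      have hn : ‖ζ • e‖ ≤ r := by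
        rw [norm_smul]
        calc ‖ζ‖ * ‖e‖ ≤ r * 1 := by gcongr
          _ = r := mul_one _
      linarith [mem_ball.1 h2]) isOpen_ball).tendsto_at (mem_ball_self hr)
  exact this

theorem osgood_step {n : ℕ} {D : Set (Fin n → ℂ)} (hD : IsOpen D) {f : (Fin n → ℂ) → ℂ}
    (hf : ContinuousOn f D) {e : Fin n → ℂ} (he : ‖e‖ ≤ 1)
    (hd : ∀ z ∈ D, DifferentiableAt ℂ (fun ζ : ℂ => f (z + ζ • e)) 0) {z : Fin n → ℂ} (hz : z ∈ D)
    {ε : ℝ} (hε : 0 < ε) : ∃ ρ > 0, ∀ (y : Fin n → ℂ) (t : ℂ), ‖y - z‖ < ρ → ‖t‖ < ρ →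
      ‖f (y + t • e) - f y - t * deriv (fun ζ : ℂ => f (z + ζ • e)) 0‖ ≤ ε * ‖t‖ := by
  have hc := partial_cont hD hf he hd hz
  have hev := (Metric.continuousAt_iff'.1 hc ε hε).and (hD.mem_nhds hz)
  obtain ⟨ρ, hρ, hb⟩ := Metric.eventually_nhds_iff.1 hev
  refine ⟨ρ / 2, by positivity, ?_⟩
  intro y t hy ht
  have hin : ∀ τ ∈ ball (0:ℂ) (ρ / 2), dist (y + τ • e) z < ρ := by
    intro τ hτ
    rw [dist_eq_norm]
    have e1 : y + τ • e - z = (y - z) + τ • e := by abel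
    rw [e1]
    have := norm_add_le (y - z) (τ • e)
    rw [mem_ball_zero_iff] at hτ
    have hn : ‖τ • e‖ ≤ ρ / 2 := by
      rw [norm_smul]
      calc ‖τ‖ * ‖e‖ ≤ ρ / 2 * 1 := by gcongr
        _ = ρ / 2 := mul_one _
    linarith
  have hder : ∀ τ ∈ ball (0:ℂ) (ρ / 2), HasDerivWithinAt 
      (fun τ : ℂ => f (y + τ • e) - τ * deriv (fun ζ : ℂ => f (z + ζ • e)) 0)
      (deriv (fun ζ : ℂ => f (y + τ • e + ζ • e)) 0 - 1 * deriv (fun ζ : ℂ => f (z + ζ • e)) 0)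
      (ball 0 (ρ / 2)) τ := by
    intro τ hτ
    apply HasDerivAt.hasDerivWithinAt
    exact (slice_shift (hd _ (hb (hin τ hτ)).2)).fun_sub ((hasDerivAt_id' τ).mul_const _)
  have := Convex.norm_image_sub_le_of_norm_hasDerivWithin_le (C := ε) hder (by
    intro τ hτ
    have := (hb (hin τ hτ)).1
    rw [dist_eq_norm] at this
    rw [one_mul]
    exact this.le) (convex_ball _ _) (mem_ball_self (half_pos hρ)) (y := t) (by rwa [mem_ball_zero_iff])
  simp only [zero_smul, add_zero, zero_mul, sub_zero] at this
  rw [sub_right_comm]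
  exact this

theorem osgood {n : ℕ} {D : Set (Fin n → ℂ)} (hD : IsOpen D) {f : (Fin n → ℂ) → ℂ}
    (hf : ContinuousOn f D) 
    (hd : ∀ z ∈ D, ∀ i, DifferentiableAt ℂ (fun ζ : ℂ => f (z + ζ • Pi.single i 1)) 0) :
    DifferentiableOn ℂ f D := by
  classical
  intro z hz
  apply DifferentiableAt.differentiableWithinAt
  set p : Fin n → ℂ := fun i => deriv (fun ζ : ℂ => f (z + ζ • Pi.single i 1)) 0 with hp
  set σ : Finset (Fin n) → (Fin n → ℂ) → (Fin n → ℂ) := fun s h j => if j ∈ s then h j else 0 with hσ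
  have hσn : ∀ s h, ‖σ s h‖ ≤ ‖h‖ := by
    intro s h
    rw [pi_norm_le_iff_of_nonneg (norm_nonneg _)]
    intro j
    simp only [hσ]
    split_ifs
    · exact norm_le_pi_norm h j
    · simp
  have claim : ∀ s : Finset (Fin n), ∀ ε > 0, ∃ ρ > 0, ∀ h : Fin n → ℂ, ‖h‖ < ρ →
      ‖f (z + σ s h) - f z - ∑ i ∈ s, h i * p i‖ ≤ ε * ‖h‖ := by
    intro s
    induction s using Finset.induction_on with
    | empty =>
      intro ε hε
      refine ⟨1, one_pos, ?_⟩
      intro h _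
      have : σ ∅ h = 0 := by funext j; simp [hσ]
      simp [this]
      positivity
    | insert i s hi ih =>
      intro ε hε
      obtain ⟨ρ₁, hρ₁, h1⟩ := ih (ε / 2) (half_pos hε)
      obtain ⟨ρ₂, hρ₂, h2⟩ := osgood_step hD hf (norm_single_le i) (fun z hz => hd z hz i) hz (half_pos hε)
      refine ⟨min ρ₁ ρ₂, lt_min hρ₁ hρ₂, ?_⟩
      intro h hh
      rw [lt_min_iff] at hh
      have e1 : z + σ (insert i s) h = z + σ s h + h i • Pi.single i 1 := by
        funext j
        simp only [hσ, Pi.add_apply, Pi.smul_apply, smul_eq_mul, Pi.single_apply, Finset.mem_insert]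
        by_cases hj : j = i
        · subst hj; simp [hi]
        · simp [hj]
      have a1 := h1 h hh.1
      have a2 := h2 (z + σ s h) (h i) (by
        rw [add_sub_cancel_left]; exact (hσn s h).trans_lt hh.2) ((norm_le_pi_norm h i).trans_lt hh.2)
      rw [e1, Finset.sum_insert hi]
      have e2 : f (z + σ s h + h i • Pi.single i 1) - f z - (h i * p i + ∑ i ∈ s, h i * p i) =
        (f (z + σ s h + h i • Pi.single i 1) - f (z + σ s h) - h i * p i) + 
          (f (z + σ s h) - f z - ∑ i ∈ s, h i * p i) := by ring
      rw [e2]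
      refine (norm_add_le _ _).trans ?_
      have a3 : ε / 2 * ‖h i‖ ≤ ε / 2 * ‖h‖ := by gcongr; exact norm_le_pi_norm h i
      simp only [hp] at a1 ⊢
      linarith
  have hF : HasFDerivAt f (∑ i, (p i) • (ContinuousLinearMap.proj i : (Fin n → ℂ) →L[ℂ] ℂ)) z := by
    rw [hasFDerivAt_iff_isLittleO_nhds_zero, Asymptotics.isLittleO_iff]
    intro ε hε
    obtain ⟨ρ, hρ, h1⟩ := claim Finset.univ ε hε
    filter_upwards [ball_mem_nhds (0 : Fin n → ℂ) hρ] with h hh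
    have := h1 h (by rwa [mem_ball_zero_iff] at hh)
    have e1 : σ Finset.univ h = h := by funext j; simp [hσ]
    rw [e1] at this
    have e2 : (∑ i, (p i) • (ContinuousLinearMap.proj i : (Fin n → ℂ) →L[ℂ] ℂ)) h =
        ∑ i, h i * p i := by
      rw [ContinuousLinearMap.sum_apply]
      refine Finset.sum_congr rfl fun i _ => ?_
      rw [ContinuousLinearMap.smul_apply, ContinuousLinearMap.proj_apply, smul_eq_mul, mul_comm]
    rw [e2]
    exact this
  exact hF.differentiableAt

def PP {m : ℕ} (c : Fin m → ℂ) : ℂ[X] := X ^ m + ∑ i : Fin m, C (c i) * X ^ (m - ((i : ℕ) + 1))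

theorem PP_eval {m : ℕ} (c : Fin m → ℂ) (w : ℂ) :
    (PP c).eval w = w ^ m + ∑ i : Fin m, c i * w ^ (m - ((i : ℕ) + 1)) := by
  simp [PP, eval_finsetSum]

theorem PP_deg {m : ℕ} (hm : 0 < m) (c : Fin m → ℂ) :
    (∑ i : Fin m, C (c i) * X ^ (m - ((i : ℕ) + 1)) : ℂ[X]).degree < (m : WithBot ℕ) := by
  refine (degree_sum_le _ _).trans_lt ?_
  rw [Finset.sup_lt_iff (by exact WithBot.bot_lt_coe m)]
  intro i _
  refine (degree_C_mul_X_pow_le _ _).trans_lt ?_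
  have := i.2
  exact_mod_cast (by omega : m - ((i : ℕ) + 1) < m)

theorem PP_monic {m : ℕ} (hm : 0 < m) (c : Fin m → ℂ) : (PP c).Monic :=
  monic_X_pow_add (PP_deg hm c)

theorem PP_natDegree {m : ℕ} (hm : 0 < m) (c : Fin m → ℂ) : (PP c).natDegree = m := by
  apply natDegree_eq_of_degree_eq_some
  rw [PP, degree_add_eq_left_of_degree_lt] <;> simp
  exact_mod_cast PP_deg hm c

theorem PP_coeff {m : ℕ} (c : Fin m → ℂ) (i : Fin m) :
    (PP c).coeff (m - ((i : ℕ) + 1)) = c i := by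
  have hi := i.2
  simp only [PP, coeff_add, finsetSum_coeff, coeff_X_pow, coeff_C_mul]
  rw [Finset.sum_eq_single i]
  · rw [if_neg (by omega)]; simp
  · intro j _ hj
    have := j.2
    rw [if_neg, mul_zero]
    intro h
    apply hj
    ext
    omega
  · simp

theorem PP_coeff_diff {m : ℕ} (k : ℕ) : Differentiable ℂ (fun c : Fin m → ℂ => (PP c).coeff k) := by
  simp only [PP, coeff_add, finsetSum_coeff, coeff_X_pow, coeff_C_mul]
  fun_prop

theorem prod_diff {E ι : Type*} [NormedAddCommGroup E] [NormedSpace ℂ E] (s : Finset ι) (f : ι → E → ℂ)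
    (h : ∀ i ∈ s, Differentiable ℂ (f i)) : Differentiable ℂ (fun c => ∏ i ∈ s, f i c) := by
  classical
  induction s using Finset.induction_on with
  | empty => simp
  | insert i s hi ih =>
    simp only [Finset.prod_insert hi]
    exact (h i (Finset.mem_insert_self i s)).fun_mul (ih fun j hj => h j (Finset.mem_insert_of_mem hj))

def dscr {m : ℕ} (c : Fin m → ℂ) : ℂ := resultant (PP c) (derivative (PP c)) m (m - 1)

theorem dscr_diff {m : ℕ} : Differentiable ℂ (dscr : (Fin m → ℂ) → ℂ) := by
  have h1 := fun k => PP_coeff_diff (m := m) k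
  have h2 : ∀ k, Differentiable ℂ (fun c : Fin m → ℂ => (derivative (PP c)).coeff k) := by
    intro k
    simp only [coeff_derivative]
    exact (h1 (k + 1)).mul_const _
  unfold dscr resultant
  simp only [Matrix.det_apply]
  refine Differentiable.fun_sum fun σ _ => ?_
  refine Differentiable.const_smul ?_ _
  refine prod_diff _ _ fun i _ => ?_
  unfold sylvester
  simp only [Matrix.of_apply]
  induction i using Fin.addCases <;> simp only [Fin.addCases_left, Fin.addCases_right] <;> split_ifs <;>
    first | exact h1 _ | exact h2 _ | exact differentiable_const _

theorem dscr_ne {m : ℕ} (hm : 0 < m) (c : Fin m → ℂ) : dscr c ≠ 0 ↔ (PP c).Separable := by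
  have hd : (derivative (PP c)).natDegree = m - 1 := by
    rw [natDegree_derivative, PP_natDegree hm]
  have := isUnit_resultant_iff_isCoprime (g := derivative (PP c)) (PP_monic hm c)
  rw [PP_natDegree hm, hd, isUnit_iff_ne_zero] at this
  exact this

theorem PP_of_roots {m : ℕ} (hm : 0 < m) (c : Fin m → ℂ) (ξ : Fin m → ℂ) (hξ : Function.Injective ξ)
    (h : ∀ k, (PP c).IsRoot (ξ k)) : PP c = ∏ j : Fin m, (X - C (ξ j)) := by
  have hdvd : ∏ j : Fin m, (X - C (ξ j)) ∣ PP c := by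
    apply Finset.prod_dvd_of_coprime
    · intro i _ j _ hij
      exact isCoprime_X_sub_C_of_isUnit_sub (by
        rw [isUnit_iff_ne_zero]; exact sub_ne_zero.2 (fun e => hij (hξ e)))
    · intro i _
      exact dvd_iff_isRoot.2 (h i)
  refine (eq_of_monic_of_dvd_of_natDegree_le (monic_prod_X_sub_C _ _) (PP_monic hm c) hdvd ?_)
  rw [PP_natDegree hm, natDegree_finsetProd_X_sub_C_eq_card]; simp

theorem PP_sep_roots {m : ℕ} (hm : 0 < m) (c : Fin m → ℂ) (h : (PP c).Separable) :
    ∃ ξ : Fin m → ℂ, Function.Injective ξ ∧ ∀ k, (PP c).IsRoot (ξ k) := by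
  have hs := IsAlgClosed.splits (PP c)
  have hc : (PP c).roots.toFinset.card = m := by
    rw [Multiset.toFinset_card_of_nodup (nodup_roots h), ← hs.natDegree_eq_card_roots, PP_natDegree hm]
  let e := (PP c).roots.toFinset.equivFinOfCardEq hc
  refine ⟨fun k => (e.symm k : ℂ), fun a b hab => e.symm.injective (Subtype.ext hab), fun k => ?_⟩
  have := (e.symm k).2
  rw [Multiset.mem_toFinset] at this
  exact isRoot_of_mem_roots this

theorem PP_sep_of {m : ℕ} (c : Fin m → ℂ) (ξ : Fin m → ℂ) (hξ : Function.Injective ξ)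
    (h : PP c = ∏ j : Fin m, (X - C (ξ j))) : (PP c).Separable := by
  rw [h]; exact separable_prod_X_sub_C_iff.2 hξ

theorem root_near {m : ℕ} (hm : 0 < m) (c₀ : Fin m → ℂ) (w : ℂ) (hw : (PP c₀).IsRoot w) {η : ℝ} (hη : 0 < η) :
    ∀ᶠ c in nhds c₀, ∃ r, (PP c).IsRoot r ∧ ‖w - r‖ < η := by
  have hcont : Continuous (fun c : Fin m → ℂ => ‖(PP c).eval w‖) := by
    simp only [PP_eval]; fun_prop
  have h0 : ‖(PP c₀).eval w‖ < η ^ m := by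
    rw [hw.eq_zero, norm_zero]; positivity
  filter_upwards [hcont.continuousAt.eventually_lt continuousAt_const h0] with c hc
  by_contra! hcon
  have hs := IsAlgClosed.splits (PP c)
  have e1 := hs.eval_eq_prod_roots_of_monic (PP_monic hm c) w
  have hcard := hs.natDegree_eq_card_roots
  rw [PP_natDegree hm] at hcard
  have key : ∀ s : Multiset ℂ, (∀ r ∈ s, η ≤ ‖w - r‖) → η ^ s.card ≤ ‖(s.map (fun a => w - a)).prod‖ := by
    intro s
    induction s using Multiset.induction_on with
    | empty => simp
    | cons a s ih =>
      intro h
      rw [Multiset.map_cons, Multiset.prod_cons, norm_mul, Multiset.card_cons, pow_succ, mul_comm]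
      have i1 := ih (fun r hr => h r (Multiset.mem_cons_of_mem hr))
      have i2 := h a (Multiset.mem_cons_self a s)
      gcongr
  have := key (PP c).roots (fun r hr => hcon r (isRoot_of_mem_roots hr))
  rw [← e1, ← hcard] at this
  linarith

theorem local_roots {m : ℕ} (hm : 0 < m) (c₁ : Fin m → ℂ) (ξ : Fin m → ℂ) (hξ : Function.Injective ξ)
    (h : ∀ k, (PP c₁).IsRoot (ξ k)) :
    ∃ B : Set (Fin m → ℂ), IsOpen B ∧ c₁ ∈ B ∧ ∃ ρ : Fin m → (Fin m → ℂ) → ℂ,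
      (∀ k, ContinuousOn (ρ k) B) ∧ 
      ∀ c ∈ B, (∀ k, (PP c).IsRoot (ρ k c)) ∧ PP c = ∏ j : Fin m, (X - C (ρ j c)) := by
  obtain ⟨ε, hε, hsep⟩ : ∃ ε > 0, ∀ k l, k ≠ l → 2 * ε < ‖ξ k - ξ l‖ := by
    have h1 : ∀ᶠ ε in nhdsWithin (0:ℝ) (Ioi 0), ∀ k l, k ≠ l → 2 * ε < ‖ξ k - ξ l‖ := by
      rw [Filter.eventually_all]; intro k
      rw [Filter.eventually_all]; intro l
      by_cases hkl : k = l
      · exact Filter.Eventually.of_forall fun _ hh => (hh hkl).elim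
      · have hpos : 0 < ‖ξ k - ξ l‖ := norm_pos_iff.2 (sub_ne_zero.2 fun e => hkl (hξ e))
        filter_upwards [nhdsWithin_le_nhds (Iio_mem_nhds (half_pos hpos))] with ε h _
        simp only [mem_Iio] at h
        linarith
    obtain ⟨ε, h2, h3⟩ := (h1.and self_mem_nhdsWithin).exists
    exact ⟨ε, h3, h2⟩
  have hev : ∀ᶠ c in nhds c₁, ∀ k, ∃ r, (PP c).IsRoot r ∧ ‖ξ k - r‖ < ε := by
    rw [Filter.eventually_all]; intro k
    exact root_near hm c₁ (ξ k) (h k) hε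
  obtain ⟨B, hB, hBo, hcB⟩ := _root_.mem_nhds_iff.1 hev
  have hB' : ∀ c : Fin m → ℂ, ∀ k, ∃ r, c ∈ B → (PP c).IsRoot r ∧ ‖ξ k - r‖ < ε := by
    intro c k
    by_cases hc : c ∈ B
    · obtain ⟨r, hr⟩ := hB hc k
      exact ⟨r, fun _ => hr⟩
    · exact ⟨0, fun h => (hc h).elim⟩
  choose ρ hρ using hB'
  have hprod : ∀ c ∈ B, PP c = ∏ j : Fin m, (X - C (ρ c j)) := by
    intro c hc
    apply PP_of_roots hm c _ _ (fun k => (hρ c k hc).1)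
    intro k l hkl
    by_contra hne
    have h1 := hsep k l hne
    have h2 := (hρ c k hc).2
    have h3 := (hρ c l hc).2
    rw [hkl] at h2
    have h4 := norm_sub_le_norm_sub_add_norm_sub (ξ k) (ρ c l) (ξ l)
    rw [norm_sub_rev (ρ c l)] at h4
    linarith
  have huniq : ∀ c ∈ B, ∀ k r, (PP c).IsRoot r → ‖ξ k - r‖ < ε → r = ρ c k := by
    intro c hc k r hr hrk
    have h1 : (PP c).eval r = 0 := hr
    rw [hprod c hc, eval_prod, Finset.prod_eq_zero_iff] at h1
    obtain ⟨l, -, hl⟩ := h1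
    simp only [eval_sub, eval_X, eval_C, sub_eq_zero] at hl
    by_cases hkl : k = l
    · rw [hkl]; exact hl
    · exfalso
      have h1 := hsep k l hkl
      have h3 := (hρ c l hc).2
      rw [← hl] at h3
      have h4 := norm_sub_le_norm_sub_add_norm_sub (ξ k) r (ξ l)
      rw [norm_sub_rev r] at h4
      linarith
  refine ⟨B, hBo, hcB, fun k c => ρ c k, ?_, fun c hc => ⟨fun k => (hρ c k hc).1, hprod c hc⟩⟩
  intro k c' hc'
  apply ContinuousAt.continuousWithinAt
  rw [Metric.continuousAt_iff']
  intro η hη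
  have hpos : 0 < ε - ‖ξ k - ρ c' k‖ := sub_pos.2 (hρ c' k hc').2
  filter_upwards [root_near hm c' (ρ c' k) (hρ c' k hc').1 (lt_min hη hpos), hBo.mem_nhds hc'] with c ⟨r, h1, h2⟩ hc
  rw [lt_min_iff] at h2
  have h4 := norm_sub_le_norm_sub_add_norm_sub (ξ k) (ρ c' k) r
  have := huniq c hc k r h1 (by linarith [h2.2])
  rw [← this, dist_comm, dist_eq_norm]
  exact h2.1

theorem prod_coeff_diff {E ι : Type*} [NormedAddCommGroup E] [NormedSpace ℂ E] (s : Finset ι) (f : ι → E → ℂ)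
    (x : E) (h : ∀ i ∈ s, DifferentiableAt ℂ (f i) x) : 
    ∀ k, DifferentiableAt ℂ (fun c => (∏ i ∈ s, (X - C (f i c))).coeff k) x := by
  classical
  induction s using Finset.induction_on with
  | empty => simp
  | insert i s hi ih =>
    intro k
    have ih' := ih fun j hj => h j (Finset.mem_insert_of_mem hj)
    have hh := h i (Finset.mem_insert_self i s)
    simp only [Finset.prod_insert hi, coeff_mul]
    refine DifferentiableAt.fun_sum fun p _ => ?_
    refine DifferentiableAt.fun_mul ?_ (ih' _)
    simp only [coeff_sub, coeff_C]
    split_ifs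
    · exact (differentiableAt_const _).fun_sub hh
    · simp

theorem psh_bot {N : ℕ} {φ : (Fin N → ℂ) → EReal} (hφ : Plurisubharmonic φ) {W : Set (Fin N → ℂ)} (hW : IsOpen W)
    {p : Fin N → ℂ} (hp : p ∈ W) (hb : ∀ q ∈ W, φ q = ⊥) (q : Fin N → ℂ) : φ q = ⊥ := by
  have hc : Continuous (fun t : ℂ => p + t • (q - p)) := by fun_prop
  have hWo : IsOpen ((fun t : ℂ => p + t • (q - p)) ⁻¹' W) := hW.preimage hc
  obtain ⟨ρ, hρ, hsub⟩ := Metric.isOpen_iff.1 hWo 0 (by simpa using hp)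
  have := subharmonic_bot_of_ball (hφ.2.2 p (q - p)) (fun z => hφ.2.1 _) hρ (fun z hz => hb _ (hsub hz)) 1
  simpa using this

theorem snoc_affine {n : ℕ} (z e : Fin n → ℂ) (ζ w : ℂ) : 
    (Fin.snoc (z + ζ • e) w : Fin (n + 1) → ℂ) = 
      Fin.snoc z 0 + ζ • (Fin.snoc e 0 : Fin (n + 1) → ℂ) + w • (Fin.snoc (0 : Fin n → ℂ) 1 : Fin (n + 1) → ℂ) := by
  funext j
  induction j using Fin.lastCases <;> simp

theorem slice_psh {n : ℕ} {φ : (Fin (n + 1) → ℂ) → EReal} (hφ : Plurisubharmonic φ) (z e : Fin n → ℂ) :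
    PSH2 (fun p : ℂ × ℂ => φ (Fin.snoc (z + p.1 • e) p.2)) := by
  simp only [snoc_affine]
  refine ⟨hφ.1.comp (by fun_prop), fun p => hφ.2.1 _, ?_⟩
  intro a b
  have := hφ.2.2 (Fin.snoc z 0 + a.1 • (Fin.snoc e 0 : Fin (n + 1) → ℂ) + a.2 • (Fin.snoc (0 : Fin n → ℂ) 1 : Fin (n + 1) → ℂ))
    (b.1 • (Fin.snoc e 0 : Fin (n + 1) → ℂ) + b.2 • (Fin.snoc (0 : Fin n → ℂ) 1 : Fin (n + 1) → ℂ))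
  refine (congrArg (fun f => SubharmonicOn f univ) ?_).mp this
  funext t
  congr 1
  simp only [Prod.fst_add, Prod.snd_add, Prod.smul_fst, Prod.smul_snd, smul_eq_mul]
  module

theorem good_dense {n : ℕ} {φ : (Fin (n + 1) → ℂ) → EReal} (hφ : Plurisubharmonic φ) (hne : ¬ ∀ z, φ z = ⊥)
    {V : Set (Fin n → ℂ)} (hV : IsOpen V) (hVn : V.Nonempty) : 
    (V ∩ {z | ∃ w, φ (Fin.snoc z w) ≠ ⊥}).Nonempty := by
  by_contra hcon
  rw [not_nonempty_iff_eq_empty] at hcon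
  apply hne
  obtain ⟨v, hv⟩ := hVn
  have hc : Continuous (fun p : Fin (n + 1) → ℂ => (Fin.init p : Fin n → ℂ)) := by
    unfold Fin.init; fun_prop
  refine psh_bot hφ (hV.preimage hc) (p := Fin.snoc v 0) (by simpa using hv) ?_
  intro q hq
  by_contra hqn
  have : Fin.init q ∈ V ∩ {z | ∃ w, φ (Fin.snoc z w) ≠ ⊥} := 
    ⟨hq, q (Fin.last n), by rwa [Fin.snoc_init_self]⟩
  rw [hcon] at this
  exact this

theorem line_cont {n : ℕ} (z e : Fin n → ℂ) : Continuous (fun ζ : ℂ => z + ζ • e) := by fun_prop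

theorem graph_diff {n : ℕ} {φ : (Fin (n + 1) → ℂ) → EReal} (hφ : Plurisubharmonic φ) (hne : ¬ ∀ z, φ z = ⊥)
    {V : Set (Fin n → ℂ)} (hV : IsOpen V) {f : (Fin n → ℂ) → ℂ} (hf : ContinuousOn f V)
    (hb : ∀ z ∈ V, φ (Fin.snoc z (f z)) = ⊥) : DifferentiableOn ℂ f V := by
  refine osgood hV hf ?_
  intro z hz i
  refine slice_limit (G := {z | ∃ w, φ (Fin.snoc z w) ≠ ⊥}) hV hf (norm_single_le i) 
    (fun W hW _ hWn => good_dense hφ hne hW hWn) ?_ hz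
  intro z' hz' hg ζ hζ
  have hU : IsOpen ((fun ζ : ℂ => z' + ζ • (Pi.single i 1 : Fin n → ℂ)) ⁻¹' V) := hV.preimage (line_cont _ _)
  have := thm1D (slice_psh hφ z' (Pi.single i 1)) (by
    obtain ⟨w, hw⟩ := hg
    exact ⟨(0, w), by simpa using hw⟩) hU
    (f := fun ζ => f (z' + ζ • Pi.single i 1)) 
    (hf.comp (line_cont _ _).continuousOn (fun _ h => h)) (fun ζ hζ => hb _ hζ)
  exact this.differentiableAt (hU.mem_nhds hζ)

theorem local_diff {n m : ℕ} (hm : 0 < m) {φ : (Fin (n + 1) → ℂ) → EReal} (hφ : Plurisubharmonic φ) 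
    (hne : ¬ ∀ z, φ z = ⊥) {D : Set (Fin n → ℂ)} (hD : IsOpen D) {A : (Fin n → ℂ) → (Fin m → ℂ)} 
    (hA : ContinuousOn A D) (hb : ∀ z ∈ D, ∀ w, (PP (A z)).IsRoot w → φ (Fin.snoc z w) = ⊥)
    {z : Fin n → ℂ} (hz : z ∈ D) (hd : dscr (A z) ≠ 0) : DifferentiableAt ℂ A z := by
  obtain ⟨ξ, hξ, hr⟩ := PP_sep_roots hm _ ((dscr_ne hm _).1 hd)
  obtain ⟨B, hBo, hzB, ρ, hρ, hB⟩ := local_roots hm (A z) ξ hξ hr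
  have hV : IsOpen (D ∩ A ⁻¹' B) := hA.isOpen_inter_preimage hD hBo
  have h1 : ∀ k, DifferentiableAt ℂ (fun z => ρ k (A z)) z := by
    intro k
    refine (graph_diff hφ hne hV (f := fun z => ρ k (A z)) 
      ((hρ k).comp (hA.mono inter_subset_left) (fun _ h => h.2)) ?_).differentiableAt (hV.mem_nhds ⟨hz, hzB⟩)
    intro z hz
    exact hb z hz.1 _ ((hB _ hz.2).1 k)
  rw [differentiableAt_pi]
  intro i
  have h2 := prod_coeff_diff Finset.univ (fun k z => ρ k (A z)) z (fun k _ => h1 k) (m - ((i : ℕ) + 1))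
  refine h2.congr_of_eventuallyEq ?_
  filter_upwards [hV.mem_nhds ⟨hz, hzB⟩] with y hy
  rw [← (hB _ hy.2).2, PP_coeff]

theorem delta_diff {n m : ℕ} {D : Set (Fin n → ℂ)} (hD : IsOpen D) {A : (Fin n → ℂ) → (Fin m → ℂ)} 
    (hA : ContinuousOn A D) (hd : ∀ z ∈ D, dscr (A z) ≠ 0 → DifferentiableAt ℂ A z) : 
    DifferentiableOn ℂ (fun z => dscr (A z)) D := by
  have hc : ContinuousOn (fun z => dscr (A z)) D := dscr_diff.continuous.comp_continuousOn hA
  refine osgood hD hc ?_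
  intro z hz i
  have hU : IsOpen ((fun ζ : ℂ => z + ζ • (Pi.single i 1 : Fin n → ℂ)) ⁻¹' D) := hD.preimage (line_cont _ _)
  refine (rado hU (δ := fun ζ => dscr (A (z + ζ • Pi.single i 1)))
    (hc.comp (line_cont _ _).continuousOn (fun _ h => h)) ?_).differentiableAt (hU.mem_nhds (by simpa using hz))
  intro ζ hζ hne
  have h1 := hd _ hζ hne
  have h2 : DifferentiableAt ℂ (fun ζ : ℂ => z + ζ • (Pi.single i 1 : Fin n → ℂ)) ζ := by fun_prop
  have h3 : DifferentiableAt ℂ (dscr ∘ A) (z + ζ • (Pi.single i 1 : Fin n → ℂ)) :=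
    dscr_diff.differentiableAt.comp _ h1
  have h4 := DifferentiableAt.comp (g := dscr ∘ A) ζ h3 h2
  exact h4

theorem slice_zero {n : ℕ} {B : Set (Fin n → ℂ)} (hB : IsOpen B) (hBc : Convex ℝ B) {δ : (Fin n → ℂ) → ℂ}
    (hδ : DifferentiableOn ℂ δ B) (z e : Fin n → ℂ) :
    IsPreconnected ((fun ζ : ℂ => z + ζ • e) ⁻¹' B) ∧ 
    AnalyticOnNhd ℂ (fun ζ : ℂ => δ (z + ζ • e)) ((fun ζ : ℂ => z + ζ • e) ⁻¹' B) := by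
  have hU : IsOpen ((fun ζ : ℂ => z + ζ • e) ⁻¹' B) := hB.preimage (line_cont _ _)
  constructor
  · apply Convex.isPreconnected
    intro x hx y hy s t hs ht hst
    have := hBc hx hy hs ht hst
    refine (congrArg (fun q => q ∈ B) ?_).mp this
    have hz : z = s • z + t • z := by rw [← add_smul, hst, one_smul]
    nth_rw 3 [hz]
    simp only [smul_add, add_smul, smul_assoc]
    abel
  · apply DifferentiableOn.analyticOnNhd _ hU
    refine hδ.comp ?_ (fun _ h => h)
    fun_prop

theorem delta_dense {n : ℕ} {D : Set (Fin n → ℂ)} (hD : IsOpen D) (hDc : IsConnected D) {δ : (Fin n → ℂ) → ℂ}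
    (hδ : DifferentiableOn ℂ δ D) {z₀ : Fin n → ℂ} (hz₀ : z₀ ∈ D) (h0 : δ z₀ ≠ 0)
    {V : Set (Fin n → ℂ)} (hV : IsOpen V) (hVD : V ⊆ D) (hVn : V.Nonempty) : (V ∩ {z | δ z ≠ 0}).Nonempty := by
  by_contra hcon
  obtain ⟨v, hv⟩ := hVn
  have hVz : ∀ x ∈ V, δ x = 0 := by
    intro x hx
    by_contra hx0
    exact hcon ⟨x, hx, hx0⟩
  set Z : Set (Fin n → ℂ) := {x | ∀ᶠ y in nhds x, δ y = 0} with hZ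
  have hZo : IsOpen Z := isOpen_setOfPred_eventually_nhds
  have hsub : D ⊆ Z := by
    apply hDc.isPreconnected.subset_of_closure_inter_subset hZo
    · exact ⟨v, hVD hv, Filter.mem_of_superset (hV.mem_nhds hv) hVz⟩
    · rintro p ⟨hpc, hpD⟩
      obtain ⟨r, hr, hrD⟩ := Metric.isOpen_iff.1 hD p hpD
      obtain ⟨q, hqb, hqZ⟩ := _root_.mem_closure_iff.1 hpc (ball p r) isOpen_ball (mem_ball_self hr)
      refine Filter.mem_of_superset (ball_mem_nhds p hr) ?_
      intro x hx
      obtain ⟨hpre, han⟩ := slice_zero isOpen_ball (convex_ball p r) (hδ.mono hrD) q (x - q)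
      have hE := han.eqOn_zero_of_preconnected_of_eventuallyEq_zero hpre (z₀ := 0) (by simpa using hqb) (by
        have ht : Filter.Tendsto (fun ζ : ℂ => q + ζ • (x - q)) (nhds 0) (nhds q) := by
          have := (line_cont q (x - q)).tendsto 0
          simpa using this
        exact ht.eventually hqZ)
      have := hE (x := 1) (by simpa using hx)
      simpa using this
  exact h0 (hsub hz₀).self_of_nhds

theorem final_diff {n m : ℕ} {D : Set (Fin n → ℂ)} (hD : IsOpen D) (hDc : IsConnected D) 
    {A : (Fin n → ℂ) → (Fin m → ℂ)} 
    (hA : ContinuousOn A D) (hd : ∀ z ∈ D, dscr (A z) ≠ 0 → DifferentiableAt ℂ A z)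
    {z₀ : Fin n → ℂ} (hz₀ : z₀ ∈ D) (h0 : dscr (A z₀) ≠ 0) (j : Fin m) : 
    DifferentiableOn ℂ (fun z => A z j) D := by
  have hδ := delta_diff hD hA hd
  have hAj : ContinuousOn (fun z => A z j) D := (continuous_apply j).comp_continuousOn hA
  intro p hp
  apply DifferentiableAt.differentiableWithinAt
  obtain ⟨r, hr, hrD⟩ := Metric.isOpen_iff.1 hD p hp
  refine (osgood isOpen_ball (hAj.mono hrD) ?_).differentiableAt (ball_mem_nhds p hr)
  intro z hz i
  refine slice_limit (G := {z | dscr (A z) ≠ 0}) isOpen_ball (hAj.mono hrD) (norm_single_le i) 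
    (fun W hW hWs hWn => delta_dense hD hDc hδ hz₀ h0 hW (hWs.trans hrD) hWn) ?_ hz
  intro z' hz' hg ζ hζ
  obtain ⟨hpre, han⟩ := slice_zero isOpen_ball (convex_ball p r) (hδ.mono hrD) z' (Pi.single i 1)
  have hU : IsOpen ((fun ζ : ℂ => z' + ζ • (Pi.single i 1 : Fin n → ℂ)) ⁻¹' (ball p r)) := 
    isOpen_ball.preimage (line_cont _ _)
  have hev : ∀ᶠ ζ' in nhdsWithin ζ {ζ}ᶜ, dscr (A (z' + ζ' • Pi.single i 1)) ≠ 0 := by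
    rcases (han ζ hζ).eventually_eq_zero_or_eventually_ne_zero with h | h
    · exfalso
      have := han.eqOn_zero_of_preconnected_of_eventuallyEq_zero hpre hζ h (x := 0) (by simpa using hz')
      apply hg
      simpa using this
    · exact h
  apply AnalyticAt.differentiableAt (𝕜 := ℂ)
  apply Complex.analyticAt_of_differentiable_on_punctured_nhds_of_continuousAt
  · filter_upwards [hev, nhdsWithin_le_nhds (hU.mem_nhds hζ)] with ζ' h1 h2
    have h3 := differentiableAt_pi.1 (hd _ (hrD h2) h1) j
    have h4 : DifferentiableAt ℂ (fun ζ : ℂ => z' + ζ • (Pi.single i 1 : Fin n → ℂ)) ζ' := by fun_prop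
    exact h3.comp ζ' h4
  · have : ContinuousOn (fun ζ : ℂ => A (z' + ζ • Pi.single i 1) j) 
        ((fun ζ : ℂ => z' + ζ • (Pi.single i 1 : Fin n → ℂ)) ⁻¹' (ball p r)) :=
      (hAj.mono hrD).comp (line_cont _ _).continuousOn (fun _ h => h)
    exact this.continuousAt (hU.mem_nhds hζ)

/-- If `𝓔` is pluripolar and at some point `z₀ ∈ D` the polynomial `P(z₀, ·)` has `m`
pairwise distinct roots, then `a₁, …, a_m` are holomorphic on `D`. -/
theorem holomorphic_of_pluripolar_of_simple_roots
    {n m : ℕ} (hm : 0 < m) (D : Set (Fin n → ℂ))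
    (hDopen : IsOpen D) (hDconn : IsConnected D)
    (a : Fin m → (Fin n → ℂ) → ℂ) (ha : ∀ i, ContinuousOn (a i) D)
    (hE : Pluripolar {p : Fin (n + 1) → ℂ | ∃ z ∈ D, ∃ w : ℂ, p = Fin.snoc z w ∧
        w ^ m + ∑ i : Fin m, a i z * w ^ (m - ((i : ℕ) + 1)) = 0})
    (z₀ : Fin n → ℂ) (hz₀ : z₀ ∈ D)
    (ξ : Fin m → ℂ) (hξ : Function.Injective ξ)
    (hroots : ∀ w : ℂ,
      w ^ m + ∑ i : Fin m, a i z₀ * w ^ (m - ((i : ℕ) + 1)) = ∏ j : Fin m, (w - ξ j)) :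
    ∀ i, DifferentiableOn ℂ (a i) D := by
  obtain ⟨φ, hφ, hne, hb⟩ := hE
  have hA : ContinuousOn (fun z i => a i z) D := continuousOn_pi.2 ha
  have h0 : dscr (fun i => a i z₀) ≠ 0 := by
    rw [dscr_ne hm]
    apply PP_sep_of _ ξ hξ
    apply Polynomial.funext
    intro w
    rw [PP_eval, hroots w, eval_prod]
    simp
  intro i
  refine final_diff hDopen hDconn hA (fun z hz hd => ?_) hz₀ h0 i
  refine local_diff hm hφ hne hDopen hA ?_ hz hd
  intro z hz w hw
  refine hb _ ⟨z, hz, w, rfl, ?_⟩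
  rw [← PP_eval]
  exact hw
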